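/- Let d ≥ 3 and p ∈ (p_c^site(ℤ^d), 1 − p_c^site(ℤ^d)). Then ℙ_p(S_∞ = Ξ) = 1, i.e. almost surely every infinite binary word is seen from some vertex of ℤ^d. -/

import Mathlib

open MeasureTheory Set

namespace PercWords

/-- Vertices of the hypercubic lattice `ℤ^d`. -/
abbrev Vtx (d : ℕ) := Fin d → ℤ

/-- Site percolation configurations on `ℤ^d` (`true` = state 1, `false` = state 0). -/
abbrev Config (d : ℕ) := Vtx d → Bool

/-- `u ∼ v` : the Euclidean distance between `u` and `v` is `1`. -/
def adj {d : ℕ} (u v : Vtx d) : Prop := (∑ i, (u i - v i) ^ 2) = 1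

/-- `μ` is Bernoulli site percolation with parameter `p` on the index set `ι`:
a probability measure under which, independently, each site has state `true`
with probability `p` and state `false` with probability `1 - p`. -/
def IsBernoulliFam {ι : Type} (p : ℝ) (μ : Measure (ι → Bool)) : Prop :=
  IsProbabilityMeasure μ ∧
    ∀ (s : Finset ι) (f : ι → Bool),
      μ {ω | ∀ v ∈ s, ω v = f v} =
        ∏ v ∈ s, ENNReal.ofReal (if f v then p else 1 - p)

/-- The word `ξ` is seen from `v` along an infinite self-avoiding path all of whose
vertices lie in `A`. -/
def seesWordIn {d : ℕ} (ω : Config d) (ξ : ℕ → Bool) (A : Set (Vtx d)) (v : Vtx d) : Prop :=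
  ∃ γ : ℕ → Vtx d, γ 0 = v ∧ Function.Injective γ ∧
    (∀ i, adj (γ i) (γ (i + 1))) ∧ (∀ i, γ i ∈ A) ∧ (∀ i, ω (γ i) = ξ i)

/-- The word `ξ` is seen from `v` in the configuration `ω`. -/
def seesWord {d : ℕ} (ω : Config d) (ξ : ℕ → Bool) (v : Vtx d) : Prop :=
  seesWordIn ω ξ Set.univ v

/-- `v` lies in an infinite connected set of `1`-vertices of `ω`. -/
def PercolatesAt {d : ℕ} (ω : Config d) (v : Vtx d) : Prop :=
  ∃ C : Set (Vtx d), v ∈ C ∧ C.Infinite ∧ (∀ u ∈ C, ω u = true) ∧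
    ∀ u₁ ∈ C, ∀ u₂ ∈ C, ∃ n : ℕ, ∃ γ : ℕ → Vtx d,
      γ 0 = u₁ ∧ γ n = u₂ ∧ (∀ i < n, adj (γ i) (γ (i + 1))) ∧ (∀ i ≤ n, γ i ∈ C)

/-- The critical point of Bernoulli site percolation on `ℤ^d`, relative to a family
`ℙ p` of Bernoulli site percolation measures: the infimum of the set of parameters
for which the origin lies in an infinite connected set of `1`-vertices with positive
probability. -/
noncomputable def pcSite (d : ℕ) (ℙ : ℝ → Measure (Config d)) : ℝ :=
  sInf {p : ℝ | p ∈ Set.Icc (0 : ℝ) 1 ∧ 0 < ℙ p {ω | PercolatesAt ω (fun _ => 0)}}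


set_option linter.all false

/-! ### Tools on product spaces -/

def Dep {ι E : Type*} (A : Set (ι → E)) (S : Set ι) : Prop :=
  ∀ ω ω' : ι → E, (∀ i ∈ S, ω i = ω' i) → (ω ∈ A ↔ ω' ∈ A)

section dep
variable {ι E : Type*}

lemma Dep.mono {A : Set (ι → E)} {S T : Set ι} (h : Dep A S) (hST : S ⊆ T) : Dep A T :=
  fun ω ω' hh => h ω ω' fun i hi => hh i (hST hi)

lemma Dep.inter {A B : Set (ι → E)} {S : Set ι} (h : Dep A S) (h' : Dep B S) :
    Dep (A ∩ B) S :=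
  fun ω ω' hh => and_congr (h ω ω' hh) (h' ω ω' hh)

lemma Dep.compl {A : Set (ι → E)} {S : Set ι} (h : Dep A S) : Dep Aᶜ S :=
  fun ω ω' hh => not_congr (h ω ω' hh)

lemma dep_of {A : Set (ι → E)} {S : Set ι}
    (h : ∀ ω ω' : ι → E, (∀ i ∈ S, ω i = ω' i) → ω ∈ A → ω' ∈ A) : Dep A S :=
  fun ω ω' hh => ⟨h ω ω' hh, h ω' ω fun i hi => (hh i hi).symm⟩

lemma Dep.meas [MeasurableSpace E] [Finite E] [MeasurableSingletonClass E]
    {A : Set (ι → E)} {S : Set ι} (hS : S.Finite) (h : Dep A S) : MeasurableSet A := by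
  classical
  have : Finite S := hS
  have e : A = (fun (ω : ι → E) (i : S) => ω i) ⁻¹' ((fun (ω : ι → E) (i : S) => ω i) '' A) := by
    ext ω
    constructor
    · exact fun hω => ⟨ω, hω, rfl⟩
    · rintro ⟨ω', h', e'⟩
      exact (h ω' ω fun i hi => congrFun e' ⟨i, hi⟩).1 h'
  rw [e]
  exact (measurable_pi_lambda _ fun i => measurable_pi_apply _) (Set.toFinite _).measurableSet

lemma indep_of_dep [MeasurableSpace E] (ρ : ι → Measure E) [∀ i, IsProbabilityMeasure (ρ i)]
    {A B : Set (ι → E)} {S T : Set ι} (hA : MeasurableSet A) (hB : MeasurableSet B)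
    (dA : Dep A S) (dB : Dep B T) (hST : Disjoint S T) :
    Measure.infinitePi ρ (A ∩ B) = Measure.infinitePi ρ A * Measure.infinitePi ρ B := by
  classical
  by_cases hne : Nonempty E
  swap
  · by_cases hi : Nonempty ι
    · obtain ⟨i⟩ := hi
      exact absurd (inferInstance : IsProbabilityMeasure (ρ i)).1 (by
        have : (univ : Set E) = ∅ := by
          rw [not_nonempty_iff] at hne; exact Set.univ_eq_empty_iff.2 hne
        simp [this])
    · rw [not_nonempty_iff] at hi
      rcases A.eq_empty_or_nonempty with h | ⟨a, ha⟩
      · simp [h]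
      rcases B.eq_empty_or_nonempty with h | ⟨b, hb⟩
      · simp [h]
      have h1 : A = univ := Set.eq_univ_of_forall fun x => Subsingleton.elim a x ▸ ha
      have h2 : B = univ := Set.eq_univ_of_forall fun x => Subsingleton.elim b x ▸ hb
      simp [h1, h2]
  obtain ⟨e0⟩ := hne
  set m : ι → MeasurableSpace (ι → E) := fun i => MeasurableSpace.comap (fun ω => ω i) inferInstance
  have hind : ProbabilityTheory.iIndep m (Measure.infinitePi ρ) :=
    ProbabilityTheory.iIndepFun_infinitePi (X := fun _ x => x) (fun i => measurable_id)
  have hle : ∀ i, m i ≤ MeasurableSpace.pi := fun i => (measurable_pi_apply i).comap_le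
  have key : ∀ (C : Set (ι → E)) (R : Set ι), MeasurableSet C → Dep C R →
      MeasurableSet[⨆ i ∈ R, m i] C := by
    intro C R hC dC
    have : C = (fun (ω : ι → E) i => if i ∈ R then ω i else e0) ⁻¹' C := by
      ext ω
      exact dC _ _ fun i hi => by simp [hi]
    rw [this]
    refine @measurable_pi_lambda _ _ _ (⨆ i ∈ R, m i) _ _ (fun i => ?_) _ hC
    by_cases hi : i ∈ R
    · simp only [hi, if_true]
      have : m i ≤ ⨆ i ∈ R, m i := le_iSup₂_of_le i hi le_rfl
      exact Measurable.mono (ma := m i) (comap_measurable _) this le_rfl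
    · simp only [hi, if_false]
      exact measurable_const
  exact (ProbabilityTheory.Indep_iff _ _ _).1
    (ProbabilityTheory.indep_iSup_of_disjoint hle hind hST) A B (key A S hA dA) (key B T hB dB)

/-- closing lemma -/
lemma closing [MeasurableSpace E] [MeasurableSingletonClass E] [Countable ι] (ρ : ι → Measure E)
    [∀ i, IsProbabilityMeasure (ρ i)] {A B : Set (ι → E)} (e0 : E) (b : ENNReal)
    (V : (ι → E) → Finset ι) (t : ℕ)
    (hb1 : b ≤ 1) (hb : ∀ v : Finset ι, (A ∩ {ω | V ω = v}).Nonempty → ∀ i ∈ v, b ≤ ρ i {e0})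
    (hm : ∀ v, MeasurableSet (A ∩ {ω | V ω = v}))
    (hd : ∀ v, Dep (A ∩ {ω | V ω = v}) (v : Set ι)ᶜ)
    (ht : ∀ ω ∈ A, (V ω).card ≤ t)
    (hAB : ∀ ω ∈ A, (∀ i ∈ V ω, ω i = e0) → ω ∈ B) :
    Measure.infinitePi ρ A * b ^ t ≤ Measure.infinitePi ρ B := by
  classical
  set μ := Measure.infinitePi ρ
  set cl : Finset ι → Set (ι → E) := fun v => Set.pi v (fun _ => {e0})
  have hcl : ∀ v, MeasurableSet (cl v) := fun v =>
    MeasurableSet.pi v.countable_toSet fun _ _ => measurableSet_singleton _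
  have h1 : ∀ v, μ (A ∩ {ω | V ω = v}) * b ^ t ≤ μ (A ∩ {ω | V ω = v} ∩ cl v) := by
    intro v
    rcases (A ∩ {ω | V ω = v}).eq_empty_or_nonempty with h | ⟨ω, hω⟩
    · simp [h]
    rw [indep_of_dep ρ (hm v) (hcl v) (hd v) (T := v) _ disjoint_compl_left]
    · gcongr
      rw [Measure.infinitePi_pi _ fun _ _ => measurableSet_singleton _]
      calc b ^ t ≤ b ^ v.card := pow_le_pow_right_of_le_one' hb1 (hω.2 ▸ ht ω hω.1)
        _ = ∏ _i ∈ v, b := by simp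
        _ ≤ _ := Finset.prod_le_prod' fun i hi => hb v ⟨ω, hω⟩ i hi
    · refine dep_of fun ω ω' h h' i hi => ?_
      have := h' i hi
      rwa [h i hi] at this
  calc μ A * b ^ t ≤ (∑' v, μ (A ∩ {ω | V ω = v})) * b ^ t := by
        gcongr
        refine (measure_mono ?_).trans (measure_iUnion_le _)
        intro ω hω
        exact mem_iUnion.2 ⟨V ω, hω, rfl⟩
    _ = ∑' v, μ (A ∩ {ω | V ω = v}) * b ^ t := ENNReal.tsum_mul_right.symm
    _ ≤ ∑' v, μ (A ∩ {ω | V ω = v} ∩ cl v) := ENNReal.tsum_le_tsum h1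
    _ = μ (⋃ v, A ∩ {ω | V ω = v} ∩ cl v) := by
        rw [measure_iUnion _ fun v => (hm v).inter (hcl v)]
        intro v w hvw
        refine Set.disjoint_left.2 fun ω h h' => hvw ?_
        exact h.1.2.symm.trans h'.1.2
    _ ≤ μ B := by
        refine measure_mono (iUnion_subset fun v ω h => hAB ω h.1.1 fun i hi => ?_)
        have h2 : V ω = v := h.1.2
        rw [h2] at hi
        exact h.2 i hi

end dep

/-! ### Abstract renormalisation -/

abbrev Cell := ℤ × ℤ

def near1 (a b : Cell) : Prop := |a.1 - b.1| + |a.2 - b.2| ≤ 1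

structure Ker {Ω : Type*} [mΩ : MeasurableSpace Ω] (μ : Measure Ω) (F : ℕ → MeasurableSpace Ω)
    (S : ℕ → Ω → Set Cell) (ε : ENNReal) : Prop where
  mono : Monotone F
  le : ∀ t, F t ≤ mΩ
  meas : ∀ t k, MeasurableSet[F t] {ω | k ∈ S t ω}
  bound : ∀ t A, MeasurableSet[F t] A → ∀ (J : Finset Cell) (f : Cell → Cell),
    (∀ j ∈ J, near1 (f j) j) → (∀ ω ∈ A, ∀ j ∈ J, j ∈ S t ω) →
    μ (A ∩ {ω | ∀ j ∈ J, f j ∉ S (t + 1) ω}) ≤ ε ^ J.card * μ A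

section ker
variable {Ω : Type*} [mΩ : MeasurableSpace Ω] {μ : Measure Ω} {F : ℕ → MeasurableSpace Ω}
    {S : ℕ → Ω → Set Cell} {ε : ENNReal}

lemma Ker.bound' (h : Ker μ F S ε) {K : Type*} [DecidableEq K] (t : ℕ) (A : Set Ω)
    (hA : MeasurableSet[F t] A)
    (J : Finset K) (g f : K → Cell) (hg : Set.InjOn g J) (hf : ∀ j ∈ J, near1 (f j) (g j))
    (hS : ∀ ω ∈ A, ∀ j ∈ J, g j ∈ S t ω) :
    μ (A ∩ {ω | ∀ j ∈ J, f j ∉ S (t + 1) ω}) ≤ ε ^ J.card * μ A := by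
  classical
  rcases J.eq_empty_or_nonempty with rfl | ⟨k0, hk0⟩
  · simpa using measure_mono Set.inter_subset_left
  haveI : Nonempty K := ⟨k0⟩
  have inv : ∀ j ∈ J, Function.invFunOn g J (g j) = j := fun j hj =>
    hg.leftInvOn_invFunOn hj
  have := h.bound t A hA (J.image g) (fun c => f (Function.invFunOn g J c)) (by
    intro c hc
    obtain ⟨j, hj, rfl⟩ := Finset.mem_image.1 hc
    rw [inv j hj]; exact hf j hj) (by
    intro ω hω c hc
    obtain ⟨j, hj, rfl⟩ := Finset.mem_image.1 hc
    exact hS ω hω j hj)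
  rw [Finset.card_image_of_injOn hg] at this
  refine le_trans (measure_mono ?_) this
  rintro ω ⟨h1, h2⟩
  refine ⟨h1, fun c hc => ?_⟩
  obtain ⟨j, hj, rfl⟩ := Finset.mem_image.1 hc
  rw [inv j hj]; exact h2 j hj

lemma Ker.path (h : Ker μ F S ε) {K : Type*} [DecidableEq K] (T : ℕ) :
    ∀ (t : ℕ) (A : Set Ω) (_ : MeasurableSet[F t] A) (J : Finset K) (pos : ℕ → K → Cell)
    (_ : ∀ r, Set.InjOn (pos r) J) (_ : ∀ r, ∀ j ∈ J, near1 (pos (r + 1) j) (pos r j))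
    (_ : ∀ ω ∈ A, ∀ j ∈ J, pos 0 j ∈ S t ω),
    μ (A ∩ {ω | ∀ j ∈ J, pos T j ∉ S (t + T) ω}) ≤ ((T : ENNReal) * ε) ^ J.card * μ A := by
  classical
  induction T with
  | zero =>
    intro t A hA J pos h1 h2 h3
    rcases J.eq_empty_or_nonempty with rfl | ⟨k0, hk0⟩
    · simpa using measure_mono Set.inter_subset_left
    have : A ∩ {ω | ∀ j ∈ J, pos 0 j ∉ S (t + 0) ω} = ∅ := by
      ext ω
      simp only [mem_inter_iff, mem_setOf_eq, mem_empty_iff_false, iff_false, not_and]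
      exact fun hω hh => hh k0 hk0 (h3 ω hω k0 hk0)
    rw [this]; simp
  | succ T ih =>
    intro t A hA J pos h1 h2 h3
    set A' : Finset K → Set Ω := fun P =>
      A ∩ ⋂ j ∈ J, {ω | pos 1 j ∉ S (t + 1) ω ↔ j ∈ P} with hA'
    have mA' : ∀ P, MeasurableSet[F (t + 1)] (A' P) := by
      intro P
      refine MeasurableSet.inter (h.mono (Nat.le_succ t) _ hA) ?_
      refine Finset.measurableSet_biInter _ fun j _ => ?_
      by_cases hj : j ∈ P
      · simp only [hj, iff_true]; exact (h.meas (t + 1) _).compl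
      · simp only [hj, iff_false, not_not]; exact h.meas (t + 1) _
    have memA' : ∀ P ω, ω ∈ A' P ↔ ω ∈ A ∧ ∀ j ∈ J, (pos 1 j ∉ S (t + 1) ω ↔ j ∈ P) := by
      intro P ω; simp [hA']
    have cover : A ∩ {ω | ∀ j ∈ J, pos (T + 1) j ∉ S (t + (T + 1)) ω} ⊆
        ⋃ P ∈ J.powerset, (A' P ∩ {ω | ∀ j ∈ J \ P, pos (T + 1) j ∉ S (t + 1 + T) ω}) := by
      rintro ω ⟨hω, hd⟩
      refine mem_biUnion (x := J.filter fun j => pos 1 j ∉ S (t + 1) ω)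
        (by rw [SetLike.mem_coe, Finset.mem_powerset]; exact Finset.filter_subset _ _) ⟨?_, ?_⟩
      · rw [memA']; exact ⟨hω, fun j hj => by simp [hj]⟩
      · intro j hj
        rw [Finset.mem_sdiff] at hj
        have := hd j hj.1
        rwa [show t + (T + 1) = t + 1 + T by ring] at this
    have b1 : ∀ P ∈ J.powerset, μ (A' P) ≤ ε ^ P.card * μ A := by
      intro P hP
      rw [Finset.mem_powerset] at hP
      refine le_trans (measure_mono ?_) (h.bound' t A hA P (pos 0) (pos 1)
        ((h1 0).mono hP) (fun j hj => h2 0 j (hP hj)) fun ω hω j hj => h3 ω hω j (hP hj))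
      intro ω hω
      rw [memA'] at hω
      exact ⟨hω.1, fun j hj => (hω.2 j (hP hj)).2 hj⟩
    have b2 : ∀ P ∈ J.powerset,
        μ (A' P ∩ {ω | ∀ j ∈ J \ P, pos (T + 1) j ∉ S (t + 1 + T) ω}) ≤
        ε ^ P.card * ((T : ENNReal) * ε) ^ (J.card - P.card) * μ A := by
      intro P hP
      have := ih (t + 1) (A' P) (mA' P) (J \ P) (fun r => pos (r + 1))
        (fun r => (h1 _).mono (by simp)) (fun r j hj => h2 _ j (Finset.mem_sdiff.1 hj).1)
        (fun ω hω j hj => by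
          rw [memA'] at hω
          rw [Finset.mem_sdiff] at hj
          by_contra hc
          exact hj.2 ((hω.2 j hj.1).1 hc))
      refine this.trans ?_
      rw [Finset.card_sdiff_of_subset (Finset.mem_powerset.1 hP)]
      calc _ ≤ ((T : ENNReal) * ε) ^ (J.card - P.card) * (ε ^ P.card * μ A) := by
            gcongr; exact b1 P hP
        _ = _ := by ring
    calc _ ≤ ∑ P ∈ J.powerset, μ (A' P ∩ {ω | ∀ j ∈ J \ P, pos (T + 1) j ∉ S (t + 1 + T) ω}) :=
          (measure_mono cover).trans (measure_biUnion_finset_le _ _)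
      _ ≤ ∑ P ∈ J.powerset, ε ^ P.card * ((T : ENNReal) * ε) ^ (J.card - P.card) * μ A :=
          Finset.sum_le_sum b2
      _ = _ := by
          rw [← Finset.sum_mul, Finset.sum_pow_mul_eq_add_pow]
          push_cast
          ring

lemma Ker.sub (h : Ker μ F S ε) (o : ℕ) : Ker μ (fun t => F (t + o)) (fun t => S (t + o)) ε where
  mono := fun a b hab => h.mono (by omega)
  le := fun t => h.le _
  meas := fun t k => h.meas _ _
  bound := fun t A hA J f h1 h2 => by
    have := h.bound (t + o) A hA J f h1 h2
    rwa [show t + o + 1 = t + 1 + o by ring] at this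

/-- straight path from `0` to `v` : first coordinate first -/
def clampZ (r : ℕ) (v : ℤ) : ℤ := max (-(r : ℤ)) (min r v)

def spath (r : ℕ) (v : Cell) : Cell :=
  (clampZ r v.1, clampZ (r - v.1.natAbs) v.2)

lemma spath_zero (v : Cell) : spath 0 v = (0, 0) := by
  simp [spath, clampZ]

lemma spath_end (r : ℕ) (v : Cell) (h : |v.1| + |v.2| ≤ r) : spath r v = v := by
  obtain ⟨a, b⟩ := v
  simp only [spath, clampZ, Int.abs_eq_natAbs] at *
  ext <;> simp only [] <;> omega

lemma spath_near (r : ℕ) (v : Cell) : near1 (spath (r + 1) v) (spath r v) := by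
  obtain ⟨a, b⟩ := v
  simp only [spath, clampZ, near1, Int.abs_eq_natAbs] at *
  omega

lemma spath_bd (r : ℕ) (v : Cell) : |(spath r v).1| ≤ |v.1| ∧ |(spath r v).2| ≤ |v.2| := by
  obtain ⟨a, b⟩ := v
  simp only [spath, clampZ, Int.abs_eq_natAbs] at *
  omega

end ker

noncomputable def QQ (g : ℕ) (κ : Cell) : Finset Cell :=
  Finset.Ico ((g : ℤ) * κ.1) (g * κ.1 + g) ×ˢ Finset.Ico ((g : ℤ) * κ.2) (g * κ.2 + g)

lemma card_QQ (g : ℕ) (κ : Cell) : (QQ g κ).card = g ^ 2 := by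
  simp [QQ, Finset.card_product, sq]

noncomputable def VV (g : ℕ) (a b : Cell) : Finset Cell :=
  Finset.Ico ((g : ℤ) * b.1 - g * a.1 - g) (g * b.1 - g * a.1 + g) ×ˢ
    Finset.Ico ((g : ℤ) * b.2 - g * a.2 - g) (g * b.2 - g * a.2 + g)

lemma card_VV (g : ℕ) (a b : Cell) : (VV g a b).card = 4 * g ^ 2 := by
  simp only [VV, Finset.card_product, Int.card_Ico]
  have : ∀ x : ℤ, (x + g - (x - g)).toNat = 2 * g := fun x => by omega
  rw [this, this]; ring

open Classical in
noncomputable def coarse (g : ℕ) (S : Set Cell) : Set Cell :=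
  {κ | g ^ 2 ≤ 2 * ((QQ g κ).filter (· ∈ S)).card}

lemma shift_pairs (g : ℕ) (hg : 0 < g) (a b : Cell) (X Y : Finset Cell) (hX : X ⊆ QQ g a)
    (hY : Y ⊆ QQ g b) (h1 : g ^ 2 ≤ 2 * X.card) (h2 : g ^ 2 ≤ 2 * Y.card) :
    ∃ v ∈ VV g a b, ∃ Z ⊆ X, Z.card = g ^ 2 / 16 ∧ ∀ x ∈ Z, x + v ∈ Y := by
  classical
  obtain ⟨v, hv, hc⟩ := Finset.exists_le_card_fiber_of_mul_le_card_of_maps_to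
    (s := X ×ˢ Y) (t := VV g a b) (f := fun q => q.2 - q.1) (n := g ^ 2 / 16) (by
      rintro ⟨x, y⟩ hq
      rw [Finset.mem_product] at hq
      have h3 := hX hq.1
      have h4 := hY hq.2
      simp only [QQ, VV, Finset.mem_product, Finset.mem_Ico, Prod.fst_sub, Prod.snd_sub] at *
      omega) (by
      rw [← Finset.card_pos, card_VV]; positivity) (by
      rw [card_VV, Finset.card_product]
      have := Nat.div_mul_le_self (g ^ 2) 16
      nlinarith [Nat.mul_le_mul h1 h2, Nat.mul_le_mul_left (4 * g ^ 2) this])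
  set W := ((X ×ˢ Y).filter fun q => q.2 - q.1 = v).image Prod.fst with hW
  have hWc : W.card = ((X ×ˢ Y).filter fun q => q.2 - q.1 = v).card := by
    apply Finset.card_image_of_injOn
    rintro ⟨x, y⟩ hq ⟨x', y'⟩ hq' e
    simp only [Finset.coe_filter, Finset.mem_product, Set.mem_setOf_eq] at hq hq' e
    have : y = y' := by rw [sub_eq_iff_eq_add.1 hq.2, sub_eq_iff_eq_add.1 hq'.2, e]
    rw [e, this]
  obtain ⟨Z, hZ, hZc⟩ := Finset.exists_subset_card_eq (hWc.symm ▸ hc)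
  have memW : ∀ x ∈ W, x ∈ X ∧ x + v ∈ Y := by
    intro x hx
    simp only [hW, Finset.mem_image, Finset.mem_filter, Finset.mem_product] at hx
    obtain ⟨⟨x', y⟩, ⟨⟨h5, h6⟩, h7⟩, rfl⟩ := hx
    refine ⟨h5, ?_⟩
    rw [← h7]; simpa using h6
  exact ⟨v, hv, Z, fun x hx => (memW x (hZ hx)).1, hZc, fun x hx => (memW x (hZ hx)).2⟩

lemma mod_class (J : Finset Cell) (n : ℕ) (hn : 0 < n) : ∃ J1 ⊆ J, J.card ≤ n ^ 2 * J1.card ∧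
    ∀ a ∈ J1, ∀ b ∈ J1, a.1 % n = b.1 % n ∧ a.2 % n = b.2 % n := by
  classical
  have hn' : (0 : ℤ) < n := by exact_mod_cast hn
  have hne : (Finset.Ico (0 : ℤ) n ×ˢ Finset.Ico (0 : ℤ) n).Nonempty :=
    ⟨(0, 0), by simp [hn]⟩
  obtain ⟨y, hy, hc⟩ := Finset.exists_le_card_fiber_of_nsmul_le_card_of_maps_to
    (M := ℚ) (s := J) (t := Finset.Ico (0 : ℤ) n ×ˢ Finset.Ico (0 : ℤ) n)
    (f := fun a => (a.1 % n, a.2 % n)) (b := (J.card : ℚ) / (n : ℚ) ^ 2) (by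
      intro a _
      simp [Int.emod_nonneg _ hn'.ne', Int.emod_lt_of_pos _ hn']) hne (by
      simp only [Finset.card_product, Int.card_Ico, nsmul_eq_mul]
      have : (n : ℚ) ≠ 0 := by exact_mod_cast hn.ne'
      simp; field_simp; rfl)
  refine ⟨J.filter fun a => (a.1 % (n : ℤ), a.2 % (n : ℤ)) = y, Finset.filter_subset _ _, ?_, ?_⟩
  rotate_left
  · intro a ha b hb
    have h1 := (Finset.mem_filter.1 ha).2
    have h2 := (Finset.mem_filter.1 hb).2
    have := h1.trans h2.symm
    simpa using this
  · have hn2 : (0 : ℚ) < (n : ℚ) ^ 2 := by positivity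
    rw [div_le_iff₀ hn2] at hc
    have : (J.card : ℚ) ≤ (n ^ 2 * (J.filter fun a => (a.1 % (n : ℤ), a.2 % (n : ℤ)) = y).card : ℕ) := by
      push_cast; linarith
    exact_mod_cast this

section ker
variable {Ω : Type*} [mΩ : MeasurableSpace Ω] {μ : Measure Ω} {F : ℕ → MeasurableSpace Ω}
    {S : ℕ → Ω → Set Cell} {ε : ENNReal}

lemma meas_coarse (m : MeasurableSpace Ω) (S : Ω → Set Cell) (g : ℕ) (κ : Cell)
    (h : ∀ k, MeasurableSet[m] {ω | k ∈ S ω}) :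
    MeasurableSet[m] {ω | κ ∈ coarse g (S ω)} := by
  classical
  have : {ω | κ ∈ coarse g (S ω)} = ⋃ P ∈ (QQ g κ).powerset.filter (fun P => g ^ 2 ≤ 2 * P.card),
      ⋂ x ∈ QQ g κ, {ω | x ∈ S ω ↔ x ∈ P} := by
    ext ω
    simp only [mem_iUnion, mem_iInter, coarse]
    constructor
    · intro hω
      have hω' : g ^ 2 ≤ 2 * ((QQ g κ).filter (· ∈ S ω)).card := hω
      exact ⟨(QQ g κ).filter (· ∈ S ω), Finset.mem_filter.2
        ⟨Finset.mem_powerset.2 (Finset.filter_subset _ _), hω'⟩,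
        fun x hx => by change x ∈ S ω ↔ _; simp [hx]⟩
    · rintro ⟨P, hP, h⟩
      rw [Finset.mem_filter, Finset.mem_powerset] at hP
      have : (QQ g κ).filter (· ∈ S ω) = P := by
        ext x
        rw [Finset.mem_filter]
        exact ⟨fun hx => (h x hx.1).1 hx.2, fun hx => ⟨hP.1 hx, (h x (hP.1 hx)).2 hx⟩⟩
      change g ^ 2 ≤ 2 * ((QQ g κ).filter (· ∈ S ω)).card
      rw [this]; exact hP.2
  rw [this]
  refine Finset.measurableSet_biUnion _ fun P _ => Finset.measurableSet_biInter _ fun x _ => ?_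
  by_cases hx : x ∈ P
  · simp only [hx, iff_true]; exact h x
  · simp only [hx, iff_false]; exact (h x).compl

lemma Ker.coarse (h : Ker μ F S ε) (g T : ℕ) (hg : 0 < g) (hT : T = 3 * g) (ε' : ENNReal)
    (hε1 : ε' ≤ 1)
    (hε : (4 * (g : ENNReal) ^ 2 * 2 ^ (g ^ 2)) * (T * ε) ^ (g ^ 2 / 16) ≤ ε' ^ 64) :
    Ker μ (fun u => F (T * u)) (fun u ω => coarse g (S (T * u) ω)) ε' where
  mono := fun a b hab => h.mono (Nat.mul_le_mul_left _ hab)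
  le := fun t => h.le _
  meas := fun t k => meas_coarse _ _ _ _ fun k => h.meas _ _
  bound := by
    classical
    intro t A hA J f hf hS
    obtain ⟨J1, hJ1, hcard, hmod⟩ := mod_class J 8 (by norm_num)
    set n0 := g ^ 2 / 16
    set Ch : Finset (J1 → Cell × Finset Cell) := Fintype.piFinset fun j : J1 =>
      VV g j (f j) ×ˢ (QQ g j).powersetCard n0 with hCh
    set AA : (J1 → Cell × Finset Cell) → Set Ω := fun c =>
      A ∩ ⋂ j : J1, ⋂ x ∈ (c j).2, {ω | x ∈ S (T * t) ω} with hAA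
    set KJ : (J1 → Cell × Finset Cell) → Finset (Σ _ : J1, Cell) := fun c =>
      Finset.univ.sigma fun j => (c j).2
    set pos : (J1 → Cell × Finset Cell) → ℕ → (Σ _ : J1, Cell) → Cell := fun c r k =>
      k.2 + spath r (c k.1).1
    have mAA : ∀ c, MeasurableSet[F (T * t)] (AA c) := fun c =>
      MeasurableSet.inter hA <| MeasurableSet.iInter fun j =>
        Finset.measurableSet_biInter _ fun x _ => h.meas _ _
    have hv : ∀ c ∈ Ch, ∀ j : J1, |(c j).1.1| ≤ 2 * g ∧ |(c j).1.2| ≤ 2 * g ∧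
        |(c j).1.1| + |(c j).1.2| ≤ T := by
      intro c hc j
      have := (Finset.mem_product.1 (Fintype.mem_piFinset.1 hc j)).1
      simp only [VV, Finset.mem_product, Finset.mem_Ico] at this
      have h1 := hf j (hJ1 j.2)
      simp only [near1] at h1
      obtain ⟨⟨h2, h3⟩, h4, h5⟩ := this
      set e1 := (f j).1 - (j : Cell).1
      set e2 := (f j).2 - (j : Cell).2
      have he1 : (g : ℤ) * (f j).1 - g * (j : Cell).1 = g * e1 := by ring
      have he2 : (g : ℤ) * (f j).2 - g * (j : Cell).2 = g * e2 := by ring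
      rw [he1] at h2 h3; rw [he2] at h4 h5
      have hcase : (e1 = 0 ∧ (e2 = 0 ∨ e2 = 1 ∨ e2 = -1)) ∨ (e2 = 0 ∧ (e1 = 1 ∨ e1 = -1)) := by
        rw [Int.abs_eq_natAbs, Int.abs_eq_natAbs] at h1; omega
      have h8 : (g * e1 = 0 ∧ (g * e2 = 0 ∨ g * e2 = g ∨ g * e2 = -g)) ∨
          (g * e2 = 0 ∧ (g * e1 = g ∨ g * e1 = -g)) := by
        rcases hcase with ⟨h6, h7 | h7 | h7⟩ | ⟨h6, h7 | h7⟩ <;> simp [h6, h7]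
      clear_value e1 e2
      generalize (g : ℤ) * e1 = G1 at *
      generalize (g : ℤ) * e2 = G2 at *
      simp only [Int.abs_eq_natAbs]
      omega
    have cover : A ∩ {ω | ∀ j ∈ J, f j ∉ PercWords.coarse g (S (T * (t + 1)) ω)} ⊆
        ⋃ c ∈ Ch, (AA c ∩ {ω | ∀ k ∈ KJ c, pos c T k ∉ S (T * t + T) ω}) := by
      rintro ω ⟨hω, hd⟩
      have ex : ∀ j : J1, ∃ q : Cell × Finset Cell,
          q ∈ VV g j (f j) ×ˢ (QQ g j).powersetCard n0 ∧
          ∀ x ∈ q.2, x ∈ S (T * t) ω ∧ x + q.1 ∉ S (T * t + T) ω := by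
        intro j
        have a1 : g ^ 2 ≤ 2 * ((QQ g j).filter (· ∈ S (T * t) ω)).card := hS ω hω j (hJ1 j.2)
        have a2 : ¬ g ^ 2 ≤ 2 * ((QQ g (f j)).filter (· ∈ S (T * (t + 1)) ω)).card :=
          hd j (hJ1 j.2)
        have a3 := Finset.card_filter_add_card_filter_not (s := QQ g (f j))
          (· ∈ S (T * (t + 1)) ω)
        rw [card_QQ] at a3
        obtain ⟨v, hv, Z, hZ, hZc, hZv⟩ := shift_pairs g hg j (f j) _
          ((QQ g (f j)).filter (· ∉ S (T * (t + 1)) ω)) (Finset.filter_subset _ _)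
          (Finset.filter_subset _ _) a1 (by omega)
        refine ⟨(v, Z), Finset.mem_product.2 ⟨hv, Finset.mem_powersetCard.2
          ⟨hZ.trans (Finset.filter_subset _ _), hZc⟩⟩, fun x hx => ⟨(Finset.mem_filter.1 (hZ hx)).2, ?_⟩⟩
        exact (Finset.mem_filter.1 (hZv x hx)).2
      choose c hc1 hc2 using ex
      have hcC : c ∈ Ch := Fintype.mem_piFinset.2 hc1
      refine mem_biUnion (x := c) hcC ⟨⟨hω, ?_⟩, ?_⟩
      · simp only [mem_iInter]
        exact fun j x hx => (hc2 j x hx).1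
      · rintro ⟨j, x⟩ hk
        have hx : x ∈ (c j).2 := (Finset.mem_sigma.1 hk).2
        change x + spath T (c j).1 ∉ _
        rw [spath_end T _ (hv c hcC j).2.2]
        exact (hc2 j x hx).2
    have each : ∀ c ∈ Ch, μ (AA c ∩ {ω | ∀ k ∈ KJ c, pos c T k ∉ S (T * t + T) ω}) ≤
        ((T : ENNReal) * ε) ^ (J1.card * n0) * μ A := by
      intro c hc
      have hK : (KJ c).card = J1.card * n0 := by
        rw [Finset.card_sigma]
        rw [Finset.sum_congr rfl fun j _ =>
          (Finset.mem_powersetCard.1 (Finset.mem_product.1 (Fintype.mem_piFinset.1 hc j)).2).2]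
        simp
      have := h.path T (T * t) (AA c) (mAA c) (KJ c) (pos c) (by
        rintro r ⟨j, x⟩ hx ⟨j', x'⟩ hx' e
        have hx := (Finset.mem_sigma.1 hx).2
        have hx' := (Finset.mem_sigma.1 hx').2
        simp only at hx hx'
        have e : x + spath r (c j).1 = x' + spath r (c j').1 := e
        by_cases hj : j = j'
        · subst hj
          rw [add_right_cancel e]
        exfalso
        have b1 := hv c hc j
        have b2 := hv c hc j'
        have b3 := spath_bd r (c j).1
        have b4 := spath_bd r (c j').1
        have q1 := (Finset.mem_powersetCard.1
          (Finset.mem_product.1 (Fintype.mem_piFinset.1 hc j)).2).1 hx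
        have q2 := (Finset.mem_powersetCard.1
          (Finset.mem_product.1 (Fintype.mem_piFinset.1 hc j')).2).1 hx'
        simp only [QQ, Finset.mem_product, Finset.mem_Ico] at q1 q2
        have e1 := congrArg Prod.fst e
        have e2 := congrArg Prod.snd e
        simp only [Prod.fst_add, Prod.snd_add] at e1 e2
        have m := hmod j j.2 j' j'.2
        have hne : (j : Cell).1 ≠ (j' : Cell).1 ∨ (j : Cell).2 ≠ (j' : Cell).2 := by
          by_contra hcon
          push Not at hcon
          exact hj (Subtype.ext (Prod.ext hcon.1 hcon.2))
        have aux : ∀ a b : ℤ, a % (8 : ℕ) = b % (8 : ℕ) → a ≠ b →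
            (g : ℤ) * a + 8 * g ≤ g * b ∨ (g : ℤ) * b + 8 * g ≤ g * a := by
          intro a b hab hne
          have hg' : (0 : ℤ) ≤ g := by positivity
          rcases (by omega : a + 8 ≤ b ∨ b + 8 ≤ a) with h | h
          · left; nlinarith
          · right; nlinarith
        simp only [Int.abs_eq_natAbs] at b1 b2 b3 b4
        rcases hne with hne | hne
        · have := aux _ _ m.1 hne; omega
        · have := aux _ _ m.2 hne; omega) (by
        rintro r ⟨j, x⟩ _
        have := spath_near r (c j).1
        simpa [near1, pos] using this) (by
        rintro ω hω ⟨j, x⟩ hk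
        have hx := (Finset.mem_sigma.1 hk).2
        change x + spath 0 _ ∈ _
        rw [spath_zero, ← Prod.zero_eq_mk, add_zero]
        have := hω.2
        simp only [mem_iInter] at this
        exact this j x hx)
      rw [hK] at this
      exact this.trans (by gcongr; exact inter_subset_left)
    have hCc : (Ch.card : ENNReal) ≤ (4 * (g : ENNReal) ^ 2 * 2 ^ (g ^ 2)) ^ J1.card := by
      rw [hCh, Fintype.card_piFinset]
      push_cast
      calc _ ≤ ∏ _j : J1, (4 * (g : ENNReal) ^ 2 * 2 ^ (g ^ 2)) := by
            apply Finset.prod_le_prod' fun j _ => ?_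
            rw [Finset.card_product, card_VV]
            push_cast
            gcongr
            have : ((QQ g j).powersetCard n0).card ≤ 2 ^ (g ^ 2) := by
              rw [← card_QQ g j, ← Finset.card_powerset]
              refine Finset.card_le_card fun P hP => ?_
              exact Finset.mem_powerset.2 (Finset.mem_powersetCard.1 hP).1
            exact_mod_cast this
        _ = _ := by simp
    calc _ ≤ ∑ c ∈ Ch, μ (AA c ∩ {ω | ∀ k ∈ KJ c, pos c T k ∉ S (T * t + T) ω}) :=
          (measure_mono cover).trans (measure_biUnion_finset_le _ _)
      _ ≤ ∑ c ∈ Ch, ((T : ENNReal) * ε) ^ (J1.card * n0) * μ A := Finset.sum_le_sum each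
      _ = Ch.card * (((T : ENNReal) * ε) ^ (J1.card * n0) * μ A) := by
          rw [Finset.sum_const, nsmul_eq_mul]
      _ ≤ (4 * (g : ENNReal) ^ 2 * 2 ^ (g ^ 2)) ^ J1.card *
          (((T : ENNReal) * ε) ^ (J1.card * n0) * μ A) := by gcongr
      _ = ((4 * (g : ENNReal) ^ 2 * 2 ^ (g ^ 2)) * (T * ε) ^ n0) ^ J1.card * μ A := by
          rw [mul_pow _ ((T * ε : ENNReal) ^ n0), ← pow_mul (T * ε : ENNReal), mul_comm n0]; ring
      _ ≤ (ε' ^ 64) ^ J1.card * μ A := by gcongr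
      _ ≤ ε' ^ J.card * μ A := by
          rw [← pow_mul]
          gcongr ?_ * _
          exact pow_le_pow_right_of_le_one' hε1 (by simpa using hcard)

end ker

lemma two_num (x y z : ℕ) (h : x + y ≤ z) : (2 : ENNReal) ^ x * (2⁻¹) ^ z ≤ (2⁻¹) ^ y := by
  obtain ⟨w, rfl⟩ := Nat.exists_eq_add_of_le h
  rw [pow_add, pow_add, ← mul_assoc, ← mul_assoc, ← mul_pow, ENNReal.mul_inv_cancel (by simp) (by simp),
    one_pow, one_mul]
  calc (2⁻¹ : ENNReal) ^ y * 2⁻¹ ^ w ≤ 2⁻¹ ^ y * 1 := by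
        gcongr; exact pow_le_one' (by simp) _
    _ = _ := mul_one _

lemma half_le_one (n : ℕ) : (2⁻¹ : ENNReal) ^ n ≤ 1 := pow_le_one' (by simp) _

lemma coarse_num (g T n G e : ℕ) (hg : g = 2 ^ 15) (hT : T = 3 * 2 ^ 15) (hn : 70 ≤ n)
    (hG : G = 2 ^ 30) (he : e = 2 ^ 26) :
    (4 * (g : ENNReal) ^ 2 * 2 ^ G) * (T * 2⁻¹ ^ n) ^ e ≤ ((2⁻¹ : ENNReal) ^ (4 * T * n)) ^ 64 := by
  have h1 : 4 * (g : ENNReal) ^ 2 = 2 ^ 32 := by rw [hg]; norm_num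
  have h2 : (T : ENNReal) ≤ 2 ^ 17 := by rw [hT]; norm_num
  have h3 : 32 + G + 17 * e + 4 * T * n * 64 ≤ n * e := by
    rw [hG, he, hT]; omega
  clear hG he
  calc _ ≤ (2 ^ 32 * 2 ^ G) * (2 ^ 17 * 2⁻¹ ^ n) ^ e := by rw [h1]; gcongr
    _ = (2 : ENNReal) ^ (32 + G + 17 * e) * 2⁻¹ ^ (n * e) := by
        rw [mul_pow, ← pow_mul, ← pow_mul]; ring
    _ ≤ _ := by rw [← pow_mul]; exact two_num _ _ _ h3

section ker
variable {Ω : Type*} [mΩ : MeasurableSpace Ω] {μ : Measure Ω} {F : ℕ → MeasurableSpace Ω}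
    {S : ℕ → Ω → Set Cell}

lemma Ker.next {n : ℕ} (h : Ker μ F S (2⁻¹ ^ n)) (g T : ℕ) (hg : g = 2 ^ 15) (hT : T = 3 * 2 ^ 15)
    (hn : 70 ≤ n) :
    Ker μ (fun u => F (T * u)) (fun u ω => PercWords.coarse g (S (T * u) ω)) (2⁻¹ ^ (4 * T * n)) :=
  h.coarse g T (by rw [hg]; norm_num) (by rw [hT, hg]) _ (half_le_one _)
    (coarse_num g T n _ _ hg hT hn (by rw [hg]; norm_num) (by rw [hg]; norm_num))

def Full (R : ℕ) (S : Ω → Set Cell) : Prop :=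
  ∀ ω, ∀ κ : Cell, κ.1.natAbs ≤ R → κ.2.natAbs ≤ R → κ ∈ S ω

lemma coarse_full {g R : ℕ} {S : Ω → Set Cell} (h : Full (g * (R + 1)) S) :
    Full R (fun ω => PercWords.coarse g (S ω)) := by
  classical
  intro ω κ h1 h2
  have : (QQ g κ).filter (· ∈ S ω) = QQ g κ := by
    refine Finset.filter_true_of_mem fun x hx => ?_
    simp only [QQ, Finset.mem_product, Finset.mem_Ico] at hx
    have aux : ∀ a y : ℤ, a.natAbs ≤ R → g * a ≤ y → y < g * a + g → y.natAbs ≤ g * (R + 1) := by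
      intro a y ha hy hy'
      have e1 : (g : ℤ) * a ≤ g * R := by
        apply mul_le_mul_of_nonneg_left _ (by positivity); omega
      have e2 : (g : ℤ) * (-R) ≤ g * a := by
        apply mul_le_mul_of_nonneg_left _ (by positivity); omega
      zify
      rw [abs_le]
      constructor <;> nlinarith
    exact h ω x (aux _ _ h1 hx.1.1 hx.1.2) (aux _ _ h2 hx.2.1 hx.2.2)
  change g ^ 2 ≤ 2 * ((QQ g κ).filter (· ∈ S ω)).card
  rw [this, card_QQ]; omega

lemma coarse_nonempty {g : ℕ} (hg : 0 < g) {S : Set Cell} {κ : Cell}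
    (h : κ ∈ PercWords.coarse g S) : S.Nonempty := by
  classical
  have h' : g ^ 2 ≤ 2 * ((QQ g κ).filter (· ∈ S)).card := h
  have : 0 < ((QQ g κ).filter (· ∈ S)).card := by have := pow_pos hg 2; omega
  obtain ⟨x, hx⟩ := Finset.card_pos.1 this
  exact ⟨x, (Finset.mem_filter.1 hx).2⟩

lemma Ker.phase1 {n : ℕ} (h : Ker μ F S (2⁻¹ ^ n)) (g T : ℕ) (hg : g = 2 ^ 15)
    (hT : T = 3 * 2 ^ 15) (hn : 70 ≤ n) (i : ℕ) : ∀ R,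
    Full ((fun R => g * (R + 1))^[i] R) (S 0) →
    ∃ S' : ℕ → Ω → Set Cell, Ker μ (fun u => F (T ^ i * u)) S' (2⁻¹ ^ (n * (4 * T) ^ i)) ∧
      Full R (S' 0) ∧ ∀ u ω, (S' u ω).Nonempty → (S (T ^ i * u) ω).Nonempty := by
  induction i with
  | zero => intro R hR; exact ⟨S, by simpa using h, by simpa using hR, by simp⟩
  | succ i ih =>
    intro R hR
    rw [Function.iterate_succ_apply] at hR
    obtain ⟨S', h1, h2, h3⟩ := ih _ hR
    refine ⟨fun u ω => PercWords.coarse g (S' (T * u) ω), ?_, ?_, ?_⟩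
    · have := h1.next g T hg hT (hn.trans (Nat.le_mul_of_pos_right _ (by subst hT; positivity)))
      convert this using 2
      · ring_nf
      · ring
    · exact coarse_full h2
    · rintro u ω ⟨κ, hκ⟩
      have := h3 _ _ (coarse_nonempty (by rw [hg]; norm_num) hκ)
      rwa [show T ^ (i + 1) * u = T ^ i * (T * u) by ring]

noncomputable def SS (g T : ℕ) (S : ℕ → Ω → Set Cell) : ℕ → ℕ → Ω → Set Cell
  | 0 => S
  | i + 1 => fun u ω => PercWords.coarse g (SS g T S i (T * u + T) ω)

def aa (T : ℕ) : ℕ → ℕ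
  | 0 => 0
  | i + 1 => aa T i + T ^ (i + 1)

lemma aa_le (T : ℕ) (hT : 2 ≤ T) (i : ℕ) : aa T i ≤ 2 * T ^ i := by
  induction i with
  | zero => simp [aa]
  | succ i ih => rw [aa]; have := pow_pos (by omega : 0 < T) i; rw [pow_succ]; nlinarith

lemma le_aa (T : ℕ) (hT : 2 ≤ T) (i : ℕ) : i ≤ aa T i := by
  induction i with
  | zero => simp
  | succ i ih => rw [aa]; have := pow_pos (by omega : 0 < T) (i + 1); omega

lemma Ker.phase2 {n : ℕ} (h : Ker μ F S (2⁻¹ ^ n)) (g T : ℕ) (hg : g = 2 ^ 15)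
    (hT : T = 3 * 2 ^ 15) (hn : 70 ≤ n) (i : ℕ) :
    Ker μ (fun u => F (T ^ i * u + aa T i)) (SS g T S i) (2⁻¹ ^ (n * (4 * T) ^ i)) := by
  induction i with
  | zero => simpa [aa, SS] using h
  | succ i ih =>
    have := (ih.sub T).next g T hg hT
      (hn.trans (Nat.le_mul_of_pos_right _ (by subst hT; positivity)))
    convert this using 2
    · rw [aa]; ring_nf
    · rfl
    · ring

lemma Ker.link [IsProbabilityMeasure μ] {n : ℕ} (h : Ker μ F S (2⁻¹ ^ n)) (g T : ℕ)
    (hg : g = 2 ^ 15) (hT : T = 3 * 2 ^ 15) :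
    μ ({ω | (0, 0) ∈ S 0 ω} \ {ω | (0, 0) ∈ PercWords.coarse g (S T ω)}) ≤ 2 ^ 47 * 2⁻¹ ^ n := by
  classical
  have hsub : {ω | ((0 : ℤ), (0 : ℤ)) ∈ S 0 ω} \ {ω | (0, 0) ∈ PercWords.coarse g (S T ω)} ⊆
      ⋃ y ∈ QQ g (0, 0), ({ω | (0, 0) ∈ S 0 ω} ∩
        {ω | ∀ j ∈ ({()} : Finset Unit), spath T y ∉ S (0 + T) ω}) := by
    rintro ω ⟨h1, h2⟩
    have h2 : ¬ g ^ 2 ≤ 2 * ((QQ g (0, 0)).filter (· ∈ S T ω)).card := h2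
    by_contra hcon
    apply h2
    have : (QQ g (0, 0)).filter (· ∈ S T ω) = QQ g (0, 0) := by
      refine Finset.filter_true_of_mem fun x hx => ?_
      by_contra hx2
      refine hcon (mem_biUnion hx ⟨h1, ?_⟩)
      intro _ _
      rw [spath_end, zero_add]
      · exact hx2
      · simp only [QQ, Finset.mem_product, Finset.mem_Ico, Int.abs_eq_natAbs] at *
        subst hT hg; omega
    rw [this, card_QQ]; omega
  refine (measure_mono hsub).trans ((measure_biUnion_finset_le _ _).trans ?_)
  have : ∀ y ∈ QQ g (0, 0), μ ({ω | (0, 0) ∈ S 0 ω} ∩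
        {ω | ∀ j ∈ ({()} : Finset Unit), spath T y ∉ S (0 + T) ω}) ≤ T * 2⁻¹ ^ n := by
    intro y _
    have := h.path T 0 {ω | (0, 0) ∈ S 0 ω} (h.meas 0 _) ({()} : Finset Unit)
      (fun r _ => spath r y) (fun r => by simp) (fun r _ _ => spath_near r y)
      (fun ω hω _ _ => by rw [spath_zero]; exact hω)
    refine this.trans ?_
    rw [Finset.card_singleton, pow_one]
    calc _ ≤ (T : ENNReal) * 2⁻¹ ^ n * 1 := by gcongr; exact prob_le_one
      _ = _ := mul_one _
  refine (Finset.sum_le_sum this).trans ?_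
  rw [Finset.sum_const, card_QQ, nsmul_eq_mul, ← mul_assoc]
  gcongr
  rw [hg, hT]; norm_num

theorem levels (n0 B0 s : ℕ) (hn : 70 ≤ n0) : ∃ (R : ℕ) (b : ℕ → ℕ), Monotone b ∧ (∀ i, i ≤ b i) ∧
    ∀ {Ω : Type} [MeasurableSpace Ω] {μ : Measure Ω} [IsProbabilityMeasure μ]
      {F : ℕ → MeasurableSpace Ω} {S : ℕ → Ω → Set Cell}, Ker μ F S (2⁻¹ ^ n0) → Full R (S 0) →
    ∃ E : ℕ → Set Ω, E 0 = univ ∧ (∀ i, MeasurableSet[F (b i)] (E i)) ∧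
      (∀ i, ∀ ω ∈ E i, (S (b i) ω).Nonempty) ∧
      ∑' i, 2 ^ (B0 * b (i + 1)) * μ (E i \ E (i + 1)) ≤ 2⁻¹ ^ s := by
  obtain ⟨g, hg⟩ : ∃ g : ℕ, g = 2 ^ 15 := ⟨_, rfl⟩
  obtain ⟨T, hT⟩ : ∃ T : ℕ, T = 3 * 2 ^ 15 := ⟨_, rfl⟩
  have hT2 : 2 ≤ T := by omega
  have hg0 : 0 < g := by rw [hg]; norm_num
  set i0 := 2 * B0 * T + 50 + s with hi0
  refine ⟨(fun R => g * (R + 1))^[i0] 0, fun i => T ^ i0 * aa T i, ?_, ?_, ?_⟩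
  · refine monotone_nat_of_le_succ fun i => Nat.mul_le_mul_left _ ?_
    rw [aa]; omega
  · intro i
    exact (le_aa T hT2 i).trans (Nat.le_mul_of_pos_left _ (by positivity))
  intro Ω _ μ _ F S h hF
  obtain ⟨S', h1, h2, h3⟩ := h.phase1 g T hg hT hn i0 0 hF
  have h70 : 70 ≤ n0 * (4 * T) ^ i0 := hn.trans (Nat.le_mul_of_pos_right _ (by positivity))
  have hK := h1.phase2 g T hg hT h70
  have hne : ∀ i u ω, (SS g T S' i u ω).Nonempty → (S' (T ^ i * u + aa T i) ω).Nonempty := by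
    intro i
    induction i with
    | zero => intro u ω; simp [SS, aa]
    | succ i ih =>
      rintro u ω ⟨κ, hκ⟩
      have := ih _ _ (coarse_nonempty hg0 hκ)
      rwa [show T ^ (i + 1) * u + aa T (i + 1) = T ^ i * (T * u + T) + aa T i by rw [aa]; ring]
  refine ⟨fun i => {ω | (0, 0) ∈ SS g T S' i 0 ω}, ?_, ?_, ?_, ?_⟩
  · exact eq_univ_of_forall fun ω => h2 ω _ (by simp) (by simp)
  · intro i
    have := (hK i).meas 0 (0, 0)
    rwa [mul_zero, zero_add] at this
  · intro i ω hω
    have := h3 _ _ (hne i 0 ω ⟨_, hω⟩)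
    simpa using this
  · have key : ∀ i, 2 ^ (B0 * (T ^ i0 * aa T (i + 1))) *
        μ ({ω | (0, 0) ∈ SS g T S' i 0 ω} \ {ω | (0, 0) ∈ SS g T S' (i + 1) 0 ω}) ≤
        2⁻¹ ^ s * (2⁻¹ : ENNReal) ^ (i + 1) := by
      intro i
      have l := (hK i).link g T hg hT
      have e : ∀ ω, SS g T S' (i + 1) 0 ω = PercWords.coarse g (SS g T S' i T ω) := by
        intro ω; rw [SS]; simp
      simp only [e]
      calc _ ≤ 2 ^ (B0 * (T ^ i0 * aa T (i + 1))) * (2 ^ 47 * 2⁻¹ ^ (n0 * (4 * T) ^ i0 * (4 * T) ^ i)) := by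
            gcongr
        _ = (2 : ENNReal) ^ (B0 * (T ^ i0 * aa T (i + 1)) + 47) * 2⁻¹ ^ (n0 * (4 * T) ^ i0 * (4 * T) ^ i) := by
            rw [pow_add]; ring
        _ ≤ 2⁻¹ ^ (s + (i + 1)) := by
            apply two_num
            have q1 := aa_le T hT2 (i + 1)
            have q2 : i0 < 4 ^ i0 := Nat.lt_pow_self (by norm_num)
            have q3 : i < 4 ^ i := Nat.lt_pow_self (by norm_num)
            have q4 : 0 < T ^ (i0 + i) := by positivity
            calc _ ≤ B0 * (T ^ i0 * (2 * T ^ (i + 1))) + 47 + (s + (i + 1)) := by gcongr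
              _ = (2 * B0 * T) * T ^ (i0 + i) + (47 + (s + (i + 1))) := by ring
              _ ≤ (2 * B0 * T) * T ^ (i0 + i) + (50 + s + i) * T ^ (i0 + i) := by nlinarith
              _ = (i0 + i) * T ^ (i0 + i) := by rw [hi0]; ring
              _ ≤ (4 ^ i0 * 4 ^ i) * T ^ (i0 + i) := by
                  gcongr
                  nlinarith
              _ = 1 * ((4 * T) ^ i0 * (4 * T) ^ i) := by rw [mul_pow, mul_pow]; ring
              _ ≤ n0 * ((4 * T) ^ i0 * (4 * T) ^ i) := by gcongr; omega
              _ = _ := by ring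
        _ = _ := by rw [pow_add]
    refine (ENNReal.tsum_le_tsum key).trans ?_
    rw [ENNReal.tsum_mul_left, ENNReal.tsum_geometric_add_one]
    rw [ENNReal.one_sub_inv_two, inv_inv, ENNReal.inv_mul_cancel (by simp) (by simp), mul_one]

end ker

/-! ### Lattice basics -/
section lat
variable {d : ℕ}

lemma adj_symm {x y : Vtx d} (h : adj x y) : adj y x := by
  unfold adj at *
  rw [← h]; exact Finset.sum_congr rfl fun i _ => by ring

lemma adj_coord {x y : Vtx d} (h : adj x y) (i : Fin d) : |x i - y i| ≤ 1 := by
  unfold adj at h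
  have : (x i - y i) ^ 2 ≤ 1 := by
    rw [← h]; exact Finset.single_le_sum (f := fun i => (x i - y i) ^ 2) (fun i _ => sq_nonneg _) (Finset.mem_univ i)
  exact abs_le_one_iff_mul_self_le_one.2 (by nlinarith)

open Classical in
noncomputable def nbs (x : Vtx d) : Finset (Vtx d) := (Finset.Icc (x - 1) (x + 1)).filter (adj x)

lemma mem_nbs {x y : Vtx d} : y ∈ nbs x ↔ adj x y := by
  classical
  simp only [nbs, Finset.mem_filter, Finset.mem_Icc, Pi.le_def, Pi.sub_apply, Pi.add_apply,
    Pi.one_apply, and_iff_right_iff_imp]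
  intro h
  refine ⟨fun i => ?_, fun i => ?_⟩ <;> have := abs_le.1 (adj_coord h i) <;> linarith [this.1, this.2]

open Classical in
noncomputable def bdy (c : Finset (Vtx d)) : Finset (Vtx d) := c.biUnion nbs

lemma mem_bdy {c : Finset (Vtx d)} {y : Vtx d} : y ∈ bdy c ↔ ∃ x ∈ c, adj x y := by
  classical
  simp [bdy, mem_nbs]

open Classical in
noncomputable def grow (O : Set (Vtx d)) (c : Finset (Vtx d)) : Finset (Vtx d) :=
  c ∪ (bdy c).filter (· ∈ O)

lemma mem_grow {O : Set (Vtx d)} {c : Finset (Vtx d)} {y : Vtx d} :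
    y ∈ grow O c ↔ y ∈ c ∨ (∃ x ∈ c, adj x y) ∧ y ∈ O := by
  classical
  simp [grow, mem_bdy]

lemma grow_mono {O O' : Set (Vtx d)} {c c' : Finset (Vtx d)} (hO : O ⊆ O') (hc : c ⊆ c') :
    grow O c ⊆ grow O' c' := by
  intro y hy
  rw [mem_grow] at *
  rcases hy with h | ⟨⟨x, hx, h⟩, h2⟩
  · exact Or.inl (hc h)
  · exact Or.inr ⟨⟨x, hc hx, h⟩, hO h2⟩

lemma le_grow (O : Set (Vtx d)) (c : Finset (Vtx d)) : c ⊆ grow O c :=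
  fun y hy => mem_grow.2 (Or.inl hy)

lemma grow_iter_mono {O O' : Set (Vtx d)} (hO : O ⊆ O') : ∀ {n n' : ℕ} (hn : n ≤ n')
    {c c' : Finset (Vtx d)} (hc : c ⊆ c'), (grow O)^[n] c ⊆ (grow O')^[n'] c' := by
  intro n n' hn
  induction n' generalizing n with
  | zero => intro c c' hc; obtain rfl : n = 0 := by omega
            exact hc
  | succ n' ih =>
    intro c c' hc
    rw [Function.iterate_succ_apply']
    rcases Nat.lt_or_ge n (n' + 1) with h | h
    · exact (ih (by omega) hc).trans (le_grow _ _)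
    · obtain rfl : n = n' + 1 := by omega
      rw [Function.iterate_succ_apply']
      exact grow_mono hO (ih le_rfl hc)

end lat

/-! ### Words -/
section words
variable {d : ℕ} {Lab : Type} (op : Lab → Prop) (swap : Lab → Lab) (V0 : Finset (Vtx d))

noncomputable def AL (l : ℕ) (η : Vtx d → Lab) : Finset (Vtx d) := (grow {x | op (η x)})^[l] V0

open Classical in
noncomputable def QL : ℕ → (Vtx d → Lab) → Finset (Vtx d)
  | 0, _ => V0
  | l + 1, η => QL l η ∪ bdy (AL op V0 l η)

open Classical in
noncomputable def NL (l : ℕ) (η : Vtx d → Lab) : Finset (Vtx d) := bdy (AL op V0 l η) \ QL op V0 l η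

lemma AL_succ (l : ℕ) (η : Vtx d → Lab) :
    AL op V0 (l + 1) η = grow {x | op (η x)} (AL op V0 l η) := by
  rw [AL, Function.iterate_succ_apply']; rfl

lemma AL_mono (η : Vtx d → Lab) {l l' : ℕ} (h : l ≤ l') : AL op V0 l η ⊆ AL op V0 l' η :=
  grow_iter_mono subset_rfl h subset_rfl

lemma QL_mono (η : Vtx d → Lab) {l l' : ℕ} (h : l ≤ l') : QL op V0 l η ⊆ QL op V0 l' η := by
  classical
  exact monotone_nat_of_le_succ (f := fun l => QL op V0 l η)
    (fun l => by rw [QL]; exact Finset.subset_union_left) h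

lemma AL_sub_QL (η : Vtx d → Lab) (l : ℕ) : AL op V0 l η ⊆ QL op V0 l η := by
  classical
  induction l with
  | zero => simp [AL, QL]
  | succ l ih =>
    intro x hx
    rw [AL_succ, mem_grow] at hx
    rw [QL, Finset.mem_union, mem_bdy]
    rcases hx with h | h
    · exact Or.inl (ih h)
    · exact Or.inr h.1

lemma QL_agree {η η' : Vtx d → Lab} (l : ℕ) (h : ∀ x ∈ QL op V0 l η, η x = η' x) :
    ∀ k ≤ l, AL op V0 k η' = AL op V0 k η ∧ QL op V0 k η' = QL op V0 k η := by
  classical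
  intro k
  induction k with
  | zero => intro _; simp [AL, QL]
  | succ k ih =>
    intro hk
    obtain ⟨h1, h2⟩ := ih (by omega)
    constructor
    · rw [AL_succ, AL_succ, h1]
      ext x
      rw [mem_grow, mem_grow]
      refine or_congr_right (and_congr_right fun hx => ?_)
      have : x ∈ QL op V0 l η := QL_mono op V0 η hk (by
        rw [QL, Finset.mem_union, mem_bdy]; exact Or.inr hx)
      change op (η' x) ↔ op (η x)
      rw [h x this]
    · rw [QL, QL, h1, h2]

/-- open sites of `QL` are already in `AL` -/
lemma QL_open (η : Vtx d → Lab) (l : ℕ) : ∀ x ∈ QL op V0 l η, op (η x) → x ∈ AL op V0 l η := by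
  classical
  induction l with
  | zero => intro x hx _; simpa [AL, QL] using hx
  | succ l ih =>
    intro x hx ho
    rw [QL, Finset.mem_union, mem_bdy] at hx
    rw [AL_succ, mem_grow]
    rcases hx with h | h
    · exact Or.inl (ih x h ho)
    · exact Or.inr ⟨h, ho⟩

lemma new_in_NL (η : Vtx d → Lab) (l : ℕ) (x : Vtx d) (h1 : x ∈ AL op V0 (l + 1) η)
    (h2 : x ∉ AL op V0 l η) : x ∈ NL op V0 l η ∧ op (η x) ∧ ∃ y ∈ AL op V0 l η, adj y x := by
  classical
  rw [AL_succ, mem_grow] at h1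
  rcases h1 with h | ⟨h, ho⟩
  · exact absurd h h2
  · refine ⟨?_, ho, h⟩
    rw [NL, Finset.mem_sdiff, mem_bdy]
    exact ⟨h, fun hq => h2 (QL_open op V0 η l x hq ho)⟩

lemma NL_sub (η : Vtx d → Lab) (l : ℕ) : NL op V0 l η ⊆ QL op V0 (l + 1) η := by
  classical
  rw [QL, NL]; exact Finset.sdiff_subset.trans Finset.subset_union_right

/-- swapping on a random set -/
noncomputable def swN (n : Finset (Vtx d)) (b : Bool) (η : Vtx d → Lab) : Vtx d → Lab :=
  open Classical in fun x => if x ∈ n ∧ b = false then swap (η x) else η x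

noncomputable def UU (ξ : ℕ → Bool) : ℕ → (Vtx d → Lab) → (Vtx d → Lab)
  | 0, η => η
  | l + 1, η => swN swap (NL op V0 l (UU ξ l η)) (ξ l) (UU ξ l η)

lemma UU_agree_step (ξ : ℕ → Bool) (l : ℕ) (η : Vtx d → Lab) :
    ∀ x ∈ QL op V0 l (UU op swap V0 ξ l η),
      UU op swap V0 ξ l η x = UU op swap V0 ξ (l + 1) η x := by
  classical
  intro x hx
  rw [UU, swN, if_neg]
  rintro ⟨h, _⟩
  rw [NL, Finset.mem_sdiff] at h
  exact h.2 hx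

lemma UU_agree (ξ : ℕ → Bool) (l l' : ℕ) (h : l ≤ l') (η : Vtx d → Lab) :
    (∀ x ∈ QL op V0 l (UU op swap V0 ξ l η),
      UU op swap V0 ξ l η x = UU op swap V0 ξ l' η x) := by
  induction l', h using Nat.le_induction with
  | base => intros; rfl
  | succ l' hl ih =>
    intro x hx
    rw [ih x hx]
    apply UU_agree_step
    have := (QL_agree op V0 l ih l le_rfl).2
    apply QL_mono op V0 _ hl
    rwa [this]

lemma UU_inv (ξ : ℕ → Bool) (L : ℕ) (η : Vtx d → Lab) :
    (∀ x, x ∉ QL op V0 L (UU op swap V0 ξ L η) → UU op swap V0 ξ L η x = η x) ∧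
    ∀ l < L, ∀ x ∈ NL op V0 l (UU op swap V0 ξ L η),
      UU op swap V0 ξ L η x = if ξ l = false then swap (η x) else η x := by
  classical
  induction L with
  | zero => exact ⟨fun _ _ => rfl, fun l hl => by omega⟩
  | succ L ih =>
    have ag := QL_agree op V0 L (UU_agree_step op swap V0 ξ L η)
    have hN : ∀ l ≤ L, NL op V0 l (UU op swap V0 ξ (L + 1) η) = NL op V0 l (UU op swap V0 ξ L η) := by
      intro l hl
      rw [NL, NL, (ag l hl).1, (ag l hl).2]
    constructor
    · intro x hx
      rw [QL, Finset.mem_union, (ag L le_rfl).1, (ag L le_rfl).2] at hx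
      push Not at hx
      rw [UU, swN, if_neg, ih.1 x hx.1]
      rintro ⟨h, _⟩
      rw [NL, Finset.mem_sdiff] at h
      exact hx.2 h.1
    · intro l hl x hx
      rw [hN l (by omega)] at hx
      rcases Nat.lt_or_ge l L with h | h
      · rw [← ih.2 l h x hx]
        exact (UU_agree_step op swap V0 ξ L η x
          (QL_mono op V0 _ h (NL_sub op V0 _ l hx))).symm
      · obtain rfl : l = L := by omega
        have hx' := hx
        rw [NL, Finset.mem_sdiff] at hx'
        rw [UU, swN, ih.1 x hx'.2]
        simp [hx]

lemma UU_prefix (ξ ξ' : ℕ → Bool) (L : ℕ) (h : ∀ l < L, ξ l = ξ' l) (η : Vtx d → Lab) :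
    UU op swap V0 ξ L η = UU op swap V0 ξ' L η := by
  induction L with
  | zero => rfl
  | succ L ih => rw [UU, UU, ih fun l hl => h l (by omega), h L (by omega)]

/-- reading the word along a geodesic -/
lemma geodesic (η : Vtx d → Lab) (l : ℕ) : ∀ x, x ∈ AL op V0 (l + 1) η → x ∉ AL op V0 l η →
    ∃ y : ℕ → Vtx d, y l = x ∧ (∀ k ≤ l, y k ∈ AL op V0 (k + 1) η ∧ y k ∉ AL op V0 k η) ∧
      ∀ k < l, adj (y k) (y (k + 1)) := by
  induction l with
  | zero =>
    intro x h1 h2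
    exact ⟨fun _ => x, rfl, fun k hk => by obtain rfl : k = 0 := by omega
                                           exact ⟨h1, h2⟩, fun k hk => by omega⟩
  | succ l ih =>
    intro x h1 h2
    obtain ⟨_, ho, z, hz, hzx⟩ := new_in_NL op V0 η (l + 1) x h1 h2
    have hz2 : z ∉ AL op V0 l η := by
      intro hc
      apply h2
      rw [AL_succ, mem_grow]
      exact Or.inr ⟨⟨z, hc, hzx⟩, ho⟩
    obtain ⟨y, h3, h4, h5⟩ := ih z hz hz2
    refine ⟨fun k => if k ≤ l then y k else x, by simp, ?_, ?_⟩
    · intro k hk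
      by_cases hkl : k ≤ l
      · simpa [hkl] using h4 k hkl
      · obtain rfl : k = l + 1 := by omega
        simpa using ⟨h1, h2⟩
    · intro k hk
      by_cases hkl : k + 1 ≤ l
      · simp only [hkl, if_true, (by omega : k ≤ l)]; exact h5 k (by omega)
      · obtain rfl : k = l := by omega
        simp [h3, hzx]

lemma read_word (val : Lab → Bool) (hv1 : ∀ a, op a → val a = true)
    (hv2 : ∀ a, op (swap a) → val a = false) (ξ : ℕ → Bool) (L n : ℕ) (η : Vtx d → Lab)
    (x : Vtx d) (hx : x ∈ AL op V0 L (UU op swap V0 ξ L η))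
    (hx' : x ∉ AL op V0 n (UU op swap V0 ξ L η)) :
    ∃ y : ℕ → Vtx d, y 0 ∈ bdy V0 ∧ (∀ k < n, adj (y k) (y (k + 1))) ∧
      (∀ k ≤ n, ∀ k' ≤ n, y k = y k' → k = k') ∧ ∀ k ≤ n, val (η (y k)) = ξ k := by
  classical
  set ζ := UU op swap V0 ξ L η with hζ
  have hex : ∃ l, x ∈ AL op V0 l ζ := ⟨L, hx⟩
  set l := Nat.find hex with hl
  have h1 : x ∈ AL op V0 l ζ := Nat.find_spec hex
  have hlL : l ≤ L := Nat.find_min' hex hx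
  have hnl : n < l := by
    by_contra hc
    exact hx' (AL_mono op V0 ζ (not_lt.1 hc) h1)
  obtain ⟨l', hl'⟩ : ∃ l', l = l' + 1 := ⟨l - 1, by omega⟩
  have h2 : x ∉ AL op V0 l' ζ := Nat.find_min hex (by omega)
  rw [hl'] at h1
  obtain ⟨y, -, h4, h5⟩ := geodesic op V0 ζ l' x h1 h2
  refine ⟨y, ?_, fun k hk => h5 k (by omega), ?_, ?_⟩
  · have := h4 0 (by omega)
    obtain ⟨-, -, z, hz, hzx⟩ := new_in_NL op V0 ζ 0 (y 0) this.1 this.2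
    exact mem_bdy.2 ⟨z, hz, hzx⟩
  · have : ∀ k k', k < k' → k' ≤ n → y k ≠ y k' := by
      intro k k' hkk hk' e
      have a1 := (h4 k (by omega)).1
      have a2 := (h4 k' (by omega)).2
      rw [e] at a1
      exact a2 (AL_mono op V0 ζ hkk a1)
    intro k hk k' hk' e
    rcases lt_trichotomy k k' with h | h | h
    · exact absurd e (this k k' h hk')
    · exact h
    · exact absurd e.symm (this k' k h hk)
  · intro k hk
    have a := h4 k (by omega)
    obtain ⟨b1, b2, -⟩ := new_in_NL op V0 ζ k (y k) a.1 a.2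
    have c := (UU_inv op swap V0 ξ L η).2 k (by omega) (y k) b1
    rw [← hζ] at c
    rw [c] at b2
    cases hk : ξ k
    · rw [hk] at b2; exact hv2 _ (by simpa using b2)
    · rw [hk] at b2; exact hv1 _ (by simpa using b2)

end words

lemma konig {X : Type*} (P : ℕ → (ℕ → X) → Prop) (B : ℕ → Finset X)
    (hanti : ∀ n m y, n ≤ m → P m y → P n y)
    (hdep : ∀ n y z, (∀ k ≤ n, y k = z k) → P n y → P n z)
    (hB : ∀ n y, P n y → y n ∈ B n) (hex : ∀ n, ∃ y, P n y) : ∃ y, ∀ n, P n y := by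
  choose y hy using hex
  have hfin : ∀ k, ∃ z ∈ B k, ∀ᶠ n in (Filter.hyperfilter ℕ : Filter ℕ), y n k = z := by
    intro k
    have h1 : ∀ᶠ n in (Filter.hyperfilter ℕ : Filter ℕ), ∃ z ∈ (B k : Set X), y n k = z := by
      have : ∀ᶠ n in (Filter.hyperfilter ℕ : Filter ℕ), k ≤ n :=
        Filter.hyperfilter_le_cofinite (by
          have := Filter.eventually_ge_atTop k
          rwa [← Nat.cofinite_eq_atTop] at this)
      exact this.mono fun n hn => ⟨_, hB k _ (hanti k n _ hn (hy n)), rfl⟩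
    have := (Ultrafilter.finite_biUnion_mem_iff (f := Filter.hyperfilter ℕ)
      (B k).finite_toSet (s := fun z => {n | y n k = z})).1 (by
        refine Filter.mem_of_superset h1 ?_
        rintro n ⟨z, hz, e⟩
        exact mem_biUnion hz e)
    obtain ⟨z, hz, h⟩ := this
    exact ⟨z, hz, h⟩
  choose z _ hz using hfin
  refine ⟨z, fun n => ?_⟩
  have h1 : ∀ᶠ m in (Filter.hyperfilter ℕ : Filter ℕ), ∀ k ∈ Finset.range (n + 1), y m k = z k :=
    (Filter.eventually_all_finset _).2 fun k _ => hz k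
  have h2 : ∀ᶠ m in (Filter.hyperfilter ℕ : Filter ℕ), n ≤ m :=
    Filter.hyperfilter_le_cofinite (by
      have := Filter.eventually_ge_atTop n
      rwa [← Nat.cofinite_eq_atTop] at this)
  obtain ⟨m, hm1, hm2⟩ := (h1.and h2).exists
  exact hdep n (y m) z (fun k hk => hm1 k (by simp; omega)) (hanti n m _ hm2 (hy m))

section words
variable {d : ℕ} {Lab : Type} (op : Lab → Prop) (swap : Lab → Lab) (V0 : Finset (Vtx d))

lemma QL_ball (η : Vtx d → Lab) (l : ℕ) :
    AL op V0 l η ⊆ (grow univ)^[l] V0 ∧ QL op V0 l η ⊆ (grow univ)^[l] V0 := by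
  classical
  have h1 : ∀ l, AL op V0 l η ⊆ (grow univ)^[l] V0 := fun l =>
    grow_iter_mono (subset_univ _) le_rfl subset_rfl
  refine ⟨h1 l, ?_⟩
  induction l with
  | zero => simp [QL]
  | succ l ih =>
    rw [QL, Function.iterate_succ_apply']
    refine Finset.union_subset (ih.trans (le_grow _ _)) ?_
    intro x hx
    obtain ⟨y, hy, h⟩ := mem_bdy.1 hx
    exact mem_grow.2 (Or.inr ⟨⟨y, h1 l hy, h⟩, mem_univ _⟩)

variable [MeasurableSpace Lab] [Finite Lab] [MeasurableSingletonClass Lab]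

lemma NL_dep_compl (l : ℕ) (n : Finset (Vtx d)) :
    Dep {η : Vtx d → Lab | NL op V0 l η = n} (n : Set (Vtx d))ᶜ := by
  classical
  refine dep_of fun η η' h hn => ?_
  have hn : NL op V0 l η = n := hn
  have := QL_agree op V0 l (η := η) (η' := η') (fun x hx => h x fun hxn => by
    rw [Finset.mem_coe, ← hn, NL, Finset.mem_sdiff] at hxn
    exact hxn.2 hx) l le_rfl
  change NL op V0 l η' = n
  rw [← hn, NL, NL, this.1, this.2]

lemma NL_meas (l : ℕ) (n : Finset (Vtx d)) :
    MeasurableSet {η : Vtx d → Lab | NL op V0 l η = n} := by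
  classical
  refine Dep.meas ((grow univ)^[l] V0).finite_toSet (dep_of fun η η' h hn => ?_)
  have hn : NL op V0 l η = n := hn
  have := QL_agree op V0 l (η := η) (η' := η') (fun x hx => h x ((QL_ball op V0 η l).2 hx)) l le_rfl
  change NL op V0 l η' = n
  rw [← hn, NL, NL, this.1, this.2]

variable (lam : Measure Lab) [IsProbabilityMeasure lam]

lemma swN_pres (hsw : lam.map swap = lam) (n : Finset (Vtx d)) (b : Bool) :
    MeasurePreserving (swN swap n b) (Measure.infinitePi fun _ : Vtx d => lam)
      (Measure.infinitePi fun _ : Vtx d => lam) := by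
  classical
  have e : (swN swap n b : (Vtx d → Lab) → _) =
      fun η x => (if x ∈ n ∧ b = false then swap else id) (η x) := by
    funext η x
    rw [swN]; split_ifs <;> rfl
  have hm : ∀ x, Measurable (if x ∈ n ∧ b = false then swap else id : Lab → Lab) :=
    fun x => measurable_from_top.mono (by
      intro s _; exact (Set.toFinite s).measurableSet) le_rfl
  constructor
  · rw [e]; exact measurable_pi_lambda _ fun x => (hm x).comp (measurable_pi_apply x)
  · rw [e, Measure.infinitePi_map_pi _ hm]
    congr 1
    funext x
    split_ifs
    · exact hsw
    · exact Measure.map_id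

lemma UU_pres (hsw : lam.map swap = lam) (ξ : ℕ → Bool) (L : ℕ) :
    MeasurePreserving (UU op swap V0 ξ L) (Measure.infinitePi fun _ : Vtx d => lam)
      (Measure.infinitePi fun _ : Vtx d => lam) := by
  classical
  set μ := Measure.infinitePi fun _ : Vtx d => lam with hμ
  induction L with
  | zero => exact MeasurePreserving.id _
  | succ L ih =>
    set W : (Vtx d → Lab) → (Vtx d → Lab) := fun η => swN swap (NL op V0 L η) (ξ L) η
    have hWpre : ∀ B, W ⁻¹' B = ⋃ n, {η | NL op V0 L η = n} ∩ swN swap n (ξ L) ⁻¹' B := by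
      intro B
      ext η
      simp only [mem_iUnion]
      constructor
      · intro h; exact ⟨_, rfl, h⟩
      · rintro ⟨n, h1, h2⟩
        have h1 : NL op V0 L η = n := h1
        subst h1; exact h2
    have hWm : Measurable W := by
      intro B hB
      rw [hWpre]
      exact MeasurableSet.iUnion fun n => (NL_meas op V0 L n).inter
        ((swN_pres swap lam hsw n (ξ L)).measurable hB)
    have hW : MeasurePreserving W μ μ := by
      refine ⟨hWm, Measure.ext fun B hB => ?_⟩
      rw [Measure.map_apply hWm hB, hWpre, measure_iUnion]
      · have h3 : ∀ n, μ ({η | NL op V0 L η = n} ∩ swN swap n (ξ L) ⁻¹' B) =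
            μ ({η | NL op V0 L η = n} ∩ B) := by
          intro n
          have : {η | NL op V0 L η = n} ∩ swN swap n (ξ L) ⁻¹' B =
              swN swap n (ξ L) ⁻¹' ({η | NL op V0 L η = n} ∩ B) := by
            rw [preimage_inter]
            congr 1
            ext η
            refine NL_dep_compl op V0 L n _ _ fun x hx => ?_
            rw [swN, if_neg]
            exact fun h => hx h.1
          rw [this]
          exact (swN_pres swap lam hsw n (ξ L)).measure_preimage
            ((NL_meas op V0 L n).inter hB).nullMeasurableSet
        simp only [h3]
        rw [← measure_iUnion]
        · congr 1
          ext η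
          simp only [mem_iUnion]
          exact ⟨fun ⟨n, h⟩ => h.2, fun h => ⟨_, rfl, h⟩⟩
        · intro n n' hnn
          exact Set.disjoint_left.2 fun η h h' => hnn (h.1.symm.trans h'.1)
        · exact fun n => (NL_meas op V0 L n).inter hB
      · intro n n' hnn
        exact Set.disjoint_left.2 fun η h h' => hnn (h.1.symm.trans h'.1)
      · exact fun n => (NL_meas op V0 L n).inter
          ((swN_pres swap lam hsw n (ξ L)).measurable hB)
    exact hW.comp ih

theorem words_main (hsw : lam.map swap = lam) (val : Lab → Bool) (hv1 : ∀ a, op a → val a = true)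
    (hv2 : ∀ a, op (swap a) → val a = false) (E : ℕ → Set (Vtx d → Lab)) (L : ℕ → ℕ)
    (hE0 : E 0 = univ) (hEm : ∀ i, MeasurableSet (E i))
    (hEd : ∀ i η η', (∀ x ∈ QL op V0 (L i) η, η x = η' x) → η ∈ E i → η' ∈ E i)
    (hL : Monotone L)
    (hfar : ∀ n, ∃ i, ∀ η ∈ E i, ∃ x ∈ AL op V0 (L i) η, x ∉ AL op V0 n η) (ε : ENNReal)
    (hε : ∑' i, 2 ^ (L (i + 1)) * (Measure.infinitePi fun _ : Vtx d => lam) (E i \ E (i + 1)) ≤ ε) :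
    ∃ Bad : Set (Vtx d → Lab), (Measure.infinitePi fun _ : Vtx d => lam) Bad ≤ ε ∧
      ∀ η ∉ Bad, ∀ ξ, ∃ v, seesWord (fun x => val (η x)) ξ v := by
  classical
  set μ := Measure.infinitePi fun _ : Vtx d => lam with hμ
  set ext : (l : ℕ) → (Fin l → Bool) → ℕ → Bool := fun l w k => if h : k < l then w ⟨k, h⟩ else false
  refine ⟨⋃ i, ⋃ w : Fin (L (i + 1)) → Bool,
    UU op swap V0 (ext _ w) (L (i + 1)) ⁻¹' (E i \ E (i + 1)), ?_, ?_⟩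
  · refine (measure_iUnion_le _).trans (le_trans (ENNReal.tsum_le_tsum fun i => ?_) hε)
    refine (measure_iUnion_le _).trans ?_
    rw [tsum_fintype]
    have h1 : ∀ w : Fin (L (i + 1)) → Bool,
        μ (UU op swap V0 (ext _ w) (L (i + 1)) ⁻¹' (E i \ E (i + 1))) = μ (E i \ E (i + 1)) :=
      fun w => (UU_pres op swap V0 lam hsw (ext _ w) (L (i + 1))).measure_preimage
        ((hEm i).diff (hEm (i + 1))).nullMeasurableSet
    rw [Finset.sum_congr rfl fun w _ => h1 w]
    simp [Finset.sum_const]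
  · intro η hη0 ξ
    have hη : ∀ i (w : Fin (L (i + 1)) → Bool),
        η ∉ UU op swap V0 (ext _ w) (L (i + 1)) ⁻¹' (E i \ E (i + 1)) :=
      fun i w h => hη0 (mem_iUnion.2 ⟨i, mem_iUnion.2 ⟨w, h⟩⟩)
    have step : ∀ i, UU op swap V0 ξ (L (i + 1)) η ∉ E i \ E (i + 1) := by
      intro i
      have := hη i (fun k => ξ k)
      rw [UU_prefix op swap V0 ξ (ext _ fun k : Fin (L (i + 1)) => ξ k) (L (i + 1))
        (fun l hl => by simp [ext, hl])]
      exact this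
    have all : ∀ i, UU op swap V0 ξ (L i) η ∈ E i := by
      intro i
      induction i with
      | zero => rw [hE0]; trivial
      | succ i ih =>
        have h1 : UU op swap V0 ξ (L (i + 1)) η ∈ E i :=
          hEd i _ _ (UU_agree op swap V0 ξ (L i) (L (i + 1)) (hL (Nat.le_succ i)) η) ih
        by_contra hc
        exact step i ⟨h1, hc⟩
    obtain ⟨y, hy⟩ := konig (X := Vtx d) (fun n y => y 0 ∈ bdy V0 ∧
        (∀ k < n, adj (y k) (y (k + 1))) ∧ (∀ k ≤ n, ∀ k' ≤ n, y k = y k' → k = k') ∧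
        ∀ k ≤ n, val (η (y k)) = ξ k) (fun n => (grow univ)^[n] (bdy V0))
      (fun n m y hnm ⟨h1, h2, h3, h4⟩ => ⟨h1, fun k hk => h2 k (by omega),
        fun k hk k' hk' => h3 k (by omega) k' (by omega), fun k hk => h4 k (by omega)⟩)
      (fun n y z hyz ⟨h1, h2, h3, h4⟩ => ⟨hyz 0 (by omega) ▸ h1,
        fun k hk => by rw [← hyz k (by omega), ← hyz (k + 1) (by omega)]; exact h2 k hk,
        fun k hk k' hk' => by rw [← hyz k hk, ← hyz k' hk']; exact h3 k hk k' hk',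
        fun k hk => by rw [← hyz k hk]; exact h4 k hk⟩)
      (fun n y ⟨h1, h2, _⟩ => by
        have : ∀ k ≤ n, y k ∈ (grow univ)^[k] (bdy V0) := by
          intro k
          induction k with
          | zero => intro _; exact h1
          | succ k ih =>
            intro hk
            rw [Function.iterate_succ_apply']
            exact mem_grow.2 (Or.inr ⟨⟨_, ih (by omega), h2 k (by omega)⟩, mem_univ _⟩)
        exact this n le_rfl)
      (fun n => by
        obtain ⟨i, hi⟩ := hfar n
        obtain ⟨x, hx, hx'⟩ := hi _ (all i)
        exact read_word op swap V0 val hv1 hv2 ξ (L i) n η x hx hx')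
    refine ⟨y 0, y, rfl, fun a b hab => ?_, fun i => (hy (i + 1)).2.1 i (by omega),
      fun i => mem_univ _, fun i => (hy i).2.2.2 i le_rfl⟩
    exact (hy (max a b)).2.2.1 a (le_max_left _ _) b (le_max_right _ _) hab

end words

/-! ### Reachability -/
section reach
variable {d : ℕ}

inductive Rc (O c : Set (Vtx d)) : Vtx d → Prop
  | base {x} (h : x ∈ c) : Rc O c x
  | step {x y} (h : Rc O c x) (ha : adj x y) (hy : y ∈ O) : Rc O c y

lemma Rc.mono {O O' c c' : Set (Vtx d)} (hO : O ⊆ O') (hc : c ⊆ c') {x} (h : Rc O c x) :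
    Rc O' c' x := by
  induction h with
  | base h => exact .base (hc h)
  | step h ha hy ih => exact .step ih ha (hO hy)

lemma Rc.trans {O c c' : Set (Vtx d)} (hc : ∀ x ∈ c, Rc O c' x) {x} (h : Rc O c x) :
    Rc O c' x := by
  induction h with
  | base h => exact hc _ h
  | step h ha hy ih => exact .step ih ha hy

lemma Rc.mem {O c : Set (Vtx d)} {x} (h : Rc O c x) : x ∈ c ∨ x ∈ O := by
  cases h with
  | base h => exact .inl h
  | step h ha hy => exact .inr hy

lemma grow_iter_Rc {O : Set (Vtx d)} {c : Finset (Vtx d)} (n : ℕ) :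
    ∀ x ∈ (grow O)^[n] c, Rc O c x := by
  induction n with
  | zero => exact fun x hx => .base hx
  | succ n ih =>
    intro x hx
    rw [Function.iterate_succ_apply', mem_grow] at hx
    rcases hx with h | ⟨⟨y, hy, ha⟩, h⟩
    · exact ih x h
    · exact .step (ih y hy) ha h

lemma Rc_grow {O : Set (Vtx d)} {c G : Finset (Vtx d)} (hO : O ⊆ G) {n : ℕ} (hn : G.card ≤ n)
    {x : Vtx d} (h : Rc O c x) : x ∈ (grow O)^[n] c := by
  classical
  -- stabilisation
  have hst : ∃ k ≤ G.card, (grow O)^[k + 1] c = (grow O)^[k] c := by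
    by_contra hc
    push Not at hc
    have hcard : ∀ k ≤ G.card + 1, k + c.card ≤ ((grow O)^[k] c).card := by
      intro k
      induction k with
      | zero => simp
      | succ k ih =>
        intro hk
        have h1 := ih (by omega)
        have h2 : (grow O)^[k] c ⊂ (grow O)^[k + 1] c := by
          refine Finset.ssubset_iff_subset_ne.2 ⟨?_, fun e => hc k (by omega) e.symm⟩
          rw [Function.iterate_succ_apply']; exact le_grow _ _
        have := Finset.card_lt_card h2
        omega
    have h3 : ∀ k, (grow O)^[k] c ⊆ c ∪ G := by
      intro k y hy
      rcases (grow_iter_Rc k y hy).mem with h | h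
      · exact Finset.mem_union_left _ h
      · exact Finset.mem_union_right _ (hO h)
    have := hcard (G.card + 1) le_rfl
    have h4 := Finset.card_le_card (h3 (G.card + 1))
    have h5 := Finset.card_union_le c G
    omega
  obtain ⟨k, hk, e⟩ := hst
  have hx : x ∈ (grow O)^[k] c := by
    induction h with
    | base h => exact grow_iter_mono subset_rfl (Nat.zero_le k) subset_rfl h
    | step h ha hy ih =>
      rw [← e, Function.iterate_succ_apply', mem_grow]
      exact .inr ⟨⟨_, ih, ha⟩, hy⟩
  exact grow_iter_mono subset_rfl (hk.trans hn) subset_rfl hx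

/-- locality of growth -/
lemma grow_iter_local {O O' : Set (Vtx d)} {c : Finset (Vtx d)} (n : ℕ)
    (h : ∀ x ∈ bdy ((grow O)^[n] c), (x ∈ O ↔ x ∈ O')) : (grow O)^[n] c = (grow O')^[n] c := by
  induction n with
  | zero => rfl
  | succ n ih =>
    have hs : (grow O)^[n] c ⊆ (grow O)^[n + 1] c := by
      rw [Function.iterate_succ_apply']; exact le_grow _ _
    have hb : ∀ x ∈ bdy ((grow O)^[n] c), (x ∈ O ↔ x ∈ O') := fun x hx => by
      obtain ⟨y, hy, ha⟩ := mem_bdy.1 hx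
      exact h x (mem_bdy.2 ⟨y, hs hy, ha⟩)
    have e := ih hb
    rw [Function.iterate_succ_apply', Function.iterate_succ_apply', ← e]
    ext x
    rw [mem_grow, mem_grow]
    refine or_congr Iff.rfl ⟨fun ⟨h1, h2⟩ => ⟨h1, (hb x (mem_bdy.2 h1)).1 h2⟩,
      fun ⟨h1, h2⟩ => ⟨h1, (hb x (mem_bdy.2 h1)).2 h2⟩⟩

lemma Rc_local {O O' c G : Set (Vtx d)} (h : ∀ x ∈ G, (x ∈ O ↔ x ∈ O')) {x} (hx : Rc (O ∩ G) c x) :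
    Rc (O' ∩ G) c x := Rc.mono (O := O ∩ G) (c := c) (O' := O' ∩ G) (fun y hy => ⟨(h y hy.2).1 hy.1, hy.2⟩) subset_rfl hx

/-- boxes -/
def box (m : ℤ) (z : Vtx d) : Set (Vtx d) := {x | ∀ j, z j - m ≤ x j ∧ x j ≤ z j + m}

lemma box_finite (m : ℤ) (z : Vtx d) : (box m z).Finite :=
  (Set.finite_Icc (fun j => z j - m) (fun j => z j + m)).subset
    fun x hx => ⟨fun j => (hx j).1, fun j => (hx j).2⟩

lemma box_mono {m m' : ℤ} (h : m ≤ m') (z : Vtx d) : box m z ⊆ box m' z :=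
  fun x hx j => ⟨by linarith [(hx j).1], by linarith [(hx j).2]⟩

lemma mem_box_self {m : ℤ} (h : 0 ≤ m) (z : Vtx d) : z ∈ box m z :=
  fun j => ⟨by linarith, by linarith⟩

lemma adj_update (x : Vtx d) (i : Fin d) (a : ℤ) (h : |x i - a| = 1) :
    adj x (Function.update x i a) := by
  unfold adj
  rw [Finset.sum_eq_single i]
  · simp only [Function.update_self]
    rw [← sq_abs, h]; norm_num
  · intro j _ hj; simp [hj]
  · simp

lemma adj_cases {x y : Vtx d} (h : adj x y) :
    ∃ i, (y i = x i + 1 ∨ y i = x i - 1) ∧ ∀ j ≠ i, y j = x j := by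
  unfold adj at h
  have : ∃ i, x i - y i ≠ 0 := by
    by_contra hc
    push Not at hc
    simp [hc] at h
  obtain ⟨i, hi⟩ := this
  have h0 : 1 ≤ (x i - y i) ^ 2 := by
    have : 0 < (x i - y i) ^ 2 := by positivity
    omega
  have hs := Finset.add_sum_erase Finset.univ (fun i => (x i - y i) ^ 2) (Finset.mem_univ i)
  have h1 : 0 ≤ ∑ j ∈ Finset.univ.erase i, (x j - y j) ^ 2 :=
    Finset.sum_nonneg fun _ _ => sq_nonneg _
  simp only [h] at hs
  have h2 : ∑ j ∈ Finset.univ.erase i, (x j - y j) ^ 2 = 0 := by omega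
  have h3 : (x i - y i) ^ 2 = 1 := by omega
  refine ⟨i, ?_, fun j hj => ?_⟩
  · rcases mul_eq_zero.1 (show (x i - y i - 1) * (x i - y i + 1) = 0 by linarith [h3, sq (x i - y i)]) with h | h
    · right; omega
    · left; omega
  · have := (Finset.sum_eq_zero_iff_of_nonneg (fun _ _ => sq_nonneg _)).1 h2 j (by simp [hj])
    have := pow_eq_zero_iff (two_ne_zero) |>.1 this
    omega

lemma box_conn (m : ℤ) (z y : Vtx d) (hy : y ∈ box m z) :
    ∀ (n : ℕ) (x : Vtx d), x ∈ box m z → ∑ j, (x j - y j).natAbs = n → Rc (box m z) {y} x := by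
  intro n
  induction n with
  | zero =>
    intro x hx h
    refine .base ?_
    rw [Finset.sum_eq_zero_iff] at h
    exact funext fun j => by have := h j (Finset.mem_univ j); omega
  | succ n ih =>
    intro x hx h
    have : ∃ i, x i ≠ y i := by
      by_contra hc
      push Not at hc
      simp [hc] at h
    obtain ⟨i, hi⟩ := this
    obtain ⟨a, ha1, ha2, ha3⟩ : ∃ a : ℤ, |a - x i| = 1 ∧ (a - y i).natAbs + 1 = (x i - y i).natAbs ∧
        (z i - m ≤ a ∧ a ≤ z i + m) := by
      have h1 := hx i
      have h2 := hy i
      rcases lt_or_gt_of_ne hi with h | h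
      · exact ⟨x i + 1, by simp, by omega, by omega⟩
      · exact ⟨x i - 1, by simp, by omega, by omega⟩
    have hx' : Function.update x i a ∈ box m z := by
      intro j
      by_cases hj : j = i
      · subst hj; simpa using ha3
      · simpa [hj] using hx j
    have hsum : ∑ j, (Function.update x i a j - y j).natAbs = n := by
      rw [← Finset.add_sum_erase _ _ (Finset.mem_univ i)] at h ⊢
      rw [Function.update_self]
      have : ∑ j ∈ Finset.univ.erase i, (Function.update x i a j - y j).natAbs =
          ∑ j ∈ Finset.univ.erase i, (x j - y j).natAbs :=
        Finset.sum_congr rfl fun j hj => by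
          rw [Function.update_of_ne (Finset.ne_of_mem_erase hj)]
      omega
    refine .step (ih _ hx' hsum) ?_ hx
    have := adj_update (Function.update x i a) i (x i) (by simpa using ha1)
    simpa using this

lemma box_conn' {m : ℤ} {z x y : Vtx d} (hy : y ∈ box m z) (hx : x ∈ box m z) :
    Rc (box m z) {y} x := box_conn m z y hy _ x hx rfl

/-- first exit -/
lemma Rc_exit {O c : Set (Vtx d)} {z : Vtx d} {r : ℤ} (hc : c ⊆ box r z) {x : Vtx d} (h : Rc O c x) :
    (x ∈ box r z ∧ Rc (O ∩ box r z) c x) ∨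
      ∃ y w, w ∉ box r z ∧ w ∈ O ∧ adj y w ∧ Rc (O ∩ box r z) c y := by
  induction h with
  | base h => exact .inl ⟨hc h, .base h⟩
  | @step x y h ha hy ih =>
    rcases ih with ⟨h1, h2⟩ | h
    · by_cases hyb : y ∈ box r z
      · exact .inl ⟨hyb, .step h2 ha ⟨hy, hyb⟩⟩
      · exact .inr ⟨x, y, hyb, hy, ha, h2⟩
    · exact .inr h

/-! frames -/
def fr (e : Equiv.Perm (Fin d)) (sg : Fin d → ℤ) (s : Vtx d) (x : Vtx d) : Vtx d :=
  fun j => s j + sg j * x (e j)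

def IsSg (sg : Fin d → ℤ) : Prop := ∀ j, sg j = 1 ∨ sg j = -1

lemma IsSg.mul {sg : Fin d → ℤ} (h : IsSg sg) (j : Fin d) : sg j * sg j = 1 := by
  rcases h j with h | h <;> simp [h]

lemma fr_inj {e : Equiv.Perm (Fin d)} {sg : Fin d → ℤ} (h : IsSg sg) (s : Vtx d) :
    Function.Injective (fr e sg s) := by
  intro x y hxy
  funext j
  have := congrFun hxy (e.symm j)
  simp only [fr, Equiv.apply_symm_apply] at this
  rcases h (e.symm j) with h | h <;> rw [h] at this <;> linarith

lemma fr_surj {e : Equiv.Perm (Fin d)} {sg : Fin d → ℤ} (h : IsSg sg) (s y : Vtx d) :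
    fr e sg s (fun j => sg (e.symm j) * (y (e.symm j) - s (e.symm j))) = y := by
  funext j
  simp only [fr, Equiv.symm_apply_apply]
  rw [← mul_assoc, h.mul]; ring

lemma fr_adj {e : Equiv.Perm (Fin d)} {sg : Fin d → ℤ} (h : IsSg sg) (s x y : Vtx d) :
    adj (fr e sg s x) (fr e sg s y) ↔ adj x y := by
  unfold adj
  have : ∑ i, (fr e sg s x i - fr e sg s y i) ^ 2 = ∑ i, (x i - y i) ^ 2 := by
    rw [← Equiv.sum_comp e (fun i => (x i - y i) ^ 2)]
    refine Finset.sum_congr rfl fun i _ => ?_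
    simp only [fr]
    have := h.mul i
    calc _ = (sg i * sg i) * (x (e i) - y (e i)) ^ 2 := by ring
      _ = _ := by rw [this, one_mul]
  rw [this]

lemma fr_Rc {e : Equiv.Perm (Fin d)} {sg : Fin d → ℤ} (h : IsSg sg) (s : Vtx d)
    {O c : Set (Vtx d)} {x : Vtx d} :
    Rc (fr e sg s ⁻¹' O) (fr e sg s ⁻¹' c) x ↔ Rc O c (fr e sg s x) := by
  constructor
  · intro hx
    induction hx with
    | base h => exact .base h
    | step _ ha hy ih => exact .step ih ((fr_adj h s _ _).2 ha) hy
  · intro hx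
    generalize hy : fr e sg s x = y at hx
    induction hx generalizing x with
    | base h => exact .base (by rw [← hy] at h; exact h)
    | @step u v _ ha hO ih =>
      subst hy
      have := fr_surj (e := e) h s u
      refine .step (ih this) ?_ hO
      rwa [← this, fr_adj h] at ha

end reach

section prob

lemma Dep.meas_iSup {ι E : Type*} [MeasurableSpace E] [Nonempty E] {C : Set (ι → E)} {R : Set ι}
    (hC : MeasurableSet C) (dC : Dep C R) :
    MeasurableSet[⨆ i ∈ R, MeasurableSpace.comap (fun ω : ι → E => ω i) inferInstance] C := by
  classical
  obtain ⟨e0⟩ := ‹Nonempty E›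
  set m : ι → MeasurableSpace (ι → E) := fun i => MeasurableSpace.comap (fun ω => ω i) inferInstance
  have : C = (fun (ω : ι → E) i => if i ∈ R then ω i else e0) ⁻¹' C := by
    ext ω
    exact dC _ _ fun i hi => by simp [hi]
  rw [this]
  refine @measurable_pi_lambda _ _ _ (⨆ i ∈ R, m i) _ _ (fun i => ?_) _ hC
  by_cases hi : i ∈ R
  · simp only [hi, if_true]
    have : m i ≤ ⨆ i ∈ R, m i := le_iSup₂_of_le i hi le_rfl
    exact Measurable.mono (ma := m i) (comap_measurable _) this le_rfl
  · simp only [hi, if_false]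
    exact measurable_const

lemma zero_one {ι E : Type*} [MeasurableSpace E] [Nonempty E] (ρ : ι → Measure E)
    [∀ i, IsProbabilityMeasure (ρ i)] {A : Set (ι → E)} (hA : MeasurableSet A)
    (hd : ∀ F : Set ι, F.Finite → Dep A Fᶜ) :
    Measure.infinitePi ρ A = 0 ∨ Measure.infinitePi ρ A = 1 := by
  classical
  set m : ι → MeasurableSpace (ι → E) := fun i => MeasurableSpace.comap (fun ω => ω i) inferInstance
  have hind : ProbabilityTheory.iIndep m (Measure.infinitePi ρ) :=
    ProbabilityTheory.iIndepFun_infinitePi (X := fun _ x => x) (fun i => measurable_id)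
  have hle : ∀ i, m i ≤ MeasurableSpace.pi := fun i => (measurable_pi_apply i).comap_le
  refine ProbabilityTheory.measure_zero_or_one_of_measurableSet_limsup (s := m)
    (f := Filter.cofinite) (p := Set.Finite) (ns := fun F : Finset ι => (F : Set ι)) hle hind ?_ ?_ ?_ ?_ ?_
  · intro t ht; simpa using ht
  · intro F F'; exact ⟨F ∪ F', by simp, by simp⟩
  · intro F; exact F.finite_toSet
  · intro n; exact ⟨{n}, by simp⟩
  · rw [Filter.limsup_eq_iInf_iSup, MeasurableSpace.measurableSet_iInf]
    intro s
    rw [MeasurableSpace.measurableSet_iInf]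
    intro hs
    have := (hd sᶜ hs).meas_iSup hA
    rwa [compl_compl] at this

open Classical in
lemma inf_sum {ι : Type*} (ρ : ι → Measure Bool) [∀ i, IsProbabilityMeasure (ρ i)]
    (S : Finset ι) {A : Set (ι → Bool)} (hA : Dep A (S : Set ι)) (x0 : ι → Bool) :
    ∃ A' : Set (S → Bool), (∀ ω : ι → Bool, ω ∈ A ↔ S.restrict ω ∈ A') ∧
    (∀ a : S → Bool, a ∈ A' ↔ (fun i => if h : i ∈ S then a ⟨i, h⟩ else x0 i) ∈ A) ∧
    ((Measure.infinitePi ρ A).toReal = ∑ a : S → Bool, (∏ i : S, (ρ i {a i}).toReal) * (if a ∈ A' then 1 else 0)) := by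
  classical
  set A' : Set (S → Bool) := {a | (fun i => if h : i ∈ S then a ⟨i, h⟩ else x0 i) ∈ A}
  have h1 : ∀ ω : ι → Bool, ω ∈ A ↔ S.restrict ω ∈ A' := by
    intro ω
    refine hA _ _ fun i hi => ?_
    have hi' : i ∈ S := hi
    simp [hi']
  refine ⟨A', h1, fun a => Iff.rfl, ?_⟩
  have h2 : A = S.restrict ⁻¹' A' := by ext ω; exact h1 ω
  rw [h2, ← Measure.map_apply (by fun_prop) (Set.toFinite A').measurableSet,
    Measure.infinitePi_map_restrict]
  have h3 : A' = ((Finset.univ.filter (· ∈ A') : Finset (S → Bool)) : Set (S → Bool)) := by ext; simp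
  conv_lhs => rw [h3]
  rw [← sum_measure_singleton, ENNReal.toReal_sum (fun _ _ => measure_ne_top _ _), Finset.sum_filter]
  refine Finset.sum_congr rfl fun a _ => ?_
  rw [Measure.pi_singleton, ENNReal.toReal_prod]
  simp

lemma harris {ι : Type*} (ρ : ι → Measure Bool) [∀ i, IsProbabilityMeasure (ρ i)]
    (S : Finset ι) {A B : Set (ι → Bool)} (hA : Dep A (S : Set ι)) (hB : Dep B (S : Set ι))
    (lA : IsLowerSet A) (lB : IsLowerSet B) :
    Measure.infinitePi ρ A * Measure.infinitePi ρ B ≤ Measure.infinitePi ρ (A ∩ B) := by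
  classical
  set μ := Measure.infinitePi ρ
  obtain ⟨A', a1, a2, a3⟩ := inf_sum ρ S hA (fun _ => false)
  obtain ⟨B', b1, b2, b3⟩ := inf_sum ρ S hB (fun _ => false)
  obtain ⟨C', c1, c2, c3⟩ := inf_sum ρ S (hA.inter hB) (fun _ => false)
  obtain ⟨U', u1, u2, u3⟩ := inf_sum ρ S (A := univ) (fun _ _ _ => Iff.rfl) (fun _ => false)
  have hle : ∀ a b : S → Bool, a ≤ b → (fun i => if h : i ∈ S then a ⟨i, h⟩ else false) ≤
      (fun i => if h : i ∈ S then b ⟨i, h⟩ else false) := by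
    intro a b hab i
    by_cases h : i ∈ S
    · simpa [h] using hab ⟨i, h⟩
    · simp [h]
  have key := fkg (α := (S → Bool)ᵒᵈ) (β := ℝ) (μ := fun a => ∏ i : S, (ρ i {(OrderDual.ofDual a) i}).toReal)
    (f := fun a => if OrderDual.ofDual a ∈ A' then 1 else 0)
    (g := fun a => if OrderDual.ofDual a ∈ B' then 1 else 0)
    (fun a => Finset.prod_nonneg fun _ _ => ENNReal.toReal_nonneg)
    (fun a => by dsimp only; split_ifs <;> simp) (fun a => by dsimp only; split_ifs <;> simp)
    (by
      intro a b hab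
      dsimp only
      by_cases h : OrderDual.ofDual a ∈ A'
      · have : OrderDual.ofDual b ∈ A' := (a2 _).2 (lA (hle _ _ hab) ((a2 _).1 h))
        rw [if_pos h, if_pos this]
      · rw [if_neg h]; split_ifs <;> simp)
    (by
      intro a b hab
      dsimp only
      by_cases h : OrderDual.ofDual a ∈ B'
      · have : OrderDual.ofDual b ∈ B' := (b2 _).2 (lB (hle _ _ hab) ((b2 _).1 h))
        rw [if_pos h, if_pos this]
      · rw [if_neg h]; split_ifs <;> simp)
    (by
      intro a b
      rw [← Finset.prod_mul_distrib, ← Finset.prod_mul_distrib]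
      refine le_of_eq (Finset.prod_congr rfl fun i _ => ?_)
      simp only [ofDual_inf, ofDual_sup, Pi.sup_apply, Pi.inf_apply]
      cases OrderDual.ofDual a i <;> cases OrderDual.ofDual b i <;> simp [mul_comm])
  have e1 : (μ A).toReal * (μ B).toReal ≤ (μ univ).toReal * (μ (A ∩ B)).toReal := by
    have key' : (∑ a : S → Bool, (∏ i : S, (ρ i {a i}).toReal) * (if a ∈ A' then (1:ℝ) else 0)) *
        (∑ a : S → Bool, (∏ i : S, (ρ i {a i}).toReal) * (if a ∈ B' then (1:ℝ) else 0)) ≤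
        (∑ a : S → Bool, (∏ i : S, (ρ i {a i}).toReal)) *
        (∑ a : S → Bool, (∏ i : S, (ρ i {a i}).toReal) *
          ((if a ∈ A' then (1:ℝ) else 0) * (if a ∈ B' then (1:ℝ) else 0))) := key
    have hu : ∀ a : S → Bool, a ∈ U' := fun a => (u2 a).2 trivial
    have hc : ∀ a : S → Bool, (if a ∈ C' then (1:ℝ) else 0) =
        (if a ∈ A' then (1:ℝ) else 0) * (if a ∈ B' then (1:ℝ) else 0) := by
      intro a
      have : a ∈ C' ↔ a ∈ A' ∧ a ∈ B' := by rw [c2, a2, b2]; rfl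
      by_cases h1 : a ∈ A' <;> by_cases h2 : a ∈ B' <;> simp [this, h1, h2]
    rw [a3, b3, c3, u3]
    simp only [hc, hu, if_true, mul_one]
    convert key' using 2
  rw [measure_univ, ENNReal.toReal_one, one_mul, ← ENNReal.toReal_mul] at e1
  exact (ENNReal.toReal_le_toReal (ENNReal.mul_ne_top (measure_ne_top _ _) (measure_ne_top _ _))
    (measure_ne_top _ _)).1 e1

lemma harris_prod {ι κ : Type*} (ρ : ι → Measure Bool) [∀ i, IsProbabilityMeasure (ρ i)]
    (S : Finset ι) (A : κ → Set (ι → Bool)) (hA : ∀ k, Dep (A k) (S : Set ι))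
    (lA : ∀ k, IsLowerSet (A k)) (T : Finset κ) :
    ∏ k ∈ T, Measure.infinitePi ρ (A k) ≤ Measure.infinitePi ρ (⋂ k ∈ T, A k) := by
  classical
  induction T using Finset.induction_on with
  | empty => simp
  | insert k T hk ih =>
    rw [Finset.prod_insert hk, Finset.set_biInter_insert]
    refine (mul_le_mul_right ih _).trans (harris ρ S (hA k) ?_ (lA k) ?_)
    · refine fun ω ω' h => ?_
      simp only [mem_iInter]
      exact forall_congr' fun k => forall_congr' fun _ => hA k ω ω' h
    · exact isLowerSet_iInter fun k => isLowerSet_iInter fun _ => lA k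

end prob

section hits
variable {d : ℕ}

def opn (ω : Config d) : Set (Vtx d) := {x | ω x = true}

def EB (m r : ℤ) : Set (Config d) :=
  {ω | ∃ w, w ∉ box r 0 ∧ w ∈ opn ω ∧ ∃ y, adj y w ∧ Rc (opn ω ∩ box r 0) (box m 0) y}

def INF (m : ℤ) : Set (Config d) := {ω | ∀ r : ℤ, ∃ x, x ∉ box r 0 ∧ Rc (opn ω) (box m 0) x}

lemma Rc_in {O c : Set (Vtx d)} {m r : ℤ} {z : Vtx d} (h : m ≤ r) (hc : c = box m z) {y : Vtx d}
    (hy : Rc (O ∩ box r z) c y) : y ∈ box r z := by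
  rcases hy.mem with h1 | h1
  · rw [hc] at h1; exact box_mono h z h1
  · exact h1.2

lemma adj_box {r : ℤ} {z x y : Vtx d} (hx : x ∈ box r z) (h : adj x y) : y ∈ box (r + 1) z := by
  intro j
  have := abs_le.1 (adj_coord h j)
  have := hx j
  constructor <;> omega

lemma EB_dep {m r : ℤ} (h : m ≤ r) : Dep (EB m r : Set (Config d)) (box (r + 1) 0) := by
  refine dep_of ?_
  rintro ω ω' hh ⟨w, hw, ho, y, ha, hy⟩
  have hyb := Rc_in h rfl hy
  refine ⟨w, hw, ?_, y, ha, Rc_local (fun x hx => ?_) hy⟩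
  · have := hh w (adj_box hyb ha)
    exact this.symm.trans ho
  · have := hh x (box_mono (by omega) _ hx)
    change ω x = true ↔ ω' x = true
    rw [this]

lemma EB_anti {m r r' : ℤ} (h : m ≤ r) (h' : r ≤ r') : (EB m r' : Set (Config d)) ⊆ EB m r := by
  rintro ω ⟨w, hw, ho, y, ha, hy⟩
  have : Rc (opn ω) (box m 0) w := .step (hy.mono inter_subset_left subset_rfl) ha ho
  rcases Rc_exit (box_mono h 0) this with h1 | ⟨y, w, h1, h2, h3, h4⟩
  · exact absurd (box_mono h' _ h1.1) hw
  · exact ⟨w, h1, h2, y, h3, h4⟩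

lemma INF_eq (m : ℤ) : (INF m : Set (Config d)) = ⋂ n : ℕ, EB m (m + n) := by
  ext ω
  rw [mem_iInter]
  constructor
  · intro h n
    obtain ⟨x, hx, hR⟩ := h (m + n)
    rcases Rc_exit (box_mono (by omega : m ≤ m + n) 0) hR with h1 | ⟨y, w, h1, h2, h3, h4⟩
    · exact absurd h1.1 hx
    · exact ⟨w, h1, h2, y, h3, h4⟩
  · intro h r
    obtain ⟨w, hw, ho, y, ha, hy⟩ := h (r - m).toNat
    exact ⟨w, fun hh => hw (box_mono (by omega) _ hh),
      .step (hy.mono inter_subset_left subset_rfl) ha ho⟩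

lemma EB_meas {m r : ℤ} (h : m ≤ r) : MeasurableSet (EB m r : Set (Config d)) :=
  (EB_dep h).meas (box_finite _ _)

lemma INF_meas (m : ℤ) : MeasurableSet (INF m : Set (Config d)) := by
  rw [INF_eq]
  exact MeasurableSet.iInter fun n => EB_meas (by omega)

lemma INF_mono {m m' : ℤ} (h : m ≤ m') : (INF m : Set (Config d)) ⊆ INF m' :=
  fun ω hω r => by
    obtain ⟨x, hx, hR⟩ := hω r
    exact ⟨x, hx, hR.mono subset_rfl (box_mono h 0)⟩

lemma finite_sub_box {F : Set (Vtx d)} (hF : F.Finite) : ∃ n : ℕ, F ⊆ box n 0 := by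
  induction F, hF using Set.Finite.induction_on with
  | empty => exact ⟨0, by simp⟩
  | @insert a s ha hs ih =>
    obtain ⟨n, hn⟩ := ih
    refine ⟨n + ∑ j, (a j).natAbs, ?_⟩
    rw [insert_subset_iff]
    constructor
    · intro j
      have := Finset.single_le_sum (f := fun j => (a j).natAbs) (fun i _ => Nat.zero_le _) (Finset.mem_univ j)
      have h0 : (0 : Vtx d) j = 0 := rfl
      rw [h0]
      omega
    · exact hn.trans (box_mono (by omega) _)

lemma INF_tail (F : Set (Vtx d)) (hF : F.Finite) : Dep (⋃ m : ℕ, (INF m : Set (Config d))) Fᶜ := by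
  refine dep_of ?_
  intro ω ω' hh hω
  obtain ⟨m, hm⟩ := mem_iUnion.1 hω
  obtain ⟨n, hn⟩ := finite_sub_box hF
  refine mem_iUnion.2 ⟨m + n, ?_⟩
  have h1 : ω ∈ INF ((m + n : ℕ) : ℤ) := INF_mono (by push_cast; omega) hm
  intro r
  obtain ⟨x, hx, hR⟩ := h1 r
  refine ⟨x, hx, ?_⟩
  clear hx
  induction hR with
  | base h => exact .base h
  | @step u v _ ha hv ih =>
    by_cases hvb : v ∈ box ((m + n : ℕ) : ℤ) 0
    · exact .base hvb
    · refine .step ih ha ?_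
      have : v ∉ F := fun h => hvb (box_mono (by push_cast; omega) _ (hn h))
      exact (hh v this).symm.trans hv

lemma perc_INF : {ω : Config d | PercolatesAt ω (fun _ => 0)} ⊆ INF 0 := by
  rintro ω ⟨C, h0, hC, ho, hc⟩ r
  obtain ⟨x, hx, hxr⟩ := hC.exists_notMem_finite (box_finite r 0)
  refine ⟨x, hxr, ?_⟩
  obtain ⟨n, γ, g0, gn, ga, gC⟩ := hc _ h0 _ hx
  have : ∀ i ≤ n, Rc (opn ω) (box 0 0) (γ i) := by
    intro i
    induction i with
    | zero => intro _; rw [g0]; exact .base (mem_box_self le_rfl _)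
    | succ i ih => exact fun hi => .step (ih (by omega)) (ga i (by omega)) (ho _ (gC _ hi))
  rw [← gn]; exact this n le_rfl

variable (ρ : Measure Bool) [IsProbabilityMeasure ρ]

lemma INF_one (hp : 0 < (Measure.infinitePi fun _ : Vtx d => ρ) {ω | PercolatesAt ω (fun _ => 0)}) :
    Filter.Tendsto (fun m : ℕ => (Measure.infinitePi fun _ : Vtx d => ρ) (INF m)ᶜ) Filter.atTop (nhds 0) := by
  set ν := (Measure.infinitePi fun _ : Vtx d => ρ)
  have hm : MeasurableSet (⋃ m : ℕ, (INF m : Set (Config d))) := MeasurableSet.iUnion fun m => INF_meas _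
  have h1 : ν (⋃ m : ℕ, (INF m : Set (Config d))) = 1 := by
    rcases zero_one (fun _ : Vtx d => ρ) hm INF_tail with h | h
    · exfalso
      refine hp.ne' (measure_mono_null (perc_INF.trans ?_) h)
      exact subset_iUnion (fun m : ℕ => (INF m : Set (Config d))) 0
    · exact h
  have h2 := tendsto_measure_iInter_atTop (μ := ν) (s := fun m : ℕ => (INF m : Set (Config d))ᶜ)
    (fun m => (INF_meas _).compl.nullMeasurableSet)
    (fun m m' h => compl_subset_compl.2 (INF_mono (by exact_mod_cast h))) ⟨0, measure_ne_top _ _⟩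
  rw [← compl_iUnion, prob_compl_eq_one_sub hm, h1, tsub_self] at h2
  exact h2

/-- outer neighbours -/
def YY (m k : ℤ) (ω : Config d) : Set (Vtx d) :=
  {y | y ∉ box k 0 ∧ ∃ x, adj x y ∧ Rc (opn ω ∩ box k 0) (box m 0) x}

lemma YY_sub {m k : ℤ} (h : m ≤ k) (ω : Config d) : YY m k ω ⊆ box (k + 1) 0 := by
  rintro y ⟨hy, x, ha, hx⟩
  exact adj_box (Rc_in h rfl hx) ha

lemma YY_fin {m k : ℤ} (h : m ≤ k) (ω : Config d) : (YY m k ω).Finite :=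
  (box_finite _ _).subset (YY_sub h ω)

lemma YY_mono {m k : ℤ} {ω ω' : Config d} (h : ω ≤ ω') : YY m k ω ⊆ YY m k ω' := by
  rintro y ⟨hy, x, ha, hx⟩
  refine ⟨hy, x, ha, hx.mono (inter_subset_inter_left _ fun z hz => ?_) subset_rfl⟩
  have := h z
  have hz' : ω z = true := hz
  rw [hz'] at this
  exact le_antisymm le_top this

lemma YY_loc {m k : ℤ} {ω ω' : Config d} (h : ∀ x ∈ box k 0, ω x = ω' x) : YY m k ω = YY m k ω' := by
  have : ∀ ω ω' : Config d, (∀ x ∈ box k 0, ω x = ω' x) → YY m k ω ⊆ YY m k ω' := by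
    rintro ω ω' h y ⟨hy, x, ha, hx⟩
    refine ⟨hy, x, ha, Rc_local (fun z hz => ?_) hx⟩
    change ω z = true ↔ ω' z = true
    rw [h z hz]
  exact (this _ _ h).antisymm (this _ _ fun x hx => (h x hx).symm)

lemma hits1 (hp : 0 < (Measure.infinitePi fun _ : Vtx d => ρ) {ω | PercolatesAt ω (fun _ => 0)})
    (hf : ρ {false} ≠ 0) (η : ENNReal) (hη : η ≠ 0) :
    ∃ m : ℕ, ∀ K : ℕ, ∃ r : ℤ, m ≤ r ∧ ∀ k : ℤ, r ≤ k →
      (Measure.infinitePi fun _ : Vtx d => ρ) {ω | (YY m k ω).ncard < K} ≤ η := by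
  classical
  set ν := (Measure.infinitePi fun _ : Vtx d => ρ) with hν
  have hη2 : η / 2 ≠ 0 := by simpa using hη
  obtain ⟨m, hm⟩ := ((INF_one ρ hp).eventually (ge_mem_nhds (pos_iff_ne_zero.2 hη2))).exists
  refine ⟨m, fun K => ?_⟩
  set b := ρ {false} with hb
  have hbK : b ^ K ≠ 0 := pow_ne_zero _ hf
  have hb1 : b ≤ 1 := prob_le_one
  have hbt : b ≠ ⊤ := ne_top_of_le_ne_top ENNReal.one_ne_top hb1
  have hlim := tendsto_measure_iInter_atTop (μ := ν)
    (s := fun n : ℕ => (EB (m : ℤ) (m + n) \ INF m : Set (Config d)))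
    (fun n => ((EB_meas (by omega)).diff (INF_meas _)).nullMeasurableSet)
    (fun n n' h => diff_subset_diff_left (EB_anti (by omega) (by omega))) ⟨0, measure_ne_top _ _⟩
  have he : (⋂ n : ℕ, (EB (m : ℤ) (m + n) \ INF m : Set (Config d))) = ∅ := by
    rw [eq_empty_iff_forall_notMem]
    intro ω h
    rw [mem_iInter] at h
    refine (h 0).2 ?_
    rw [INF_eq, mem_iInter]
    exact fun n => (h n).1
  rw [he, measure_empty] at hlim
  obtain ⟨n, hn⟩ := (hlim.eventually (ge_mem_nhds (pos_iff_ne_zero.2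
    (mul_ne_zero hη2 hbK)))).exists
  refine ⟨m + n + 1, by omega, fun k hk => ?_⟩
  have hmk : (m : ℤ) ≤ k := by omega
  set A : Set (Config d) := {ω | (YY (m : ℤ) k ω).ncard < K} ∩
    {ω | ∃ x, x ∉ box ((m : ℤ) + n) 0 ∧ Rc (opn ω ∩ box k 0) (box m 0) x} with hA
  have hsub : {ω | (YY (m : ℤ) k ω).ncard < K} ⊆ (INF (m : ℤ))ᶜ ∪ A := by
    intro ω hω
    by_cases h : ∃ x, x ∉ box ((m : ℤ) + n) 0 ∧ Rc (opn ω ∩ box k 0) (box m 0) x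
    · exact .inr ⟨hω, h⟩
    · left
      intro hI
      apply h
      obtain ⟨x, hx, hR⟩ := hI k
      rcases Rc_exit (r := (m : ℤ) + n) (box_mono (by omega) 0) hR with h1 | ⟨y, w, h1, h2, h3, h4⟩
      · exact absurd (box_mono (by omega) _ h1.1) hx
      · refine ⟨w, h1, .step (h4.mono (inter_subset_inter_right _ (box_mono (by omega) _)) subset_rfl) h3 ⟨h2, ?_⟩⟩
        exact box_mono (by omega) _ (adj_box (Rc_in (by omega) rfl h4) h3)
  have hcl : ν A * b ^ K ≤ ν (EB (m : ℤ) (m + n) \ INF m) := by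
    have hdep : ∀ v : Finset (Vtx d), Dep (A ∩ {ω | (YY_fin hmk ω).toFinset = v}) (box k 0) := by
      intro v
      refine dep_of ?_
      rintro ω ω' hh ⟨⟨h1, x, hx, hR⟩, h2⟩
      have e := YY_loc (m := m) hh
      refine ⟨⟨?_, x, hx, Rc_local (fun z hz => ?_) hR⟩, ?_⟩
      · change (YY (m : ℤ) k ω').ncard < K
        rw [← e]; exact h1
      · change ω z = true ↔ ω' z = true
        rw [hh z hz]
      · change (YY_fin hmk ω').toFinset = v
        rw [← h2]
        simp [e]
    refine closing (fun _ : Vtx d => ρ) false b (fun ω => (YY_fin hmk ω).toFinset) K hb1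
      (fun _ _ _ _ => le_rfl) (fun v => (hdep v).meas (box_finite _ _)) ?_ ?_ ?_
    · intro v ω ω' hh
      by_cases hv : ∀ y ∈ v, y ∉ box k 0
      · exact hdep v ω ω' fun i hi => hh i fun h => hv i h hi
      · have : ∀ ω : Config d, ω ∉ (A ∩ {ω | (YY_fin hmk ω).toFinset = v}) := by
          rintro ω ⟨_, h⟩
          apply hv
          intro y hy
          have h' : (YY_fin hmk ω).toFinset = v := h
          rw [← h', Set.Finite.mem_toFinset] at hy
          exact hy.1
        simp [this]
    · rintro ω ⟨h, _⟩
      have h' : (YY (m : ℤ) k ω).ncard < K := h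
      rw [Set.ncard_eq_toFinset_card _ (YY_fin hmk ω)] at h'
      exact h'.le
    · rintro ω ⟨h1, x, hx, hR⟩ hclosed
      constructor
      · rcases Rc_exit (r := (m : ℤ) + n) (box_mono (by omega) 0) (hR.mono inter_subset_left subset_rfl) with h1 | ⟨y, w, h1, h2, h3, h4⟩
        · exact absurd h1.1 hx
        · exact ⟨w, h1, h2, y, h3, h4⟩
      · intro hI
        obtain ⟨u, hu, hRu⟩ := hI k
        rcases Rc_exit (r := k) (box_mono hmk 0) hRu with h1 | ⟨y, w, h1, h2, h3, h4⟩
        · exact hu h1.1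
        · have := hclosed w (by rw [Set.Finite.mem_toFinset]; exact ⟨h1, y, h3, h4⟩)
          have h2' : ω w = true := h2
          rw [h2'] at this
          exact absurd this (by simp)
  have hA2 : ν A ≤ η / 2 := by
    have := hcl.trans hn
    exact (ENNReal.mul_le_mul_iff_left hbK (ENNReal.pow_ne_top hbt)).1 this
  calc ν _ ≤ ν ((INF (m : ℤ))ᶜ ∪ A) := measure_mono hsub
    _ ≤ ν (INF (m : ℤ))ᶜ + ν A := measure_union_le _ _
    _ ≤ η / 2 + η / 2 := add_le_add hm hA2
    _ = η := ENNReal.add_halves _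

end hits

lemma sum_cond {Ω κ : Type*} [MeasurableSpace Ω] [Countable κ] (μ : Measure Ω)
    [IsProbabilityMeasure μ] (f : Ω → κ) (hf : ∀ v, MeasurableSet {ω | f ω = v}) {B : Set Ω} (ε : ENNReal)
    (h : ∀ v, μ ({ω | f ω = v} ∩ B) ≤ ε * μ {ω | f ω = v}) : μ B ≤ ε := by
  calc μ B ≤ μ (⋃ v, {ω | f ω = v} ∩ B) :=
        measure_mono fun ω hω => mem_iUnion.2 ⟨f ω, rfl, hω⟩
    _ ≤ ∑' v, μ ({ω | f ω = v} ∩ B) := measure_iUnion_le _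
    _ ≤ ∑' v, ε * μ {ω | f ω = v} := ENNReal.tsum_le_tsum h
    _ = ε * ∑' v, μ {ω | f ω = v} := ENNReal.tsum_mul_left
    _ = ε * μ (⋃ v, {ω | f ω = v}) := by
        rw [measure_iUnion _ hf]
        exact fun v w hvw => Set.disjoint_left.2 fun ω h h' => hvw (h.symm.trans h')
    _ ≤ ε * 1 := by gcongr; exact prob_le_one
    _ = ε := mul_one _

section hits
variable {d : ℕ}

lemma fr_box {e : Equiv.Perm (Fin d)} {sg : Fin d → ℤ} (h : IsSg sg) (s z x : Vtx d) (r : ℤ) :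
    fr e sg s x ∈ box r (fr e sg s z) ↔ x ∈ box r z := by
  have key : ∀ j, (fr e sg s z j - r ≤ fr e sg s x j ∧ fr e sg s x j ≤ fr e sg s z j + r) ↔
      (z (e j) - r ≤ x (e j) ∧ x (e j) ≤ z (e j) + r) := by
    intro j
    simp only [fr]
    rcases h j with h | h <;> rw [h] <;> constructor <;> rintro ⟨h1, h2⟩ <;> constructor <;> linarith
  constructor
  · intro hx j
    have := (key (e.symm j)).1 (hx _)
    simpa using this
  · exact fun hx j => (key j).2 (hx _)

lemma fr_zero (e : Equiv.Perm (Fin d)) (sg : Fin d → ℤ) (s : Vtx d) : fr e sg s 0 = s := by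
  funext j; simp [fr]

lemma fr_box0 {e : Equiv.Perm (Fin d)} {sg : Fin d → ℤ} (h : IsSg sg) (s : Vtx d) (r : ℤ) :
    fr e sg s ⁻¹' (box r s) = box r 0 := by
  ext x
  have := fr_box (e := e) h s 0 x r
  rw [fr_zero] at this
  exact this

lemma fr_surj' {e : Equiv.Perm (Fin d)} {sg : Fin d → ℤ} (h : IsSg sg) (s : Vtx d) :
    Function.Surjective (fr e sg s) := fun y => ⟨_, fr_surj h s y⟩

variable (i0 : Fin d)

def PS (k : ℤ) : Set (Vtx d) := {y | y i0 = k + 1 ∧ ∀ j ≠ i0, 0 ≤ y j ∧ y j ≤ k}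

lemma YY_fr {e : Equiv.Perm (Fin d)} {sg : Fin d → ℤ} (h : IsSg sg) (m k : ℤ) (ω : Config d) :
    YY m k (fun x => ω (fr e sg 0 x)) = fr e sg 0 ⁻¹' (YY m k ω) := by
  have e0 : opn (fun x => ω (fr e sg 0 x)) ∩ box k 0 = fr e sg 0 ⁻¹' (opn ω ∩ box k 0) := by
    rw [preimage_inter, fr_box0 h]; rfl
  ext y
  have hb : ∀ y, fr e sg 0 y ∈ box k 0 ↔ y ∈ box k 0 := fun y => by
    rw [← mem_preimage, fr_box0 h]
  refine and_congr (not_congr (hb y).symm) ⟨?_, ?_⟩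
  · rintro ⟨x, ha, hx⟩
    refine ⟨fr e sg 0 x, (fr_adj h _ _ _).2 ha, ?_⟩
    rw [e0, ← fr_box0 h 0 m (e := e)] at hx
    exact (fr_Rc h 0).1 hx
  · rintro ⟨x, ha, hx⟩
    obtain ⟨x, rfl⟩ := fr_surj' (e := e) h 0 x
    refine ⟨x, (fr_adj h _ _ _).1 ha, ?_⟩
    rw [e0, ← fr_box0 h 0 m (e := e)]
    exact (fr_Rc h 0).2 hx

def sgB (b : Fin d → Bool) : Fin d → ℤ := fun j => if b j then 1 else -1

lemma sgB_sg (b : Fin d → Bool) : IsSg (sgB b) := fun j => by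
  unfold sgB; split_ifs <;> simp

variable (ρ : Measure Bool) [IsProbabilityMeasure ρ]

lemma fr_pres {e : Equiv.Perm (Fin d)} {sg : Fin d → ℤ} (h : IsSg sg) (s : Vtx d) {A : Set (Config d)}
    (hA : MeasurableSet A) : (Measure.infinitePi fun _ : Vtx d => ρ) {ω | (fun x => ω (fr e sg s x)) ∈ A} =
      (Measure.infinitePi fun _ : Vtx d => ρ) A := by
  have := Measure.map_infinitePi_infinitePi_of_inj (P := fun _ : Vtx d => ρ) (fr_inj (e := e) h s)
  conv_rhs => rw [← this]
  rw [Measure.map_apply (measurable_pi_lambda _ fun i => measurable_pi_apply _) hA]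
  rfl

def Few (m k : ℤ) (K : ℕ) : Set (Config d) := {ω | (YY m k ω ∩ PS i0 k).ncard < K}

lemma Few_dep (m k : ℤ) (K : ℕ) : Dep (Few i0 m k K) (box k 0) := by
  intro ω ω' h
  change (YY m k ω ∩ PS i0 k).ncard < K ↔ (YY m k ω' ∩ PS i0 k).ncard < K
  rw [YY_loc h]

lemma hits2 (hp : 0 < (Measure.infinitePi fun _ : Vtx d => ρ) {ω | PercolatesAt ω (fun _ => 0)})
    (hf : ρ {false} ≠ 0) (η : ENNReal) (hη : η ≠ 0) :
    ∃ m : ℕ, ∀ K : ℕ, 0 < K → ∃ r : ℤ, m ≤ r ∧ ∀ k : ℤ, r ≤ k →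
      (Measure.infinitePi fun _ : Vtx d => ρ) (Few i0 m k K) ≤ η := by
  classical
  set ν := (Measure.infinitePi fun _ : Vtx d => ρ) with hν
  set PI := Fin d × (Fin d → Bool)
  set N := Fintype.card PI with hN
  have hN0 : N ≠ 0 := by
    rw [hN]; exact (Fintype.card_pos_iff.2 ⟨(i0, fun _ => true)⟩).ne'
  obtain ⟨m, hm⟩ := hits1 ρ hp hf (η ^ N) (pow_ne_zero _ hη)
  refine ⟨m, fun K hK => ?_⟩
  obtain ⟨r, hr, h⟩ := hm (N * K)
  refine ⟨r, hr, fun k hk => ?_⟩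
  have hmk : (m : ℤ) ≤ k := by omega
  set φ : PI → Vtx d → Vtx d := fun π => fr (Equiv.swap i0 π.1) (sgB π.2) 0 with hφ
  set A : PI → Set (Config d) := fun π => {ω | (fun x => ω (φ π x)) ∈ Few i0 (m : ℤ) k K}
  have hFm : MeasurableSet (Few i0 (m : ℤ) k K) := (Few_dep i0 m k K).meas (box_finite _ _)
  have hAν : ∀ π, ν (A π) = ν (Few i0 (m : ℤ) k K) := fun π => fr_pres ρ (sgB_sg _) 0 hFm
  have hAeq : ∀ π ω, (YY m k (fun x => ω (φ π x)) ∩ PS i0 k) = (φ π) ⁻¹' (YY m k ω) ∩ PS i0 k :=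
    fun π ω => by rw [YY_fr (sgB_sg _)]
  have hpr := harris_prod (fun _ : Vtx d => ρ) (box_finite k (0 : Vtx d)).toFinset A (by
      intro π ω ω' hh
      refine Few_dep i0 m k K _ _ fun x hx => hh _ ?_
      rw [Set.Finite.coe_toFinset, ← mem_preimage, fr_box0 (sgB_sg _)]
      exact hx) (by
      intro π ω ω' hle hω
      refine lt_of_le_of_lt (Set.ncard_le_ncard ?_ ((YY_fin hmk _).inter_of_left _)) hω
      exact inter_subset_inter_left _ (YY_mono fun x => hle _)) Finset.univ
  have hsub : (⋂ π ∈ (Finset.univ : Finset PI), A π) ⊆ {ω | (YY (m : ℤ) k ω).ncard < N * K} := by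
    intro ω hω
    have hω' : ∀ π, (YY m k (fun x => ω (φ π x)) ∩ PS i0 k).ncard < K := fun π => by
      have := mem_iInter₂.1 hω π (Finset.mem_univ _)
      exact this
    have hcov : YY (m : ℤ) k ω ⊆ ⋃ π ∈ (Finset.univ : Finset PI), (φ π) '' (YY m k (fun x => ω (φ π x)) ∩ PS i0 k) := by
      intro y hy
      obtain ⟨hyb, x, ha, hx⟩ := hy
      have hxb := Rc_in hmk rfl hx
      obtain ⟨i, hi, hj⟩ := adj_cases ha
      have hxj : ∀ j, -k ≤ x j ∧ x j ≤ k := fun j => by have := hxb j; simpa using this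
      have hyi : y i = k + 1 ∨ y i = -(k + 1) := by
        by_contra hc
        apply hyb
        intro j
        have h0 : (0 : Vtx d) j = 0 := rfl
        rw [h0]
        by_cases hji : j = i
        · subst hji
          have := hxj j
          omega
        · rw [hj j hji]
          have := hxj j
          omega
      set b : Fin d → Bool := fun j => decide (0 ≤ y j)
      have hS := sgB_sg b
      have hsy : ∀ j, sgB b j * y j = |y j| := by
        intro j
        simp only [sgB, b]
        by_cases h : 0 ≤ y j
        · simp [h, abs_of_nonneg h]
        · simp [h, abs_of_neg (not_le.1 h)]
      refine mem_biUnion (Finset.mem_univ (i, b)) ?_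
      have hs := fr_surj (e := Equiv.swap i0 i) hS 0 y
      refine ⟨_, ⟨?_, ?_⟩, hs⟩
      · rw [YY_fr (sgB_sg _), mem_preimage]
        change fr (Equiv.swap i0 i) (sgB b) 0 _ ∈ _
        rw [hs]
        exact ⟨hyb, x, ha, hx⟩
      · have h0 : ∀ j, (0 : Vtx d) j = 0 := fun _ => rfl
        constructor
        · simp only [Equiv.symm_swap, Equiv.swap_apply_left, h0, sub_zero, hsy]
          have := hxj i
          rcases hyi with h | h <;> rw [h]
          · rw [abs_of_nonneg]; omega
          · rw [abs_neg, abs_of_nonneg]; omega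
        · intro j hj0
          simp only [h0, sub_zero, hsy]
          refine ⟨abs_nonneg _, ?_⟩
          have hne : (Equiv.swap i0 i).symm j ≠ i := by
            intro hc
            rw [Equiv.symm_swap] at hc
            apply hj0
            have := congrArg (Equiv.swap i0 i) hc
            rwa [Equiv.swap_apply_self, Equiv.swap_apply_right] at this
          rw [hj _ hne]
          exact abs_le.2 (hxj _)
    have hfin : ∀ π, ((φ π) '' (YY m k (fun x => ω (φ π x)) ∩ PS i0 k)).Finite := fun π =>
      ((YY_fin hmk _).inter_of_left _).image _
    calc (YY (m : ℤ) k ω).ncard ≤ (⋃ π ∈ (Finset.univ : Finset PI), (φ π) '' (YY m k (fun x => ω (φ π x)) ∩ PS i0 k)).ncard :=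
          Set.ncard_le_ncard hcov (Set.Finite.biUnion (Finset.finite_toSet _) fun π _ => hfin π)
      _ ≤ ∑ π ∈ (Finset.univ : Finset PI), ((φ π) '' (YY m k (fun x => ω (φ π x)) ∩ PS i0 k)).ncard :=
          Finset.set_ncard_biUnion_le _ _
      _ < ∑ π ∈ (Finset.univ : Finset PI), K := by
          refine Finset.sum_lt_sum_of_nonempty ⟨(i0, fun _ => true), Finset.mem_univ _⟩ fun π _ => ?_
          exact lt_of_le_of_lt (Set.ncard_image_le ((YY_fin hmk _).inter_of_left _)) (hω' π)
      _ = N * K := by simp [hN]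
  have h3 : ν (Few i0 (m : ℤ) k K) ^ N ≤ η ^ N := by
    refine le_trans (le_of_eq ?_) (hpr.trans ((measure_mono hsub).trans (h k hk)))
    rw [Finset.prod_congr rfl fun π _ => hAν π, Finset.prod_const, Finset.card_univ]
  exact (ENNReal.pow_le_pow_left_iff hN0).1 h3

end hits

section tiles
variable {d : ℕ}

def Tgt (i : Fin d) (sg : Fin d → ℤ) (s : Vtx d) (m k : ℤ) (z : Vtx d) : Prop :=
  sg i * (z i - s i) = k + 1 + m ∧ ∀ j ≠ i, m ≤ sg j * (z j - s j) ∧ sg j * (z j - s j) ≤ k + m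

def Reg (i : Fin d) (sg : Fin d → ℤ) (s : Vtx d) (m k : ℤ) : Set (Vtx d) :=
  {x | x ∈ box k s ∨ (k + 1 ≤ sg i * (x i - s i) ∧ sg i * (x i - s i) ≤ k + 2 * m + 1 ∧
    ∀ j ≠ i, 0 ≤ sg j * (x j - s j) ∧ sg j * (x j - s j) ≤ k + 2 * m)}

def Good (i : Fin d) (sg : Fin d → ℤ) (s : Vtx d) (m k : ℤ) : Set (Config d) :=
  {ω | ∃ z, Tgt i sg s m k z ∧ box m z ⊆ opn ω ∧ ∀ x ∈ box m z, Rc (opn ω ∩ Reg i sg s m k) (box m s) x}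

lemma Reg_sub (i : Fin d) {sg : Fin d → ℤ} (hs : IsSg sg) (s : Vtx d) {m k : ℤ} (hm : 0 ≤ m) (hk : 0 ≤ k) :
    Reg i sg s m k ⊆ box (k + 2 * m + 1) s := by
  rintro x (h | ⟨h1, h2, h3⟩)
  · exact box_mono (by omega) _ h
  · intro j
    by_cases hj : j = i
    · subst hj
      rcases hs j with h | h <;> rw [h] at h1 h2 <;> constructor <;> omega
    · have := h3 j hj
      rcases hs j with h | h <;> rw [h] at this <;> constructor <;> omega

lemma Good_dep (i : Fin d) {sg : Fin d → ℤ} (hs : IsSg sg) (s : Vtx d) {m k : ℤ} (hm : 0 ≤ m) (hk : 0 ≤ k) :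
    Dep (Good i sg s m k) (box (k + 2 * m + 1) s) := by
  refine dep_of ?_
  rintro ω ω' hh ⟨z, hz, ho, hR⟩
  refine ⟨z, hz, fun x hx => ?_, fun x hx => Rc_local (fun y hy => ?_) (hR x hx)⟩
  · have hxb : x ∈ box (k + 2 * m + 1) s := by
      intro j
      have := hx j
      by_cases hj : j = i
      · subst hj
        have h1 := hz.1
        rcases hs j with h | h <;> rw [h] at h1 <;> constructor <;> omega
      · have h1 := hz.2 j hj
        rcases hs j with h | h <;> rw [h] at h1 <;> constructor <;> omega
    exact (hh x hxb).symm.trans (ho hx)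
  · change ω y = true ↔ ω' y = true
    rw [hh y (Reg_sub i hs s hm hk hy)]

lemma Good_meas (i : Fin d) {sg : Fin d → ℤ} (hs : IsSg sg) (s : Vtx d) {m k : ℤ} (hm : 0 ≤ m) (hk : 0 ≤ k) :
    MeasurableSet (Good i sg s m k) := (Good_dep i hs s hm hk).meas (box_finite _ _)

variable (i0 : Fin d)

open Classical in
noncomputable def tl (m k : ℤ) (y : Vtx d) : Vtx d :=
  fun j => if j = i0 then k + 1 + m else (2 * m + 1) * (y j / (2 * m + 1)) + m

lemma mem_tl {m k : ℤ} (hm : 0 ≤ m) {y : Vtx d} (hy : y ∈ PS i0 k) : y ∈ box m (tl i0 m k y) := by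
  intro j
  unfold tl
  by_cases hj : j = i0
  · subst hj; rw [if_pos rfl, hy.1]; constructor <;> omega
  · rw [if_neg hj]
    have h1 := Int.emod_add_mul_ediv (y j) (2 * m + 1)
    have h2 := Int.emod_nonneg (y j) (by omega : 2 * m + 1 ≠ 0)
    have h3 := Int.emod_lt_of_pos (y j) (by omega : 0 < 2 * m + 1)
    constructor <;> linarith

lemma tl_of_mem {m k : ℤ} (hm : 0 ≤ m) {y x : Vtx d} (hx : x ∈ box m (tl i0 m k y)) :
    tl i0 m k x = tl i0 m k y := by
  funext j
  have := hx j
  unfold tl at this ⊢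
  by_cases hj : j = i0
  · rw [if_pos hj, if_pos hj]
  · rw [if_neg hj] at this
    rw [if_neg hj, if_neg hj]
    congr 2
    rw [Int.ediv_eq_iff_of_pos (by omega)]
    constructor <;> linarith

lemma box_ncard (m : ℤ) (z : Vtx d) : (box m z).ncard = (box m (0 : Vtx d)).ncard := by
  have : box m z = (fun x => x + z) '' box m 0 := by
    ext x
    constructor
    · intro hx
      refine ⟨x - z, fun j => ?_, by simp⟩
      have := hx j
      have h0 : (0 : Vtx d) j = 0 := rfl
      rw [h0, Pi.sub_apply]
      omega
    · rintro ⟨y, hy, rfl⟩ j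
      have := hy j
      have h0 : (0 : Vtx d) j = 0 := rfl
      rw [h0] at this
      simp only [Pi.add_apply]
      omega
  rw [this, Set.ncard_image_of_injective _ (add_left_injective z)]

variable (ρ : Measure Bool) [IsProbabilityMeasure ρ]

lemma nofull (m : ℤ) (hm : 0 ≤ m) (Z : Finset (Vtx d)) (hZ : ∀ z ∈ Z, ∀ z' ∈ Z, z ≠ z' → Disjoint (box m z) (box m z')) :
    (Measure.infinitePi fun _ : Vtx d => ρ) {ω | ∀ z ∈ Z, ¬ box m z ⊆ opn ω} =
      (1 - ρ {true} ^ (box m (0 : Vtx d)).ncard) ^ Z.card := by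
  classical
  have hdep1 : ∀ z, Dep {ω : Config d | ¬ box m z ⊆ opn ω} (box m z) := by
    intro z
    refine Dep.compl (A := {ω : Config d | box m z ⊆ opn ω}) (dep_of fun ω ω' hh h x hx => ?_)
    exact (hh x hx).symm.trans (h hx)
  have hm1 : ∀ z, MeasurableSet {ω : Config d | ¬ box m z ⊆ opn ω} := fun z => (hdep1 z).meas (box_finite _ _)
  have hone : ∀ z : Vtx d, (Measure.infinitePi fun _ : Vtx d => ρ) {ω | ¬ box m z ⊆ opn ω} =
      1 - ρ {true} ^ (box m (0 : Vtx d)).ncard := by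
    intro z
    have h1 : {ω : Config d | ¬ box m z ⊆ opn ω} = (Set.pi (box_finite m z).toFinset fun _ => {true})ᶜ := by
      ext ω
      refine not_congr ?_
      rw [Set.Finite.coe_toFinset]
      rfl
    rw [h1, prob_compl_eq_one_sub (MeasurableSet.pi (Finset.countable_toSet _) fun _ _ => measurableSet_singleton _),
      Measure.infinitePi_pi _ fun _ _ => measurableSet_singleton _, Finset.prod_const,
      ← Set.ncard_eq_toFinset_card (box m z) (box_finite m z), box_ncard]
  induction Z using Finset.induction_on with
  | empty => simp
  | insert z Z hz ih =>
    have h1 : {ω : Config d | ∀ z' ∈ insert z Z, ¬ box m z' ⊆ opn ω} =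
        {ω | ¬ box m z ⊆ opn ω} ∩ {ω | ∀ z ∈ Z, ¬ box m z ⊆ opn ω} := by
      ext ω
      exact Finset.forall_mem_insert _ _ _
    have hd2 : Dep {ω : Config d | ∀ z ∈ Z, ¬ box m z ⊆ opn ω} (⋃ z ∈ Z, box m z) := by
      intro ω ω' hh
      exact forall_congr' fun z => forall_congr' fun hz => hdep1 z ω ω' fun i hi => hh i (mem_biUnion hz hi)
    have hfin : (⋃ z ∈ Z, box m z).Finite := Set.Finite.biUnion (Finset.finite_toSet _) fun _ _ => box_finite _ _
    rw [h1, indep_of_dep _ (hm1 z) (hd2.meas hfin) (hdep1 z) hd2, hone, ih, Finset.card_insert_of_notMem hz, pow_succ, mul_comm]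
    · exact fun a ha b hb => hZ a (Finset.mem_insert_of_mem ha) b (Finset.mem_insert_of_mem hb)
    · rw [Set.disjoint_iUnion₂_right]
      exact fun z' hz' => hZ z (Finset.mem_insert_self _ _) z' (Finset.mem_insert_of_mem hz') (fun h => hz (h ▸ hz'))

lemma hits3 (hp : 0 < (Measure.infinitePi fun _ : Vtx d => ρ) {ω | PercolatesAt ω (fun _ => 0)})
    (hf : ρ {false} ≠ 0) (ht : ρ {true} ≠ 0) (β : ENNReal) (hβ : β ≠ 0) :
    ∃ m : ℕ, ∃ r : ℤ, m ≤ r ∧ ∀ k : ℤ, r ≤ k →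
      (Measure.infinitePi fun _ : Vtx d => ρ) (Good i0 (fun _ => 1) 0 m k)ᶜ ≤ β := by
  classical
  set ν := (Measure.infinitePi fun _ : Vtx d => ρ) with hν
  have hβ2 : β / 2 ≠ 0 := by simpa using hβ
  obtain ⟨m, hm⟩ := hits2 i0 ρ hp hf (β / 2) hβ2
  set M := (box (m : ℤ) (0 : Vtx d)).ncard
  have hlt : 1 - ρ {true} ^ M < 1 := ENNReal.sub_lt_self ENNReal.one_ne_top one_ne_zero (pow_ne_zero _ ht)
  obtain ⟨L, hL⟩ := ((ENNReal.tendsto_pow_atTop_nhds_zero_of_lt_one hlt).eventually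
    (ge_mem_nhds (pos_iff_ne_zero.2 hβ2))).exists
  obtain ⟨r, hr, h⟩ := hm (M * L + 1) (by omega)
  refine ⟨m, r, hr, fun k hk => ?_⟩
  have hmk : (m : ℤ) ≤ k := by omega
  have hm0 : (0 : ℤ) ≤ m := by omega
  have hfin : ∀ ω : Config d, (YY (m : ℤ) k ω ∩ PS i0 k).Finite := fun ω => (YY_fin hmk _).inter_of_left _
  set Z : Config d → Finset (Vtx d) := fun ω => (hfin ω).toFinset.image (tl i0 m k) with hZ
  have hZd : ∀ v, Dep {ω | Z ω = v} (box k 0) := by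
    intro v ω ω' hh
    have : Z ω = Z ω' := by simp only [hZ]; congr 1; simp [YY_loc (m := m) hh]
    change Z ω = v ↔ Z ω' = v
    rw [this]
  have hcard : ∀ ω, ω ∉ Few i0 (m : ℤ) k (M * L + 1) → L ≤ (Z ω).card := by
    intro ω hω
    have h1 : M * L + 1 ≤ (YY (m : ℤ) k ω ∩ PS i0 k).ncard := not_lt.1 hω
    rw [Set.ncard_eq_toFinset_card _ (hfin ω)] at h1
    have hle := Finset.card_le_mul_card_image (f := tl i0 (m : ℤ) k) (hfin ω).toFinset M (by
      intro z hz
      obtain ⟨y, hy, rfl⟩ := Finset.mem_image.1 hz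
      rw [show M = (box (m : ℤ) (tl i0 m k y)).ncard from (box_ncard _ _).symm,
        Set.ncard_eq_toFinset_card _ (box_finite _ _)]
      refine Finset.card_le_card fun x hx => ?_
      rw [Finset.mem_filter, Set.Finite.mem_toFinset] at hx
      rw [Set.Finite.mem_toFinset, ← hx.2]
      exact mem_tl i0 hm0 hx.1.2)
    by_contra hc
    have h3 : M * (Z ω).card ≤ M * L := Nat.mul_le_mul_left _ (by omega)
    exact absurd (h1.trans (le_trans hle h3)) (by omega)
  set B : Set (Config d) := {ω | L ≤ (Z ω).card ∧ ∀ z ∈ Z ω, ¬ box (m : ℤ) z ⊆ opn ω}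
  have hsub : (Good i0 (fun _ => 1) 0 (m : ℤ) k)ᶜ ⊆ Few i0 (m : ℤ) k (M * L + 1) ∪ B := by
    intro ω hω
    by_cases hF : ω ∈ Few i0 (m : ℤ) k (M * L + 1)
    · exact .inl hF
    refine .inr ⟨hcard ω hF, fun z hz hfull => hω ?_⟩
    obtain ⟨y, hy, rfl⟩ := Finset.mem_image.1 hz
    rw [Set.Finite.mem_toFinset] at hy
    obtain ⟨⟨hyb, x, ha, hx⟩, hyP⟩ := hy
    have h0 : ∀ j, (0 : Vtx d) j = 0 := fun _ => rfl
    have hT : ∀ j ≠ i0, (m : ℤ) ≤ tl i0 m k y j ∧ tl i0 m k y j ≤ k + m := by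
      intro j hj
      have hyj := hyP.2 j hj
      unfold tl
      rw [if_neg hj]
      have h1 := Int.emod_add_mul_ediv (y j) (2 * m + 1)
      have h2 := Int.emod_nonneg (y j) (by omega : 2 * (m : ℤ) + 1 ≠ 0)
      have h3 : 0 ≤ y j / (2 * m + 1) := Int.ediv_nonneg hyj.1 (by omega)
      constructor
      · have : 0 ≤ (2 * (m : ℤ) + 1) * (y j / (2 * m + 1)) := by positivity
        omega
      · linarith
    have hT0 : tl i0 m k y i0 = k + 1 + m := by unfold tl; rw [if_pos rfl]
    have hbR : box (m : ℤ) (tl i0 m k y) ⊆ Reg i0 (fun _ => 1) 0 m k := by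
      intro u hu
      right
      refine ⟨?_, ?_, fun j hj => ?_⟩
      · have := hu i0; rw [hT0] at this; rw [h0, sub_zero, one_mul]; omega
      · have := hu i0; rw [hT0] at this; rw [h0, sub_zero, one_mul]; omega
      · have := hu j; have := hT j hj; rw [h0, sub_zero, one_mul]; constructor <;> omega
    refine ⟨tl i0 m k y, ⟨?_, fun j hj => ?_⟩, hfull, fun u hu => ?_⟩
    · rw [hT0, h0]; ring
    · rw [h0, sub_zero, one_mul]; exact hT j hj
    · have hym := mem_tl i0 hm0 hyP
      have hy : Rc (opn ω ∩ Reg i0 (fun _ => 1) 0 m k) (box m 0) y :=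
        .step (hx.mono (inter_subset_inter_right _ fun _ h => .inl h) subset_rfl) ha ⟨hfull hym, hbR hym⟩
      exact Rc.trans (c := {y}) (fun v hv => by rw [mem_singleton_iff.1 hv]; exact hy)
        ((box_conn' hym hu).mono (O' := opn ω ∩ Reg i0 (fun _ => 1) 0 m k) (fun v hv => ⟨hfull hv, hbR hv⟩) subset_rfl)
  have hB : ν B ≤ β / 2 := by
    refine le_trans (sum_cond ν Z (fun v => (hZd v).meas (box_finite _ _)) ((1 - ρ {true} ^ M) ^ L) fun v => ?_) hL
    rcases ({ω | Z ω = v} ∩ B).eq_empty_or_nonempty with he | ⟨ω, hω1, hω2⟩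
    · rw [he]; simp
    have hω1' : Z ω = v := hω1
    have hvL : L ≤ v.card := hω1' ▸ hω2.1
    have hvt : ∀ z ∈ v, ∃ y, z = tl i0 m k y := by
      intro z hz
      rw [← hω1'] at hz
      obtain ⟨y, hy, rfl⟩ := Finset.mem_image.1 hz
      exact ⟨y, rfl⟩
    have hd2 : Dep {ω : Config d | ∀ z ∈ v, ¬ box (m : ℤ) z ⊆ opn ω} (⋃ z ∈ v, box (m : ℤ) z) := by
      refine dep_of fun ω ω' hh h z hz hs => h z hz fun x hx => ?_
      exact (hh x (mem_biUnion hz hx)).trans (hs hx)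
    calc ν ({ω | Z ω = v} ∩ B) ≤ ν ({ω | Z ω = v} ∩ {ω | ∀ z ∈ v, ¬ box (m : ℤ) z ⊆ opn ω}) := by
          refine measure_mono fun ω h => ⟨h.1, ?_⟩
          have h1 : Z ω = v := h.1
          rw [← h1]; exact h.2.2
      _ = ν {ω | Z ω = v} * ν {ω | ∀ z ∈ v, ¬ box (m : ℤ) z ⊆ opn ω} := by
          refine indep_of_dep _ ((hZd v).meas (box_finite _ _)) (hd2.meas
            (Set.Finite.biUnion (Finset.finite_toSet _) fun _ _ => box_finite _ _)) (hZd v) hd2 ?_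
          rw [Set.disjoint_iUnion₂_right]
          intro z hz
          obtain ⟨y, rfl⟩ := hvt z hz
          refine Set.disjoint_left.2 fun x h1 h2 => ?_
          have h3 := h1 i0
          have h4 := h2 i0
          have h5 : tl i0 (m : ℤ) k y i0 = k + 1 + m := by unfold tl; rw [if_pos rfl]
          have h0 : (0 : Vtx d) i0 = 0 := rfl
          rw [h0] at h3
          rw [h5] at h4
          omega
      _ ≤ ν {ω | Z ω = v} * (1 - ρ {true} ^ M) ^ L := by
          gcongr
          rw [nofull ρ m hm0 v]
          · exact pow_le_pow_right_of_le_one' hlt.le hvL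
          · intro z hz z' hz' hne
            obtain ⟨y, rfl⟩ := hvt z hz
            obtain ⟨y', rfl⟩ := hvt z' hz'
            refine Set.disjoint_left.2 fun x h1 h2 => hne ?_
            rw [← tl_of_mem i0 hm0 h1, ← tl_of_mem i0 hm0 h2]
      _ = _ := mul_comm _ _
  calc ν _ ≤ ν (Few i0 (m : ℤ) k (M * L + 1) ∪ B) := measure_mono hsub
    _ ≤ _ := measure_union_le _ _
    _ ≤ β / 2 + β / 2 := add_le_add (h k hk) hB
    _ = β := ENNReal.add_halves _

/-- the main input : hits in every frame -/
lemma hits (i0 : Fin d) (hp : 0 < (Measure.infinitePi fun _ : Vtx d => ρ) {ω | PercolatesAt ω (fun _ => 0)})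
    (hf : ρ {false} ≠ 0) (ht : ρ {true} ≠ 0) (β : ENNReal) (hβ : β ≠ 0) :
    ∃ m r : ℤ, 0 ≤ m ∧ m ≤ r ∧ ∀ k : ℤ, r ≤ k → ∀ i sg s, IsSg sg →
      (Measure.infinitePi fun _ : Vtx d => ρ) (Good i sg s m k)ᶜ ≤ β := by
  obtain ⟨m, r, hr, h⟩ := hits3 i0 ρ hp hf ht β hβ
  refine ⟨m, r, by omega, hr, fun k hk i sg s hs => ?_⟩
  have h1 : IsSg (fun _ : Fin d => (1 : ℤ)) := fun _ => .inl rfl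
  have hG := Good_meas i0 h1 0 (m := m) (k := k) (by omega) (by omega)
  refine le_trans ?_ (h k hk)
  rw [← fr_pres ρ (e := Equiv.swap i0 i) hs s hG.compl]
  refine measure_mono fun ω hω hg => hω ?_
  obtain ⟨z, hz, ho, hR⟩ := hg
  set φ := fr (Equiv.swap i0 i) sg s with hφ
  have h0 : ∀ j, (0 : Vtx d) j = 0 := fun _ => rfl
  have hco : ∀ x j, sg j * (φ x j - s j) = x (Equiv.swap i0 i j) := by
    intro x j
    simp only [hφ, fr]
    calc _ = (sg j * sg j) * x (Equiv.swap i0 i j) := by ring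
      _ = _ := by rw [hs.mul, one_mul]
  have hne : ∀ j ≠ i, Equiv.swap i0 i j ≠ i0 := by
    intro j hj hc
    apply hj
    have := congrArg (Equiv.swap i0 i) hc
    rwa [Equiv.swap_apply_self, Equiv.swap_apply_left] at this
  have hReg : φ ⁻¹' (Reg i sg s m k) = Reg i0 (fun _ => 1) 0 m k := by
    ext x
    refine or_congr ?_ ?_
    · rw [← mem_preimage, fr_box0 hs]
    · rw [hco, Equiv.swap_apply_right, h0, sub_zero, one_mul]
      refine and_congr Iff.rfl (and_congr Iff.rfl ⟨fun h j hj => ?_, fun h j hj => ?_⟩)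
      · have h2 : Equiv.swap i0 i j ≠ i := fun hc => hj (by
          have := congrArg (Equiv.swap i0 i) hc
          rwa [Equiv.swap_apply_self, Equiv.swap_apply_right] at this)
        have := h _ h2
        rw [hco, Equiv.swap_apply_self] at this
        rw [h0, sub_zero, one_mul]; exact this
      · have := h _ (hne j hj)
        rw [hco]
        rwa [h0, sub_zero, one_mul] at this
  refine ⟨φ z, ⟨?_, fun j hj => ?_⟩, fun x hx => ?_, fun x hx => ?_⟩
  · rw [hco, Equiv.swap_apply_right]
    have := hz.1
    rwa [h0, sub_zero, one_mul] at this
  · rw [hco]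
    have := hz.2 _ (hne j hj)
    rwa [h0, sub_zero, one_mul] at this
  · obtain ⟨x, rfl⟩ := fr_surj' (e := Equiv.swap i0 i) hs s x
    exact ho ((fr_box hs s z x m).1 hx)
  · obtain ⟨x, rfl⟩ := fr_surj' (e := Equiv.swap i0 i) hs s x
    rw [← fr_Rc hs s, preimage_inter, hReg, fr_box0 hs]
    exact hR x ((fr_box hs s z x m).1 hx)

end tiles

section step
variable {d : ℕ} {J : Type}

def lay (a : Option J) (ω : Vtx d × Option J → Bool) : Config d := fun x => ω (x, a)

def Gd (Z : Set (Set (Vtx d))) (B G : Set (Vtx d)) (o : Set (Vtx d)) : Prop :=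
  ∃ z ∈ Z, z ⊆ o ∧ ∀ x ∈ z, Rc (o ∩ G) B x

def OutS (G X : Set (Vtx d)) (ω : Vtx d × Option J → Bool) : Set (Vtx d) :=
  {x | x ∈ G ∧ x ∉ X ∧ ω (x, none) = true}

def OpS (G X : Set (Vtx d)) (j : J) (ω : Vtx d × Option J → Bool) : Set (Vtx d) :=
  {x | x ∈ G ∧ (x ∉ X ∧ ω (x, none) = true ∨ x ∈ X ∧ ω (x, some j) = true)}

lemma OutS_sub (G X : Set (Vtx d)) (j : J) (ω : Vtx d × Option J → Bool) : OutS G X ω ⊆ OpS G X j ω :=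
  fun x hx => ⟨hx.1, .inl hx.2⟩

lemma OutS_congr {G X : Set (Vtx d)} {ω ω' : Vtx d × Option J → Bool}
    (h : ∀ x ∈ G, x ∉ X → ω (x, none) = ω' (x, none)) : OutS G X ω = OutS G X ω' := by
  ext x
  constructor
  · rintro ⟨h1, h2, h3⟩; exact ⟨h1, h2, (h x h1 h2).symm.trans h3⟩
  · rintro ⟨h1, h2, h3⟩; exact ⟨h1, h2, (h x h1 h2).trans h3⟩

open Classical in
noncomputable def VZ (Z : Set (Set (Vtx d))) (G : Finset (Vtx d)) (X : Set (Vtx d))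
    (ω : Vtx d × Option J → Bool) : Finset (Vtx d) :=
  G.filter fun x => x ∈ X ∧ ∃ z ∈ Z, ∀ y ∈ z, Rc (OutS G X ω) {x} y

lemma step (ρ : Vtx d × Option J → Measure Bool) [∀ i, IsProbabilityMeasure (ρ i)]
    (ρ0 ρ1 : Measure Bool) (h0 : ∀ x, ρ (x, none) = ρ0) (h1 : ∀ x j, ρ (x, some j) = ρ1)
    [Countable J]
    (c G : Finset (Vtx d)) (B X : Set (Vtx d)) (Z : Set (Set (Vtx d))) (j : J) (n t : ℕ) (ε β : ENNReal)
    (hBc : B ⊆ c) (hX : ∀ x ∈ X, x ∈ G → x ∉ c → x ∈ bdy c)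
    (hZG : ∀ z ∈ Z, z ⊆ G) (hZX : ∀ z ∈ Z, ∀ x ∈ z, x ∉ X)
    (hZc : ∀ z ∈ Z, ∃ z0 ∈ z, ∀ x ∈ z, Rc z {z0} x)
    (hn : G.card ≤ n) (hb0 : ρ0 {false} ≠ 0) (hb1 : ρ0 {false} ≤ 1)
    (hβ : β ≤ ε / 2 * ρ0 {false} ^ t) (hδ : ρ1 {false} ^ t ≤ ε / 2)
    (hG : Measure.infinitePi ρ {ω | ¬ Gd Z B G (opn (lay none ω))} ≤ β) :
    Measure.infinitePi ρ {ω | ¬ ∃ z ∈ Z, z ⊆ ((grow (OpS G X j ω))^[n] c : Finset (Vtx d))} ≤ ε := by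
  classical
  set μ := Measure.infinitePi ρ with hμ
  set V := VZ (J := J) Z G X with hV
  set dir : Set (Vtx d × Option J → Bool) := {ω | ∃ z ∈ Z, ∀ y ∈ z, Rc (OutS G X ω) c y} with hdir
  have hVX : ∀ ω, ∀ x ∈ V ω, x ∈ G ∧ x ∈ X ∧ ∃ z ∈ Z, ∀ y ∈ z, Rc (OutS G X ω) {x} y :=
    fun ω x hx => ⟨(Finset.mem_filter.1 hx).1, (Finset.mem_filter.1 hx).2⟩
  set S : Set (Vtx d × Option J) := {i | i.1 ∈ G ∧ i.1 ∉ X ∧ i.2 = none} with hS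
  have hSf : S.Finite := by
    refine ((Finset.finite_toSet G).image fun x => ((x, none) : Vtx d × Option J)).subset ?_
    rintro ⟨x, a⟩ ⟨h, -, rfl⟩
    exact ⟨x, h, rfl⟩
  have hOut : ∀ ω ω' : Vtx d × Option J → Bool, (∀ i ∈ S, ω i = ω' i) → OutS G X ω = OutS (G : Set (Vtx d)) X ω' :=
    fun ω ω' hh => OutS_congr fun x hx hx' => hh _ ⟨hx, hx', rfl⟩
  have hVd : ∀ ω ω', (∀ i ∈ S, ω i = ω' i) → V ω = V ω' := by
    intro ω ω' hh
    simp only [hV, VZ]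
    rw [hOut ω ω' hh]
  have hVdep : ∀ v, Dep {ω | V ω = v} S := by
    intro v ω ω' hh
    change V ω = v ↔ V ω' = v
    rw [hVd ω ω' hh]
  set A : Set (Vtx d × Option J → Bool) := {ω | (V ω).card ≤ t ∧ ω ∉ dir} with hA
  have hAd : ∀ v, Dep (A ∩ {ω | V ω = v}) S := by
    intro v ω ω' hh
    change ((V ω).card ≤ t ∧ ¬ ∃ z ∈ Z, ∀ y ∈ z, Rc (OutS G X ω) c y) ∧ V ω = v ↔
      ((V ω').card ≤ t ∧ ¬ ∃ z ∈ Z, ∀ y ∈ z, Rc (OutS G X ω') c y) ∧ V ω' = v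
    rw [hVd ω ω' hh, hOut ω ω' hh]
  have hAle : μ A ≤ ε / 2 := by
    have hcl := closing ρ (A := A) (B := {ω | ¬ Gd Z B G (opn (lay none ω))}) false (ρ0 {false})
      (fun ω => (V ω).image fun x => (x, none)) t hb1
      (by
        rintro v ⟨ω, -, hω⟩ i hi
        have hω' : (V ω).image (fun x => ((x, none) : Vtx d × Option J)) = v := hω
        rw [← hω'] at hi
        obtain ⟨x, -, rfl⟩ := Finset.mem_image.1 hi
        rw [h0])
      (by
        intro v
        by_cases hv : ∃ w : Finset (Vtx d), w.image (fun x => ((x, none) : Vtx d × Option J)) = v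
        · obtain ⟨w, rfl⟩ := hv
          have : {ω | (V ω).image (fun x => ((x, none) : Vtx d × Option J)) = w.image fun x => (x, none)} = {ω | V ω = w} := by
            ext ω
            exact (Finset.image_injective (fun a b h => (Prod.mk.inj h).1)).eq_iff
          rw [this]
          exact (hAd w).meas hSf
        · convert MeasurableSet.empty
          ext ω
          simp only [mem_empty_iff_false, iff_false]
          exact fun h => hv ⟨V ω, h.2⟩)
      (by
        intro v
        refine dep_of fun ω ω' hh hω => ?_
        have hω2 : (V ω).image (fun x => ((x, none) : Vtx d × Option J)) = v := hω.2
        have hag : ∀ i ∈ S, ω i = ω' i := by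
          rintro i hi
          refine hh i fun hiv => ?_
          rw [← hω2] at hiv
          obtain ⟨x, hx, rfl⟩ := Finset.mem_image.1 hiv
          exact hi.2.1 (hVX ω x hx).2.1
        have := ((hAd (V ω)) ω ω' hag).1 ⟨hω.1, rfl⟩
        refine ⟨this.1, ?_⟩
        have h2 : V ω' = V ω := this.2
        change (V ω').image (fun x => ((x, none) : Vtx d × Option J)) = v
        rw [h2, hω2])
      (fun ω hω => le_trans Finset.card_image_le hω.1)
      (by
        rintro ω hω hcl ⟨z, hz, hzo, hzR⟩
        have key : ∀ y, Rc (opn (lay none ω) ∩ G) B y → Rc (OutS G X ω) c y ∨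
            ∃ x ∈ G, x ∈ X ∧ ω (x, none) = true ∧ Rc (OutS G X ω) {x} y := by
          intro y hy
          induction hy with
          | base h => exact .inl (.base (hBc h))
          | @step x y h ha hy ih =>
            by_cases hyX : y ∈ X
            · exact .inr ⟨y, hy.2, hyX, hy.1, .base rfl⟩
            · have hyo : y ∈ OutS G X ω := ⟨hy.2, hyX, hy.1⟩
              rcases ih with h | ⟨w, h1, h2, h3, h4⟩
              · exact .inl (.step h ha hyo)
              · exact .inr ⟨w, h1, h2, h3, .step h4 ha hyo⟩
        obtain ⟨z0, hz0, hzc⟩ := hZc z hz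
        have hzOut : z ⊆ OutS G X ω := fun x hx => ⟨hZG z hz hx, hZX z hz x hx, hzo hx⟩
        have hext : ∀ c' : Set (Vtx d), Rc (OutS G X ω) c' z0 → ∀ x ∈ z, Rc (OutS G X ω) c' x := by
          intro c' h x hx
          exact Rc.trans (c := {z0}) (fun v hv => by rw [mem_singleton_iff.1 hv]; exact h)
            ((hzc x hx).mono hzOut subset_rfl)
        rcases key z0 (hzR z0 hz0) with h | ⟨x, hx1, hx2, hx3, hx4⟩
        · exact hω.2 ⟨z, hz, hext _ h⟩
        · have hxV : x ∈ V ω := Finset.mem_filter.2 ⟨hx1, hx2, z, hz, hext _ hx4⟩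
          have := hcl (x, none) (Finset.mem_image_of_mem _ hxV)
          rw [hx3] at this
          exact absurd this (by simp))
    have h2 : μ A * ρ0 {false} ^ t ≤ ε / 2 * ρ0 {false} ^ t := hcl.trans (hG.trans hβ)
    have hne : ρ0 {false} ^ t ≠ 0 := pow_ne_zero _ hb0
    have hnt : ρ0 {false} ^ t ≠ ⊤ := ENNReal.pow_ne_top (ne_top_of_le_ne_top ENNReal.one_ne_top hb1)
    exact (ENNReal.mul_le_mul_iff_left hne hnt).1 h2
  set A2 : Set (Vtx d × Option J → Bool) := {ω | t ≤ (V ω).card ∧ ∀ x ∈ V ω, ω (x, some j) = false} with hA2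
  have hA2le : μ A2 ≤ ε / 2 := by
    refine le_trans (sum_cond μ V (fun v => (hVdep v).meas hSf) (ρ1 {false} ^ t) fun v => ?_) hδ
    rcases ({ω | V ω = v} ∩ A2).eq_empty_or_nonempty with he | ⟨ω, hω1, hω2⟩
    · rw [he]; simp
    have hvt : t ≤ v.card := by
      have hω1' : V ω = v := hω1
      rw [← hω1']; exact hω2.1
    set K : Finset (Vtx d × Option J) := v.image fun x => (x, some j)
    have hKm : MeasurableSet (Set.pi (K : Set (Vtx d × Option J)) fun _ => ({false} : Set Bool)) :=
      MeasurableSet.pi K.countable_toSet fun _ _ => measurableSet_singleton _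
    calc μ ({ω | V ω = v} ∩ A2) ≤ μ ({ω | V ω = v} ∩ Set.pi (K : Set (Vtx d × Option J)) fun _ => ({false} : Set Bool)) := by
          refine measure_mono fun ω h => ⟨h.1, fun i hi => ?_⟩
          obtain ⟨x, hx, rfl⟩ := Finset.mem_image.1 (Finset.mem_coe.1 hi)
          have h1 : V ω = v := h.1
          exact h.2.2 x (h1 ▸ hx)
      _ = μ {ω | V ω = v} * μ (Set.pi (K : Set (Vtx d × Option J)) fun _ => ({false} : Set Bool)) := by
          refine indep_of_dep ρ ((hVdep v).meas hSf) hKm (hVdep v) (T := K) ?_ ?_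
          · refine dep_of fun ω ω' h h' i hi => ?_
            have := h' i hi
            rwa [h i hi] at this
          · refine Set.disjoint_left.2 fun i h1 h2 => ?_
            obtain ⟨x, hx, rfl⟩ := Finset.mem_image.1 (Finset.mem_coe.1 h2)
            exact absurd h1.2.2 (by simp)
      _ = μ {ω | V ω = v} * ρ1 {false} ^ v.card := by
          congr 1
          rw [hμ, Measure.infinitePi_pi _ fun _ _ => measurableSet_singleton _,
            Finset.prod_image (fun a _ b _ h => (Prod.mk.inj h).1)]
          simp [h1]
      _ ≤ μ {ω | V ω = v} * ρ1 {false} ^ t := by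
          rcases v.eq_empty_or_nonempty with rfl | ⟨x, hx⟩
          · obtain rfl : t = 0 := by simpa using hvt
            rfl
          have : ρ1 {false} ≤ 1 := by rw [← h1 x j]; exact prob_le_one
          refine mul_le_mul' le_rfl ?_
          exact pow_le_pow_right_of_le_one' this hvt
      _ = _ := mul_comm _ _
  have hsub : {ω | ¬ ∃ z ∈ Z, z ⊆ ((grow (OpS G X j ω))^[n] c : Finset (Vtx d))} ⊆ A ∪ A2 := by
    intro ω hω
    have hOG : OpS (G : Set (Vtx d)) X j ω ⊆ G := fun x hx => hx.1
    have hnd : ω ∉ dir := by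
      rintro ⟨z, hz, h⟩
      exact hω ⟨z, hz, fun x hx => Rc_grow hOG hn ((h x hx).mono (OutS_sub _ _ _ _) subset_rfl)⟩
    by_cases ht : (V ω).card ≤ t
    · exact .inl ⟨ht, hnd⟩
    refine .inr ⟨by omega, fun x hx => ?_⟩
    by_contra hc
    have hc' : ω (x, some j) = true := by simpa using hc
    obtain ⟨hxG, hxX, z, hz, h⟩ := hVX ω x hx
    refine hω ⟨z, hz, fun y hy => Rc_grow hOG hn ?_⟩
    refine Rc.trans (c := {x}) (fun v hv => ?_) ((h y hy).mono (OutS_sub _ _ _ _) subset_rfl)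
    rw [mem_singleton_iff.1 hv]
    by_cases hxc : x ∈ c
    · exact .base hxc
    · obtain ⟨w, hw, ha⟩ := mem_bdy.1 (hX x hxX hxG hxc)
      exact .step (.base hw) ha ⟨hxG, .inr ⟨hxX, hc'⟩⟩
  calc μ _ ≤ μ (A ∪ A2) := measure_mono hsub
    _ ≤ _ := measure_union_le _ _
    _ ≤ ε / 2 + ε / 2 := add_le_add hAle hA2le
    _ = ε := ENNReal.add_halves _

end step

section chain
variable {d : ℕ} {J : Type}

def Win (good : Set (Set (Vtx d)) → Set (Vtx d) → Finset (Vtx d) → Prop) (T : Finset (Vtx d)) (P : Finset (Vtx d) → Prop) :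
    ℕ → Finset (Vtx d) → Set (Vtx d) → Prop
  | 0, c, _ => P c
  | n + 1, c, D => P c ∨ ∃ (B : Set (Vtx d)) (G : Finset (Vtx d)) (Z : Set (Set (Vtx d))),
      B ⊆ c ∧ G ⊆ T ∧ (∀ z ∈ Z, z ⊆ G) ∧ (∀ z ∈ Z, ∀ x ∈ z, x ∉ D) ∧
      (∀ z ∈ Z, ∃ z0 ∈ z, ∀ x ∈ z, Rc z {z0} x) ∧ good Z B G ∧
      ∀ c', c ⊆ c' → (∃ z ∈ Z, z ⊆ c') → Win good T P n c' (D ∪ G)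

def UT (ly : ℕ → J) (T : Finset (Vtx d)) (n : ℕ) (c : Finset (Vtx d)) (D : Set (Vtx d)) : Set (Vtx d × Option J) :=
  {i | i.1 ∈ T ∧ (i.2 = none ∧ ¬ (i.1 ∈ D ∧ (i.1 ∈ c ∨ i.1 ∈ bdy c)) ∨ ∃ k < n, i.2 = some (ly k))}

def OT (ly : ℕ → J) (T : Finset (Vtx d)) (n : ℕ) (ω : Vtx d × Option J → Bool) : Set (Vtx d) :=
  {x | x ∈ T ∧ (ω (x, none) = true ∨ ∃ k < n, ω (x, some (ly k)) = true)}

lemma bdy_mono {c c' : Finset (Vtx d)} (h : c ⊆ c') : bdy c ⊆ bdy c' := by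
  intro x hx
  obtain ⟨y, hy, ha⟩ := mem_bdy.1 hx
  exact mem_bdy.2 ⟨y, h hy, ha⟩

lemma UT_fin [Finite J] (ly : ℕ → J) (T : Finset (Vtx d)) (n : ℕ) (c : Finset (Vtx d)) (D : Set (Vtx d)) :
    (UT ly T n c D).Finite :=
  (Set.Finite.prod (Finset.finite_toSet T) (Set.toFinite (univ : Set (Option J)))).subset fun i hi => ⟨hi.1, mem_univ _⟩

lemma chain [Finite J] (ρ : Vtx d × Option J → Measure Bool) [∀ i, IsProbabilityMeasure (ρ i)]
    (ρ0 ρ1 : Measure Bool) (h0 : ∀ x, ρ (x, none) = ρ0) (h1 : ∀ x j, ρ (x, some j) = ρ1)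
    (ly : ℕ → J) (N : ℕ) (hly : ∀ i < N, ∀ j < N, ly i = ly j → i = j)
    (T : Finset (Vtx d)) (P : Finset (Vtx d) → Prop) (hP : ∀ c c', c ⊆ c' → P c → P c') (t : ℕ) (ε β : ENNReal)
    (hb0 : ρ0 {false} ≠ 0) (hb1 : ρ0 {false} ≤ 1)
    (hβ : β ≤ ε / 2 * ρ0 {false} ^ t) (hδ : ρ1 {false} ^ t ≤ ε / 2)
    (good : Set (Set (Vtx d)) → Set (Vtx d) → Finset (Vtx d) → Prop)
    (hgood : ∀ Z B G, good Z B G → Measure.infinitePi ρ {ω | ¬ Gd Z B G (opn (lay none ω))} ≤ β) :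
    ∀ (n : ℕ) (hn : n ≤ N) (c : Finset (Vtx d)) (D : Set (Vtx d)), Win good T P n c D →
      ∃ F : Set (Vtx d × Option J → Bool), Dep F (UT ly T n c D) ∧ Measure.infinitePi ρ F ≤ n * ε ∧
        ∀ ω ∉ F, P ((grow (OT ly T n ω))^[n * T.card] c) := by
  classical
  set μ := Measure.infinitePi ρ with hμ
  have triv : ∀ (n : ℕ) (c : Finset (Vtx d)) (D : Set (Vtx d)), P c →
      ∃ F : Set (Vtx d × Option J → Bool), Dep F (UT ly T n c D) ∧ μ F ≤ n * ε ∧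
        ∀ ω ∉ F, P ((grow (OT ly T n ω))^[n * T.card] c) := by
    intro n c D h
    refine ⟨∅, fun _ _ _ => Iff.rfl, by simp, fun ω _ => hP _ _ ?_ h⟩
    exact grow_iter_mono (n := 0) subset_rfl (Nat.zero_le _) subset_rfl
  intro n
  induction n with
  | zero => exact fun _ c D h => triv 0 c D h
  | succ n ih =>
    intro hn c D hW
    rcases hW with h | ⟨B, G, Z, hBc, hGT, hZG, hZD, hZc, hg, hnext⟩
    · exact triv _ c D h
    set X : Set (Vtx d) := {x | x ∈ D ∧ (x ∈ c ∨ x ∈ bdy c)} with hX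
    set c1 : (Vtx d × Option J → Bool) → Finset (Vtx d) := fun ω => (grow (OpS G X (ly n) ω))^[T.card] c with hc1
    have hst := step ρ ρ0 ρ1 h0 h1 c G B X Z (ly n) T.card t ε β hBc
      (fun x hx _ hxc => hx.2.resolve_left hxc) hZG (fun z hz x hx hxX => hZD z hz x hx hxX.1) hZc
      (Finset.card_le_card hGT) hb0 hb1 hβ hδ (hgood Z B G hg)
    have hF : ∀ c', ∃ F : Set (Vtx d × Option J → Bool), Dep F (UT ly T n c' (D ∪ G)) ∧ μ F ≤ n * ε ∧
        (c ⊆ c' → (∃ z ∈ Z, z ⊆ c') → ∀ ω ∉ F, P ((grow (OT ly T n ω))^[n * T.card] c')) := by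
      intro c'
      by_cases h : c ⊆ c' ∧ ∃ z ∈ Z, z ⊆ c'
      · obtain ⟨F, h1, h2, h3⟩ := ih (by omega) c' (D ∪ G) (hnext c' h.1 h.2)
        exact ⟨F, h1, h2, fun _ _ => h3⟩
      · exact ⟨∅, fun _ _ _ => Iff.rfl, by simp, fun h1 h2 => absurd ⟨h1, h2⟩ h⟩
    choose F hFd hFm hFP using hF
    have hcc1 : ∀ ω, c ⊆ c1 ω := fun ω => grow_iter_mono (n := 0) subset_rfl (Nat.zero_le _) subset_rfl
    have hOpS : ∀ ω ω' : Vtx d × Option J → Bool, ∀ x, ω (x, none) = ω' (x, none) ∨ x ∉ G ∨ x ∈ X →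
        ω (x, some (ly n)) = ω' (x, some (ly n)) ∨ x ∉ G →
        (x ∈ OpS G X (ly n) ω ↔ x ∈ OpS G X (ly n) ω') := by
      intro ω ω' x ha hb
      change (x ∈ (G : Set (Vtx d)) ∧ (x ∉ X ∧ ω (x, none) = true ∨ x ∈ X ∧ ω (x, some (ly n)) = true)) ↔
        (x ∈ (G : Set (Vtx d)) ∧ (x ∉ X ∧ ω' (x, none) = true ∨ x ∈ X ∧ ω' (x, some (ly n)) = true))
      rw [Finset.mem_coe]
      by_cases hG : x ∈ G
      · have hb' := hb.resolve_right (not_not.2 hG)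
        by_cases hx : x ∈ X
        · simp [hG, hx, hb']
        · have ha' := ha.resolve_right (by tauto)
          simp [hG, hx, ha']
      · simp [hG]
    -- dependence of c1 = c'
    set S1 : Finset (Vtx d) → Set (Vtx d × Option J) := fun c' =>
      {i | i.1 ∈ G ∧ (i.2 = none ∧ i.1 ∈ bdy c' ∧ i.1 ∉ X ∨ i.2 = some (ly n))} with hS1
    have hd1 : ∀ c', Dep {ω | c1 ω = c'} (S1 c') := by
      intro c'
      refine dep_of fun ω ω' hh hω => ?_
      have hω' : c1 ω = c' := hω
      change c1 ω' = c'
      rw [← hω']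
      refine (grow_iter_local T.card fun x hx => ?_).symm
      have hx' : x ∈ bdy c' := hω' ▸ hx
      refine hOpS ω ω' x ?_ ?_
      · by_cases hG : x ∈ G
        · by_cases hxX : x ∈ X
          · exact .inr (.inr hxX)
          · exact .inl (hh (x, none) ⟨hG, .inl ⟨rfl, hx', hxX⟩⟩)
        · exact .inr (.inl hG)
      · by_cases hG : x ∈ G
        · exact .inl (hh (x, some (ly n)) ⟨hG, .inr rfl⟩)
        · exact .inr hG
    have hS1U : ∀ c', S1 c' ⊆ UT ly T (n + 1) c D := by
      rintro c' i ⟨hi, h | h⟩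
      · exact ⟨hGT hi, .inl ⟨h.1, h.2.2⟩⟩
      · exact ⟨hGT hi, .inr ⟨n, by omega, h⟩⟩
    have hS1f : ∀ c', (S1 c').Finite := fun c' => (UT_fin ly T (n + 1) c D).subset (hS1U c')
    have hUsub : ∀ c', c ⊆ c' → UT ly T n c' (D ∪ G) ⊆ UT ly T (n + 1) c D := by
      rintro c' hcc' i ⟨hi, h | ⟨k, hk, h⟩⟩
      · refine ⟨hi, .inl ⟨h.1, fun h2 => h.2 ⟨.inl h2.1, ?_⟩⟩⟩
        exact h2.2.imp (fun h => hcc' h) (fun h => bdy_mono hcc' h)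
      · exact ⟨hi, .inr ⟨k, by omega, h⟩⟩
    set F1 : Set (Vtx d × Option J → Bool) := {ω | ¬ ∃ z ∈ Z, z ⊆ ((grow (OpS G X (ly n) ω))^[T.card] c : Finset (Vtx d))} with hF1
    set F2 : Set (Vtx d × Option J → Bool) := {ω | ω ∈ F (c1 ω)} with hF2
    have hc1d : ∀ ω ω' : Vtx d × Option J → Bool, (∀ i ∈ UT ly T (n + 1) c D, ω i = ω' i) → c1 ω = c1 ω' := by
      intro ω ω' hh
      exact ((hd1 (c1 ω)) ω ω' fun i hi => hh i (hS1U _ hi)).1 rfl |>.symm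
    refine ⟨F1 ∪ F2, ?_, ?_, ?_⟩
    · refine dep_of fun ω ω' hh hω => ?_
      have he := hc1d ω ω' hh
      rcases hω with hω | hω
      · left
        change ¬ ∃ z ∈ Z, z ⊆ (c1 ω' : Set (Vtx d))
        rw [← he]
        exact hω
      · right
        change ω' ∈ F (c1 ω')
        rw [← he]
        exact ((hFd (c1 ω)) ω ω' fun i hi => hh i (hUsub _ (hcc1 ω) hi)).1 hω
    · have h2 : μ F2 ≤ n * ε := by
        refine sum_cond μ c1 (fun v => (hd1 v).meas (hS1f v)) _ fun v => ?_
        calc μ ({ω | c1 ω = v} ∩ F2) ≤ μ ({ω | c1 ω = v} ∩ F v) := by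
              refine measure_mono fun ω h => ⟨h.1, ?_⟩
              have h1 : c1 ω = v := h.1
              have h2 : ω ∈ F (c1 ω) := h.2
              rwa [h1] at h2
          _ = μ {ω | c1 ω = v} * μ (F v) := by
              refine indep_of_dep ρ ((hd1 v).meas (hS1f v)) ((hFd v).meas (UT_fin _ _ _ _ _)) (hd1 v) (hFd v) ?_
              refine Set.disjoint_left.2 ?_
              rintro i ⟨h1, h2⟩ ⟨h3, h4⟩
              rcases h2 with h2 | h2 <;> rcases h4 with h4 | ⟨k, hk, h4⟩
              · exact h4.2 ⟨.inr h1, .inr h2.2.1⟩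
              · rw [h2.1] at h4; simp at h4
              · rw [h2] at h4; simp at h4
              · rw [h2] at h4
                have := hly n (by omega) k (by omega) (Option.some.inj h4)
                omega
          _ ≤ μ {ω | c1 ω = v} * (n * ε) := mul_le_mul' le_rfl (hFm v)
          _ = _ := mul_comm _ _
      calc μ (F1 ∪ F2) ≤ μ F1 + μ F2 := measure_union_le _ _
        _ ≤ ε + n * ε := add_le_add hst h2
        _ = _ := by push_cast; ring
    · intro ω hω
      have hω1 : ∃ z ∈ Z, z ⊆ (c1 ω : Set (Vtx d)) := not_not.1 fun h => hω (.inl h)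
      have hω2 : ω ∉ F (c1 ω) := fun h => hω (.inr h)
      refine hP _ _ ?_ (hFP (c1 ω) (hcc1 ω) hω1 ω hω2)
      rw [add_mul, one_mul, Function.iterate_add_apply]
      have e1 : OT ly T n ω ⊆ OT ly T (n + 1) ω := fun x hx =>
        ⟨hx.1, hx.2.imp_right fun ⟨k, hk, h⟩ => ⟨k, by omega, h⟩⟩
      have e2 : OpS G X (ly n) ω ⊆ OT ly T (n + 1) ω := by
        intro x hx
        refine ⟨hGT hx.1, ?_⟩
        rcases hx.2 with h | h
        · exact .inl h.2
        · exact .inr ⟨n, by omega, h.2⟩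
      exact grow_iter_mono e1 le_rfl (grow_iter_mono e2 le_rfl subset_rfl)

end chain

section geo
variable {d : ℕ}

def good (m r : ℤ) (Z : Set (Set (Vtx d))) (B : Set (Vtx d)) (G : Finset (Vtx d)) : Prop :=
  ∃ (i : Fin d) (sg : Fin d → ℤ) (s : Vtx d) (k : ℤ), IsSg sg ∧ r ≤ k ∧ Z = {A | ∃ z, Tgt i sg s m k z ∧ A = box m z} ∧
    B = box m s ∧ (G : Set (Vtx d)) = Reg i sg s m k

lemma box_Reg {i : Fin d} {sg : Fin d → ℤ} (hs : IsSg sg) {s z : Vtx d} {m k : ℤ} (hm : 0 ≤ m)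
    (hz : Tgt i sg s m k z) : box m z ⊆ Reg i sg s m k := by
  intro x hx
  right
  refine ⟨?_, ?_, fun j hj => ?_⟩
  · have h1 := hz.1; have h2 := hx i
    rcases hs i with h | h <;> rw [h] at h1 ⊢ <;> omega
  · have h1 := hz.1; have h2 := hx i
    rcases hs i with h | h <;> rw [h] at h1 ⊢ <;> omega
  · have h1 := hz.2 j hj; have h2 := hx j
    rcases hs j with h | h <;> rw [h] at h1 ⊢ <;> omega

lemma Win_move {m r : ℤ} (hm : 0 ≤ m) {T : Finset (Vtx d)} {P : Finset (Vtx d) → Prop} {n : ℕ} {c : Finset (Vtx d)}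
    {D : Set (Vtx d)} (i : Fin d) (sg : Fin d → ℤ) (s : Vtx d) (k : ℤ) (hs : IsSg sg) (hk : r ≤ k) (hr : 0 ≤ r)
    (hB : box m s ⊆ c) (hT : Reg i sg s m k ⊆ T)
    (hD : ∀ z, Tgt i sg s m k z → ∀ x ∈ box m z, x ∉ D)
    (hn : ∀ z, Tgt i sg s m k z → ∀ c' : Finset (Vtx d), c ⊆ c' → box m z ⊆ c' → Win (good m r) T P n c' (D ∪ Reg i sg s m k)) :
    Win (good m r) T P (n + 1) c D := by
  right
  have hfin : (Reg i sg s m k).Finite := (box_finite _ _).subset (Reg_sub i hs s hm (by omega))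
  refine ⟨box m s, hfin.toFinset, {A | ∃ z, Tgt i sg s m k z ∧ A = box m z}, hB, ?_, ?_, ?_, ?_, ?_, ?_⟩
  · intro x hx
    exact hT ((Set.Finite.mem_toFinset _).1 hx)
  · rintro _ ⟨z, hz, rfl⟩
    rw [Set.Finite.coe_toFinset]
    exact box_Reg hs hm hz
  · rintro _ ⟨z, hz, rfl⟩
    exact hD z hz
  · rintro _ ⟨z, hz, rfl⟩
    exact ⟨z, mem_box_self hm z, fun x hx => box_conn' (mem_box_self hm z) hx⟩
  · exact ⟨i, sg, s, k, hs, hk, rfl, rfl, Set.Finite.coe_toFinset _⟩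
  · rintro c' hc ⟨_, ⟨z, hz, rfl⟩, hzc⟩
    rw [Set.Finite.coe_toFinset]
    exact hn z hz c' hc hzc

open Classical in
noncomputable def sgT (i0 : Fin d) (a s : Vtx d) : Fin d → ℤ := fun j =>
  if j = i0 then 1 else if s j ≤ a j then 1 else -1

lemma sgT_is (i0 : Fin d) (a s : Vtx d) : IsSg (sgT i0 a s) := by
  intro j
  unfold sgT
  split_ifs <;> simp

lemma sgT_0 (i0 : Fin d) (a s : Vtx d) : sgT i0 a s i0 = 1 := by simp [sgT]

lemma sgT_j {i0 : Fin d} (a s : Vtx d) {j : Fin d} (hj : j ≠ i0) :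
    (sgT i0 a s j = 1 ∧ s j ≤ a j) ∨ (sgT i0 a s j = -1 ∧ a j < s j) := by
  unfold sgT
  rw [if_neg hj]
  split_ifs with h
  · exact .inl ⟨rfl, h⟩
  · exact .inr ⟨rfl, not_le.1 h⟩

lemma op_win {m r h : ℤ} (hm : 0 ≤ m) (hr : 10 * m + 10 ≤ r) (i0 j0 : Fin d) (hj0 : j0 ≠ i0) (a a' s : Vtx d)
    (h1 : a j0 - 2 * r ≤ a' j0 ∧ a' j0 ≤ a j0 + 2 * r) (h2 : ∀ l ≠ j0, a' l = a l)
    (hs0 : s i0 = h) (hsj : ∀ j ≠ i0, a j - 8 * r ≤ s j ∧ s j ≤ a j + 8 * r)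
    (c : Finset (Vtx d)) (hsc : box m s ⊆ c) (T : Finset (Vtx d))
    (hT : ∀ x : Vtx d, h - 8 * r ≤ x i0 → x i0 ≤ h + 8 * r + m →
      (∀ j ≠ i0, a j - 20 * r ≤ x j ∧ x j ≤ a j + 20 * r) → x ∈ T) :
    Win (good m r) T (fun c' => ∃ s' : Vtx d, s' i0 = h + 8 * r ∧ (∀ j ≠ i0, a' j - 8 * r ≤ s' j ∧ s' j ≤ a' j + 8 * r) ∧
      box m s' ⊆ c') 3 c {x | x i0 ≤ h + m} := by
  by_cases hI : ∀ j ≠ i0, a' j - 8 * r ≤ s j ∧ s j ≤ a' j + 8 * r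
  · -- one move
    refine Win_move hm i0 (sgT i0 a' s) s (8 * r - m - 1) (sgT_is _ _ _) (by omega) (by omega) hsc ?_ ?_ ?_
    · intro x hx
      refine hT x ?_ ?_ ?_
      · rcases hx with hx | hx
        · have := hx i0; omega
        · have := hx.1; rw [sgT_0] at this; omega
      · rcases hx with hx | hx
        · have := hx i0; omega
        · have := hx.2.1; rw [sgT_0] at this; omega
      · intro j hj
        have := Reg_sub i0 (sgT_is _ _ _) s hm (by omega) hx j
        have := hsj j hj
        omega
    · intro z hz x hx hxD
      have e1 := hz.1; rw [sgT_0] at e1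
      have e2 := hx i0
      have e3 : x i0 ≤ h + m := hxD
      omega
    · intro z hz c' hc hzc
      left
      refine ⟨z, ?_, fun j hj => ?_, hzc⟩
      · have e1 := hz.1; rw [sgT_0] at e1; omega
      · have e1 := hz.2 j hj
        have e2 := hI j hj
        rcases sgT_j a' s hj with ⟨e, e'⟩ | ⟨e, e'⟩ <;> rw [e] at e1 <;> omega
  -- three moves
  have hII : ∀ j ≠ i0, j ≠ j0 → a' j - 8 * r ≤ s j ∧ s j ≤ a' j + 8 * r := by
    intro j hj hj'
    rw [h2 j hj']; exact hsj j hj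
  have hbad : ¬ (a' j0 - 8 * r ≤ s j0 ∧ s j0 ≤ a' j0 + 8 * r) := by
    intro hc
    refine hI fun j hj => ?_
    by_cases e : j = j0
    · rw [e]; exact hc
    · exact hII j hj e
  have hsj0 := hsj j0 hj0
  have hni : i0 ≠ j0 := fun e => hj0 e.symm
  refine Win_move hm i0 (sgT i0 a' s) s r (sgT_is _ _ _) le_rfl (by omega) hsc ?_ ?_ ?_
  · intro x hx
    refine hT x ?_ ?_ ?_
    · rcases hx with hx | hx
      · have := hx i0; omega
      · have := hx.1; rw [sgT_0] at this; omega
    · rcases hx with hx | hx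
      · have := hx i0; omega
      · have := hx.2.1; rw [sgT_0] at this; omega
    · intro j hj
      have := Reg_sub i0 (sgT_is _ _ _) s hm (by omega) hx j
      have := hsj j hj
      omega
  · intro z hz x hx hxD
    have e1 := hz.1; rw [sgT_0] at e1
    have e2 := hx i0
    have e3 : x i0 ≤ h + m := hxD
    omega
  intro z1 hz1 c1 hc1 hzc1
  have z10 : z1 i0 = h + r + 1 + m := by have e1 := hz1.1; rw [sgT_0] at e1; omega
  have z1s : ∀ j ≠ i0, s j - r - m ≤ z1 j ∧ z1 j ≤ s j + r + m := by
    intro j hj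
    have e1 := hz1.2 j hj
    rcases sgT_j a' s hj with ⟨e, e'⟩ | ⟨e, e'⟩ <;> rw [e] at e1 <;> omega
  have z1o : ∀ j ≠ i0, j ≠ j0 → a' j - 8 * r ≤ z1 j ∧ z1 j ≤ a' j + 8 * r := by
    intro j hj hj'
    have e1 := hz1.2 j hj
    have e2 := hII j hj hj'
    rcases sgT_j a' s hj with ⟨e, e'⟩ | ⟨e, e'⟩ <;> rw [e] at e1 <;> omega
  have z1j := hz1.2 j0 hj0
  -- second move
  refine Win_move hm j0 (sgT i0 a' z1) z1 (2 * r) (sgT_is _ _ _) (by omega) (by omega) hzc1 ?_ ?_ ?_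
  · intro x hx
    refine hT x ?_ ?_ ?_
    · rcases hx with hx | hx
      · have := hx i0; omega
      · have := hx.2.2 i0 hni; rw [sgT_0] at this; omega
    · rcases hx with hx | hx
      · have := hx i0; omega
      · have := hx.2.2 i0 hni; rw [sgT_0] at this; omega
    · intro j hj
      have := Reg_sub j0 (sgT_is _ _ _) z1 hm (by omega) hx j
      have := hsj j hj
      have := z1s j hj
      omega
  · intro z hz x hx hxD
    have e1 := hz.1
    have e2 := hx j0
    rcases hxD with e3 | e3
    · have e3 : x i0 ≤ h + m := e3
      have e4 := hz.2 i0 hni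
      have e5 := hx i0
      rw [sgT_0] at e4
      omega
    · rcases sgT_j a' s hj0 with ⟨e, e'⟩ | ⟨e, e'⟩ <;> rcases sgT_j a' z1 hj0 with ⟨g, g'⟩ | ⟨g, g'⟩ <;>
        rw [e] at z1j <;> rw [g] at e1
      · rcases e3 with e3 | e3
        · have := e3 j0; omega
        · have := e3.2.2 j0 hj0; rw [e] at this; omega
      · omega
      · omega
      · rcases e3 with e3 | e3
        · have := e3 j0; omega
        · have := e3.2.2 j0 hj0; rw [e] at this; omega
  intro z2 hz2 c2 hc2 hzc2
  have z20 : h + r + 1 + 2 * m ≤ z2 i0 ∧ z2 i0 ≤ h + 3 * r + 1 + 2 * m := by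
    have e1 := hz2.2 i0 hni; rw [sgT_0] at e1; omega
  have z2s : ∀ j ≠ i0, s j - 3 * r - 2 * m - 1 ≤ z2 j ∧ z2 j ≤ s j + 3 * r + 2 * m + 1 := by
    intro j hj
    have e0 := z1s j hj
    by_cases e : j = j0
    · have e1 := hz2.1
      subst e
      rcases sgT_j a' z1 hj with ⟨e, e'⟩ | ⟨e, e'⟩ <;> rw [e] at e1 <;> omega
    · have e1 := hz2.2 j e
      rcases sgT_j a' z1 hj with ⟨e, e'⟩ | ⟨e, e'⟩ <;> rw [e] at e1 <;> omega
  have z2o : ∀ j ≠ i0, a' j - 8 * r ≤ z2 j ∧ z2 j ≤ a' j + 8 * r := by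
    intro j hj
    by_cases hj' : j = j0
    · have e1 := hz2.1
      subst hj'
      rcases sgT_j a' s hj with ⟨e, e'⟩ | ⟨e, e'⟩ <;> rcases sgT_j a' z1 hj with ⟨g, g'⟩ | ⟨g, g'⟩ <;>
        rw [e] at z1j <;> rw [g] at e1 <;> omega
    · have e1 := hz2.2 j hj'
      have e2 := z1o j hj hj'
      rcases sgT_j a' z1 hj with ⟨e, e'⟩ | ⟨e, e'⟩ <;> rw [e] at e1 <;> omega
  refine Win_move hm i0 (sgT i0 a' z2) z2 (h + 8 * r - z2 i0 - m - 1) (sgT_is _ _ _) (by omega) (by omega) hzc2 ?_ ?_ ?_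
  · intro x hx
    refine hT x ?_ ?_ ?_
    · rcases hx with hx | hx
      · have := hx i0; omega
      · have := hx.1; rw [sgT_0] at this; omega
    · rcases hx with hx | hx
      · have := hx i0; omega
      · have := hx.2.1; rw [sgT_0] at this; omega
    · intro j hj
      have := Reg_sub i0 (sgT_is _ _ _) z2 hm (by omega) hx j
      have := hsj j hj
      have := z2s j hj
      omega
  · intro z hz x hx hxD
    have e1 := hz.1; rw [sgT_0] at e1
    have e2 := hx i0
    rcases hxD with (e3 | e3) | e3
    · have e3 : x i0 ≤ h + m := e3
      omega
    · have := Reg_sub i0 (sgT_is _ _ _) s hm (by omega) e3 i0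
      omega
    · have := Reg_sub j0 (sgT_is _ _ _) z1 hm (by omega) e3 i0
      omega
  intro z3 hz3 c3 hc3 hzc3
  refine ⟨z3, ?_, fun j hj => ?_, hzc3⟩
  · have e1 := hz3.1; rw [sgT_0] at e1; omega
  · have e1 := hz3.2 j hj
    have e2 := z2o j hj
    rcases sgT_j a' z2 hj with ⟨e, e'⟩ | ⟨e, e'⟩ <;> rw [e] at e1 <;> omega

end geo

abbrev JJ := Fin 3 × Fin 3

structure Par (d : ℕ) where
  m : ℤ
  r : ℤ
  N : ℤ
  B0 : ℕ
  i0 : Fin d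
  i1 : Fin d
  i2 : Fin d
  hm : 0 ≤ m
  hr : 10 * m + 10 ≤ r
  h01 : i1 ≠ i0
  h02 : i2 ≠ i0
  h12 : i2 ≠ i1

section proc
variable {d : ℕ} (p : Par d)

abbrev IX (d : ℕ) := Vtx d × Option JJ

def hh (t : ℕ) : ℤ := t * (8 * p.r)

lemma hh_succ (t : ℕ) : hh p (t + 1) = hh p t + 8 * p.r := by unfold hh; push_cast; ring

lemma hh_mono {s t : ℕ} (h : s ≤ t) : hh p s ≤ hh p t := by
  unfold hh
  have := p.hm; have := p.hr
  exact mul_le_mul_of_nonneg_right (by exact_mod_cast h) (by omega)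

open Classical in
noncomputable def ax (κ : Cell) : Vtx d := fun j =>
  if j = p.i1 then 2 * p.r * κ.1 else if j = p.i2 then 2 * p.r * κ.2 else 0

lemma ax_1 (κ : Cell) : ax p κ p.i1 = 2 * p.r * κ.1 := by simp [ax]
lemma ax_2 (κ : Cell) : ax p κ p.i2 = 2 * p.r * κ.2 := by simp [ax, p.h12]
lemma ax_o (κ : Cell) {j : Fin d} (h1 : j ≠ p.i1) (h2 : j ≠ p.i2) : ax p κ j = 0 := by simp [ax, h1, h2]

def alive (h : ℤ) (κ : Cell) (c : Finset (Vtx d)) : Prop :=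
  ∃ s : Vtx d, s p.i0 = h ∧ (∀ j ≠ p.i0, ax p κ j - 8 * p.r ≤ s j ∧ s j ≤ ax p κ j + 8 * p.r) ∧ box p.m s ⊆ c

open Classical in
noncomputable def tube (h : ℤ) (κ : Cell) : Finset (Vtx d) :=
  Finset.Icc (fun j => if j = p.i0 then h - 8 * p.r else ax p κ j - 20 * p.r)
    (fun j => if j = p.i0 then h + 8 * p.r + p.m else ax p κ j + 20 * p.r)

open Classical in
noncomputable def tcard : ℕ := ∏ j : Fin d, (if j = p.i0 then 16 * p.r + p.m + 1 else 40 * p.r + 1).toNat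

lemma tube_card (h : ℤ) (κ : Cell) : (tube p h κ).card = tcard p := by
  classical
  unfold tube tcard
  rw [Pi.card_Icc]
  refine Finset.prod_congr rfl fun j _ => ?_
  rw [Int.card_Icc]
  congr 1
  split_ifs <;> ring

lemma mem_tube {h : ℤ} {κ : Cell} {x : Vtx d} : x ∈ tube p h κ ↔
    (h - 8 * p.r ≤ x p.i0 ∧ x p.i0 ≤ h + 8 * p.r + p.m) ∧
      ∀ j ≠ p.i0, ax p κ j - 20 * p.r ≤ x j ∧ x j ≤ ax p κ j + 20 * p.r := by
  classical
  unfold tube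
  rw [Finset.mem_Icc]
  constructor
  · rintro ⟨h1, h2⟩
    refine ⟨⟨?_, ?_⟩, fun j hj => ⟨?_, ?_⟩⟩
    · have := h1 p.i0; simpa using this
    · have := h2 p.i0; simpa using this
    · have := h1 j; simpa [hj] using this
    · have := h2 j; simpa [hj] using this
  · rintro ⟨h1, h2⟩
    refine ⟨fun j => ?_, fun j => ?_⟩
    · by_cases hj : j = p.i0
      · subst hj; simpa using h1.1
      · simpa [hj] using (h2 j hj).1
    · by_cases hj : j = p.i0
      · subst hj; simpa using h1.2
      · simpa [hj] using (h2 j hj).2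

lemma win_alive (h : ℤ) {κ κ' : Cell} (hn : near1 κ' κ) (c : Finset (Vtx d)) (ha : alive p h κ c) :
    Win (good p.m p.r) (tube p h κ) (alive p (h + 8 * p.r) κ') 3 c {x | x p.i0 ≤ h + p.m} := by
  obtain ⟨s, hs0, hsj, hsc⟩ := ha
  have hr := p.hr
  have hm := p.hm
  have hT : ∀ x : Vtx d, h - 8 * p.r ≤ x p.i0 → x p.i0 ≤ h + 8 * p.r + p.m →
      (∀ j ≠ p.i0, ax p κ j - 20 * p.r ≤ x j ∧ x j ≤ ax p κ j + 20 * p.r) → x ∈ tube p h κ :=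
    fun x h1 h2 h3 => (mem_tube p).2 ⟨⟨h1, h2⟩, h3⟩
  unfold near1 at hn
  have a1 := abs_nonneg (κ'.1 - κ.1)
  have a2 := abs_nonneg (κ'.2 - κ.2)
  rcases eq_or_ne κ'.2 κ.2 with he | he
  · have h3 : |κ'.1 - κ.1| ≤ 1 := by linarith
    rw [abs_le] at h3
    refine op_win hm hr p.i0 p.i1 p.h01 (ax p κ) (ax p κ') s ?_ ?_ hs0 hsj c hsc _ hT
    · rw [ax_1, ax_1]; constructor <;> nlinarith
    · intro l hl
      by_cases h2 : l = p.i2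
      · subst h2; rw [ax_2, ax_2, he]
      · rw [ax_o p _ hl h2, ax_o p _ hl h2]
  · have h4 : 1 ≤ |κ'.2 - κ.2| := Int.one_le_abs (sub_ne_zero.2 he)
    have h5 : κ'.1 = κ.1 := by
      have : |κ'.1 - κ.1| = 0 := by linarith
      exact sub_eq_zero.1 (abs_eq_zero.1 this)
    have h3 : |κ'.2 - κ.2| ≤ 1 := by linarith
    rw [abs_le] at h3
    refine op_win hm hr p.i0 p.i2 p.h02 (ax p κ) (ax p κ') s ?_ ?_ hs0 hsj c hsc _ hT
    · rw [ax_2, ax_2]; constructor <;> nlinarith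
    · intro l hl
      by_cases h2 : l = p.i1
      · subst h2; rw [ax_1, ax_1, h5]
      · rw [ax_o p _ h2 hl, ax_o p _ h2 hl]

lemma tube_disj (h : ℤ) {κ κ' : Cell} (h1 : κ.1 % 21 = κ'.1 % 21) (h2 : κ.2 % 21 = κ'.2 % 21) (hne : κ ≠ κ') (x : Vtx d)
    (hx : x ∈ tube p h κ) : x ∉ tube p h κ' := by
  intro hx'
  apply hne
  rw [mem_tube] at hx hx'
  have hr := p.hr
  have hm := p.hm
  have e1 := hx.2 p.i1 p.h01
  have e2 := hx.2 p.i2 p.h02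
  have e1' := hx'.2 p.i1 p.h01
  have e2' := hx'.2 p.i2 p.h02
  rw [ax_1] at e1 e1'
  rw [ax_2] at e2 e2'
  have key : ∀ u v y : ℤ, 2 * p.r * u - 20 * p.r ≤ y ∧ y ≤ 2 * p.r * u + 20 * p.r →
      2 * p.r * v - 20 * p.r ≤ y ∧ y ≤ 2 * p.r * v + 20 * p.r → u % 21 = v % 21 → u = v := by
    intro u v y hu hv huv
    have a1 : u - v < 21 := by
      by_contra hc
      have : p.r * 21 ≤ p.r * (u - v) := mul_le_mul_of_nonneg_left (by omega) (by omega)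
      nlinarith
    have a2 : v - u < 21 := by
      by_contra hc
      have : p.r * 21 ≤ p.r * (v - u) := mul_le_mul_of_nonneg_left (by omega) (by omega)
      nlinarith
    omega
  exact Prod.ext (key _ _ _ e1 e1' h1) (key _ _ _ e2 e2' h2)

/-- the exploration -/
def lyr (t : ℕ) (k : ℕ) : JJ := (Fin.ofNat 3 t, Fin.ofNat 3 k)

def Opn (t : ℕ) (ω : IX d → Bool) : Set (Vtx d) :=
  {x | x p.i0 ≤ hh p (t + 1) + p.m ∧ (ω (x, none) = true ∨
    hh p t - 8 * p.r ≤ x p.i0 ∧ ∃ k < 3, ω (x, some (lyr t k)) = true)}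

open Classical in
noncomputable def V0 : Finset (Vtx d) :=
  Finset.Icc (fun _ => -p.N) (fun j => if j = p.i0 then p.m else p.N)

noncomputable def CC (ω : IX d → Bool) : ℕ → Finset (Vtx d)
  | 0 => V0 p
  | t + 1 => (grow (Opn p t ω))^[p.B0] (CC ω t)

lemma CC_mono (ω : IX d → Bool) {s t : ℕ} (h : s ≤ t) : CC p ω s ⊆ CC p ω t := by
  induction t, h using Nat.le_induction with
  | base => exact subset_rfl
  | succ t _ ih => exact ih.trans (grow_iter_mono (n := 0) (O := ∅) (empty_subset _) (Nat.zero_le _) subset_rfl)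

def Past (t : ℕ) (c : Finset (Vtx d)) : Set (IX d) :=
  {i | i.1 ∈ bdy c ∧ (i.2 = none ∧ i.1 p.i0 ≤ hh p t + p.m ∨
    ∃ t' < t, ∃ k, i.2 = some (lyr t' k) ∧ i.1 p.i0 ≤ hh p (t' + 1) + p.m)}

lemma Past_fin (t : ℕ) (c : Finset (Vtx d)) : (Past p t c).Finite :=
  (Set.Finite.prod (Finset.finite_toSet (bdy c)) (Set.toFinite (univ : Set (Option JJ)))).subset
    fun i hi => ⟨hi.1, mem_univ _⟩

lemma CC_dep (t : ℕ) (ω ω' : IX d → Bool) (h : ∀ i ∈ Past p t (CC p ω t), ω i = ω' i) :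
    ∀ s ≤ t, CC p ω s = CC p ω' s := by
  intro s
  induction s with
  | zero => exact fun _ => rfl
  | succ s ih =>
    intro hs
    have e := ih (by omega)
    change (grow (Opn p s ω))^[p.B0] (CC p ω s) = (grow (Opn p s ω'))^[p.B0] (CC p ω' s)
    rw [← e]
    refine grow_iter_local _ fun x hx => ?_
    have hx' : x ∈ bdy (CC p ω t) := bdy_mono (CC_mono p ω hs) hx
    refine and_congr_right fun hx0 => or_congr ?_ (and_congr_right fun _ => exists_congr fun k => and_congr_right fun _ => ?_)
    · rw [h (x, none) ⟨hx', .inl ⟨rfl, hx0.trans (by have := hh_mono p hs; omega)⟩⟩]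
    · rw [h (x, some (lyr s k)) ⟨hx', .inr ⟨s, by omega, k, rfl, hx0⟩⟩]

noncomputable def hist (t : ℕ) (ω : IX d → Bool) : Fin (t + 1) → Finset (Vtx d) := fun s => CC p ω s

@[reducible] noncomputable def FF (t : ℕ) : MeasurableSpace (IX d → Bool) := MeasurableSpace.comap (hist p t) ⊤

def SA (t : ℕ) (ω : IX d → Bool) : Set Cell := {κ | alive p (hh p t) κ (CC p ω t)}

lemma FF_iff {t : ℕ} {A : Set (IX d → Bool)} : MeasurableSet[FF p t] A ↔ ∃ s : Set (Fin (t + 1) → Finset (Vtx d)), A = {ω | hist p t ω ∈ s} := by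
  constructor
  · rintro ⟨s, -, rfl⟩; exact ⟨s, rfl⟩
  · rintro ⟨s, rfl⟩; exact ⟨s, trivial, rfl⟩

lemma hist_dep (t : ℕ) (h : Fin (t + 1) → Finset (Vtx d)) : Dep {ω | hist p t ω = h} (Past p t (h (Fin.last t))) := by
  refine dep_of fun ω ω' hh' hω => ?_
  have hω' : hist p t ω = h := hω
  have e : CC p ω t = h (Fin.last t) := congrFun hω' (Fin.last t)
  change hist p t ω' = h
  rw [← hω']
  funext s
  exact (CC_dep p t ω ω' (by rw [e]; exact hh') s (by omega)).symm

lemma indep_prod {ι E K : Type*} [MeasurableSpace E] [Finite E] [MeasurableSingletonClass E] [DecidableEq K] (ρ : ι → Measure E)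
    [∀ i, IsProbabilityMeasure (ρ i)] (ε : ENNReal) (F : K → Set (ι → E)) (Sk : K → Set ι) (hSf : ∀ k, (Sk k).Finite)
    (J : Finset K) :
    ∀ (A : Set (ι → E)) (S : Set ι) (hS : S.Finite) (dA : Dep A S)
    (dF : ∀ k ∈ J, Dep (F k) (Sk k)) (hF : ∀ k ∈ J, Measure.infinitePi ρ (F k) ≤ ε)
    (hd : ∀ k ∈ J, Disjoint S (Sk k)) (hdd : ∀ k ∈ J, ∀ k' ∈ J, k ≠ k' → Disjoint (Sk k) (Sk k')),
    Measure.infinitePi ρ (A ∩ {ω | ∀ k ∈ J, ω ∈ F k}) ≤ ε ^ J.card * Measure.infinitePi ρ A := by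
  induction J using Finset.induction_on with
  | empty => intro A S hS dA _ _ _ _; simp
  | insert k J hk ih =>
    intro A S hS dA dF hF hd hdd
    have hkI := Finset.mem_insert_self k J
    have hI : ∀ k' ∈ J, k' ∈ insert k J := fun k' h => Finset.mem_insert_of_mem h
    have e : A ∩ {ω | ∀ k' ∈ insert k J, ω ∈ F k'} = (A ∩ F k) ∩ {ω | ∀ k' ∈ J, ω ∈ F k'} := by
      ext ω
      change ω ∈ A ∧ (∀ k' ∈ insert k J, ω ∈ F k') ↔ (ω ∈ A ∧ ω ∈ F k) ∧ ∀ k' ∈ J, ω ∈ F k'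
      rw [Finset.forall_mem_insert, and_assoc]
    rw [e]
    refine (ih (A ∩ F k) (S ∪ Sk k) (hS.union (hSf k))
      ((dA.mono subset_union_left).inter ((dF k hkI).mono subset_union_right))
      (fun k' h => dF k' (hI k' h)) (fun k' h => hF k' (hI k' h))
      (fun k' h => Set.disjoint_union_left.2 ⟨hd k' (hI k' h), hdd k hkI k' (hI k' h) (fun h' => hk (h' ▸ h))⟩)
      (fun a ha b hb => hdd a (hI a ha) b (hI b hb))).trans ?_
    rw [indep_of_dep ρ (dA.meas hS) ((dF k hkI).meas (hSf k)) dA (dF k hkI) (hd k hkI), Finset.card_insert_of_notMem hk, pow_succ,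
      mul_assoc, mul_comm ε]
    exact mul_le_mul' le_rfl (mul_le_mul' le_rfl (hF k hkI))

lemma sum_cond' {Ω κ : Type*} [MeasurableSpace Ω] [Countable κ] (μ : Measure Ω)
    (f : Ω → κ) (hf : ∀ v, MeasurableSet {ω | f ω = v}) {B : Set Ω} (s : Set κ) (ε : ENNReal)
    (h : ∀ v ∈ s, μ ({ω | f ω = v} ∩ B) ≤ ε * μ {ω | f ω = v}) : μ ({ω | f ω ∈ s} ∩ B) ≤ ε * μ {ω | f ω ∈ s} := by
  have hU : {ω | f ω ∈ s} = ⋃ v : s, {ω | f ω = v} := by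
    ext ω
    rw [mem_iUnion]
    exact ⟨fun h => ⟨⟨_, h⟩, rfl⟩, fun ⟨v, hv⟩ => by
      have hv' : f ω = v := hv
      change f ω ∈ s
      rw [hv']; exact v.2⟩
  rw [hU, iUnion_inter]
  calc _ ≤ ∑' v : s, μ ({ω | f ω = v} ∩ B) := measure_iUnion_le _
    _ ≤ ∑' v : s, ε * μ {ω | f ω = v} := ENNReal.tsum_le_tsum fun v => h v v.2
    _ = ε * ∑' v : s, μ {ω | f ω = v} := ENNReal.tsum_mul_left
    _ = _ := by
        rw [measure_iUnion _ fun v : s => hf v]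
        intro v w hvw
        exact Set.disjoint_left.2 fun ω h h' => hvw (Subtype.ext (h.symm.trans h'))

end proc

section proc
variable {d : ℕ} (p : Par d)

lemma alive_mono (h : ℤ) (κ : Cell) (c c' : Finset (Vtx d)) (hc : c ⊆ c') (ha : alive p h κ c) : alive p h κ c' := by
  obtain ⟨s, h1, h2, h3⟩ := ha
  exact ⟨s, h1, h2, h3.trans (Finset.coe_subset.2 hc)⟩

lemma lyr_inj (t : ℕ) : ∀ i < 3, ∀ j < 3, lyr t i = lyr t j → i = j := by
  intro i hi j hj h
  have := congrArg (fun a : JJ => a.2.val) h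
  simp [lyr] at this
  omega

lemma op_fail (ρ : IX d → Measure Bool) [∀ i, IsProbabilityMeasure (ρ i)]
    (ρ0 ρ1 : Measure Bool) (h0 : ∀ x, ρ (x, none) = ρ0) (h1 : ∀ x j, ρ (x, some j) = ρ1)
    (t0 : ℕ) (ε1 β : ENNReal) (hb0 : ρ0 {false} ≠ 0) (hb1 : ρ0 {false} ≤ 1)
    (hβ : β ≤ ε1 / 2 * ρ0 {false} ^ t0) (hδ : ρ1 {false} ^ t0 ≤ ε1 / 2)
    (hgood : ∀ Z B G, good p.m p.r Z B G → Measure.infinitePi ρ {ω | ¬ Gd Z B G (opn (lay none ω))} ≤ β)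
    (hB0 : 3 * tcard p ≤ p.B0) (t : ℕ) (c : Finset (Vtx d)) (κ κ' : Cell) (hn : near1 κ' κ) (ha : alive p (hh p t) κ c) :
    ∃ F : Set (IX d → Bool), Dep F (UT (lyr t) (tube p (hh p t) κ) 3 c {x | x p.i0 ≤ hh p t + p.m}) ∧
      Measure.infinitePi ρ F ≤ 3 * ε1 ∧ ∀ ω ∉ F, CC p ω t = c → κ' ∈ SA p (t + 1) ω := by
  obtain ⟨F, hd, hF, hP⟩ := chain ρ ρ0 ρ1 h0 h1 (lyr t) 3 (lyr_inj t) (tube p (hh p t) κ) (alive p (hh p t + 8 * p.r) κ')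
    (alive_mono p _ _) t0 ε1 β hb0 hb1 hβ hδ (good p.m p.r) hgood 3 le_rfl c {x | x p.i0 ≤ hh p t + p.m} (win_alive p _ hn c ha)
  refine ⟨F, hd, by exact_mod_cast hF, fun ω hω hc => ?_⟩
  change alive p (hh p (t + 1)) κ' (CC p ω (t + 1))
  rw [hh_succ]
  refine alive_mono p _ _ _ _ ?_ (hP ω hω)
  change _ ⊆ (grow (Opn p t ω))^[p.B0] (CC p ω t)
  rw [hc]
  refine grow_iter_mono ?_ (by rw [tube_card]; exact hB0) subset_rfl
  rintro x ⟨hx, hx2⟩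
  have := (mem_tube p).1 hx
  refine ⟨by rw [hh_succ]; exact this.1.2, hx2.imp_right fun h => ⟨this.1.1, h⟩⟩

lemma past_disj (t : ℕ) (c : Finset (Vtx d)) (κ : Cell) :
    Disjoint (Past p t c) (UT (lyr t) (tube p (hh p t) κ) 3 c {x | x p.i0 ≤ hh p t + p.m}) := by
  refine Set.disjoint_left.2 ?_
  rintro ⟨x, a⟩ ⟨h1, h2⟩ ⟨h3, h4⟩
  simp only at h1 h2 h3 h4
  rcases h2 with h2 | ⟨t', ht', k, h2, h5⟩ <;> rcases h4 with h4 | ⟨k', hk', h4⟩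
  · exact h4.2 ⟨h2.2, .inr h1⟩
  · rw [h2.1] at h4; simp at h4
  · rw [h2] at h4; simp at h4
  · rw [h2] at h4
    have h6 := congrArg (fun a : JJ => a.1.val) (Option.some.inj h4)
    simp [lyr] at h6
    have h7 := ((mem_tube p).1 h3).1.1
    have h8 := hh_mono p (show t' + 1 + 2 ≤ t by omega)
    rw [show t' + 1 + 2 = (t' + 1 + 1) + 1 from rfl, hh_succ, hh_succ] at h8
    have := p.hr
    have := p.hm
    omega

lemma UT_disj (t : ℕ) (c : Finset (Vtx d)) (D : Set (Vtx d)) {κ κ' : Cell} (h1 : κ.1 % 21 = κ'.1 % 21) (h2 : κ.2 % 21 = κ'.2 % 21) (hne : κ ≠ κ') :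
    Disjoint (UT (lyr t) (tube p (hh p t) κ) 3 c D) (UT (lyr t) (tube p (hh p t) κ') 3 c D) :=
  Set.disjoint_left.2 fun i h h' => tube_disj p _ h1 h2 hne i.1 h.1 h'.1

lemma hist_meas (t : ℕ) (v : Fin (t + 1) → Finset (Vtx d)) : MeasurableSet {ω | hist p t ω = v} :=
  (hist_dep p t v).meas (Past_fin p t _)

lemma ker (ρ : IX d → Measure Bool) [∀ i, IsProbabilityMeasure (ρ i)]
    (ρ0 ρ1 : Measure Bool) (h0 : ∀ x, ρ (x, none) = ρ0) (h1 : ∀ x j, ρ (x, some j) = ρ1)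
    (t0 : ℕ) (ε1 β ε : ENNReal) (hb0 : ρ0 {false} ≠ 0) (hb1 : ρ0 {false} ≤ 1)
    (hβ : β ≤ ε1 / 2 * ρ0 {false} ^ t0) (hδ : ρ1 {false} ^ t0 ≤ ε1 / 2)
    (hgood : ∀ Z B G, good p.m p.r Z B G → Measure.infinitePi ρ {ω | ¬ Gd Z B G (opn (lay none ω))} ≤ β)
    (hB0 : 3 * tcard p ≤ p.B0) (hε : ε ≤ 1) (hεε : 3 * ε1 ≤ ε ^ 441) :
    Ker (Measure.infinitePi ρ) (FF p) (SA p) ε where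
  mono := by
    intro s t hst A hA
    rw [FF_iff] at hA ⊢
    obtain ⟨u, rfl⟩ := hA
    exact ⟨{h | (fun k : Fin (s + 1) => h ⟨k, by omega⟩) ∈ u}, rfl⟩
  le := by
    intro t A hA
    rw [FF_iff] at hA
    obtain ⟨u, rfl⟩ := hA
    have : {ω | hist p t ω ∈ u} = ⋃ v ∈ u, {ω | hist p t ω = v} := by
      ext ω
      rw [mem_iUnion₂]
      exact ⟨fun h => ⟨_, h, rfl⟩, fun ⟨v, hv, h⟩ => by
        have h' : hist p t ω = v := h
        change hist p t ω ∈ u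
        rw [h']; exact hv⟩
    rw [this]
    exact MeasurableSet.biUnion (Set.to_countable u) fun v _ => hist_meas p t v
  meas := by
    intro t k
    rw [FF_iff]
    exact ⟨{h | alive p (hh p t) k (h (Fin.last t))}, rfl⟩
  bound := by
    classical
    intro t A hA J f hf hS
    rw [FF_iff] at hA
    obtain ⟨u, rfl⟩ := hA
    obtain ⟨J1, hJ1, hcard, hmod⟩ := mod_class J 21 (by norm_num)
    refine sum_cond' _ (hist p t) (hist_meas p t) u _ fun v hv => ?_
    rcases ({ω | hist p t ω = v}).eq_empty_or_nonempty with he | ⟨ω0, hω0⟩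
    · rw [he]; simp
    have hω0' : hist p t ω0 = v := hω0
    set c := v (Fin.last t) with hc
    have hcω : ∀ ω, hist p t ω = v → CC p ω t = c := fun ω h => congrFun h (Fin.last t)
    have hal : ∀ j ∈ J, alive p (hh p t) j c := by
      intro j hj
      have := hS ω0 (by change hist p t ω0 ∈ u; rw [hω0']; exact hv) j hj
      rw [← hcω ω0 hω0']; exact this
    have hF : ∀ j, ∃ F : Set (IX d → Bool), j ∈ J → Dep F (UT (lyr t) (tube p (hh p t) j) 3 c {x | x p.i0 ≤ hh p t + p.m}) ∧
      Measure.infinitePi ρ F ≤ 3 * ε1 ∧ ∀ ω ∉ F, CC p ω t = c → f j ∈ SA p (t + 1) ω := by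
      intro j
      by_cases hj : j ∈ J
      · obtain ⟨F, hF⟩ := op_fail p ρ ρ0 ρ1 h0 h1 t0 ε1 β hb0 hb1 hβ hδ hgood hB0 t c j (f j) (hf j hj) (hal j hj)
        exact ⟨F, fun _ => hF⟩
      · exact ⟨∅, fun h => absurd h hj⟩
    choose F hF using hF
    calc Measure.infinitePi ρ ({ω | hist p t ω = v} ∩ {ω | ∀ j ∈ J, f j ∉ SA p (t + 1) ω})
        ≤ Measure.infinitePi ρ ({ω | hist p t ω = v} ∩ {ω | ∀ j ∈ J1, ω ∈ F j}) := by
          refine measure_mono fun ω h => ⟨h.1, fun j hj => ?_⟩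
          by_contra hc'
          exact h.2 j (hJ1 hj) ((hF j (hJ1 hj)).2.2 ω hc' (hcω ω h.1))
      _ ≤ (3 * ε1) ^ J1.card * Measure.infinitePi ρ {ω | hist p t ω = v} := by
          refine indep_prod ρ (3 * ε1) F (fun j => UT (lyr t) (tube p (hh p t) j) 3 c {x | x p.i0 ≤ hh p t + p.m})
            (fun j => UT_fin _ _ _ _ _) J1 _ (Past p t c) (Past_fin p t c) (hist_dep p t v)
            (fun j hj => (hF j (hJ1 hj)).1) (fun j hj => (hF j (hJ1 hj)).2.1)
            (fun j hj => past_disj p t c j) (fun j hj j' hj' hne => ?_)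
          have := hmod j hj j' hj'
          exact UT_disj p t c _ this.1 this.2 hne
      _ ≤ (ε ^ 441) ^ J1.card * Measure.infinitePi ρ {ω | hist p t ω = v} := by gcongr
      _ = ε ^ (441 * J1.card) * Measure.infinitePi ρ {ω | hist p t ω = v} := by rw [pow_mul]
      _ ≤ ε ^ J.card * Measure.infinitePi ρ {ω | hist p t ω = v} :=
          mul_le_mul' (pow_le_pow_right_of_le_one' hε (by norm_num at hcard; exact hcard)) le_rfl

lemma full (R : ℕ) (hN : 2 * p.r * R + p.m ≤ p.N) : Full R (SA p 0) := by
  classical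
  intro ω κ h1 h2
  have hr := p.hr
  have hm := p.hm
  have hb : ∀ u : ℤ, u.natAbs ≤ R → -(2 * p.r * R) ≤ 2 * p.r * u ∧ 2 * p.r * u ≤ 2 * p.r * R := by
    intro u hu
    have h3 : -(R : ℤ) ≤ u ∧ u ≤ R := by omega
    constructor <;> nlinarith
  have hR0 : 0 ≤ 2 * p.r * (R : ℤ) := mul_nonneg (by omega) (by omega)
  have ha : ∀ j, -(2 * p.r * R) ≤ ax p κ j ∧ ax p κ j ≤ 2 * p.r * R := by
    intro j
    by_cases hj1 : j = p.i1
    · subst hj1; rw [ax_1]; exact hb _ h1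
    · by_cases hj2 : j = p.i2
      · subst hj2; rw [ax_2]; exact hb _ h2
      · rw [ax_o p _ hj1 hj2]; omega
  have h0 : ax p κ p.i0 = 0 := ax_o p _ p.h01.symm p.h02.symm
  have hh0 : hh p 0 = 0 := by simp [hh]
  refine ⟨ax p κ, by rw [h0, hh0], fun j _ => by constructor <;> linarith, fun x hx => ?_⟩
  have hx' : ∀ j, ax p κ j - p.m ≤ x j ∧ x j ≤ ax p κ j + p.m := hx
  change x ∈ V0 p
  rw [V0, Finset.mem_Icc]
  refine ⟨fun j => ?_, fun j => ?_⟩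
  · have := hx' j; have := ha j
    change -p.N ≤ x j
    linarith
  · have := hx' j; have := ha j
    by_cases hj : j = p.i0
    · subst hj; simp only [if_true]; rw [h0] at *; linarith
    · simp only [hj, if_false]; linarith

end proc

section glue
variable {d : ℕ} (p : Par d) {Lab : Type} (op : Lab → Prop) (ly : Lab → Option JJ → Bool)

def Phi (η : Vtx d → Lab) : IX d → Bool := fun i => ly (η i.1) i.2

lemma Opn_sub (hly : ∀ a j, ly a j = true → op a) (t : ℕ) (η : Vtx d → Lab) : Opn p t (Phi ly η) ⊆ {x | op (η x)} := by
  rintro x ⟨-, h | ⟨-, k, -, h⟩⟩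
  · exact hly _ _ h
  · exact hly _ _ h

lemma CC_AL' (hly : ∀ a j, ly a j = true → op a) (t j : ℕ) (η : Vtx d → Lab)
    (ih : CC p (Phi ly η) t ⊆ AL op (V0 p) (p.B0 * t) η) :
    (grow (Opn p t (Phi ly η)))^[j] (CC p (Phi ly η) t) ⊆ AL op (V0 p) (p.B0 * t + j) η := by
  have := grow_iter_mono (Opn_sub p op ly hly t η) (le_refl j) ih
  refine this.trans ?_
  rw [AL, AL, ← Function.iterate_add_apply, add_comm]

lemma CC_AL (hly : ∀ a j, ly a j = true → op a) (t : ℕ) (η : Vtx d → Lab) :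
    CC p (Phi ly η) t ⊆ AL op (V0 p) (p.B0 * t) η := by
  induction t with
  | zero => exact subset_rfl
  | succ t ih => exact CC_AL' p op ly hly t p.B0 η ih

lemma CC_agree (hly : ∀ a j, ly a j = true → op a) (t : ℕ) (η η' : Vtx d → Lab)
    (h : ∀ x ∈ QL op (V0 p) (p.B0 * t) η, η x = η' x) : ∀ s ≤ t, CC p (Phi ly η') s = CC p (Phi ly η) s := by
  classical
  intro s
  induction s with
  | zero => exact fun _ => rfl
  | succ s ih =>
    intro hs
    have e := ih (by omega)
    have key : ∀ j ≤ p.B0, (grow (Opn p s (Phi ly η')))^[j] (CC p (Phi ly η) s) =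
        (grow (Opn p s (Phi ly η)))^[j] (CC p (Phi ly η) s) := by
      intro j
      induction j with
      | zero => exact fun _ => rfl
      | succ j ihj =>
        intro hj
        rw [Function.iterate_succ_apply', Function.iterate_succ_apply', ihj (by omega)]
        ext x
        rw [mem_grow, mem_grow]
        refine or_congr_right (and_congr_right fun hx => ?_)
        have hle : p.B0 * s + j + 1 ≤ p.B0 * t := by
          have : p.B0 * (s + 1) ≤ p.B0 * t := Nat.mul_le_mul_left _ hs
          rw [mul_add] at this; omega
        have hx2 : x ∈ QL op (V0 p) (p.B0 * t) η := by
          refine QL_mono op (V0 p) η hle ?_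
          rw [QL, Finset.mem_union]
          refine Or.inr (bdy_mono (CC_AL' p op ly hly s j η (CC_AL p op ly hly s η)) (mem_bdy.2 hx))
        have := h x hx2
        simp only [Opn, Phi, mem_setOf_eq, this]
    change (grow (Opn p s (Phi ly η')))^[p.B0] (CC p (Phi ly η') s) = (grow (Opn p s (Phi ly η)))^[p.B0] (CC p (Phi ly η) s)
    rw [e]
    exact key _ le_rfl

lemma AL_height (n : ℕ) (η : Vtx d → Lab) : ∀ x ∈ AL op (V0 p) n η, x p.i0 ≤ p.m + n := by
  induction n with
  | zero =>
    intro x hx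
    have hx' : x ∈ V0 p := hx
    rw [V0, Finset.mem_Icc] at hx'
    have := hx'.2 p.i0
    simpa using this
  | succ n ih =>
    intro x hx
    rw [AL_succ, mem_grow] at hx
    push_cast
    rcases hx with h | ⟨⟨y, hy, ha⟩, -⟩
    · have := ih x h; linarith
    · have := ih y hy
      have := abs_le.1 (adj_coord ha p.i0)
      linarith [this.1]

theorem glue [MeasurableSpace Lab] [Finite Lab] [MeasurableSingletonClass Lab] (swap : Lab → Lab) (lam : Measure Lab)
    [IsProbabilityMeasure lam] (hly : ∀ a j, ly a j = true → op a)
    (hsw : lam.map swap = lam) (val : Lab → Bool) (hv1 : ∀ a, op a → val a = true)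
    (hv2 : ∀ a, op (swap a) → val a = false) (ρ : IX d → Measure Bool) [∀ i, IsProbabilityMeasure (ρ i)]
    (hPm : Measurable (Phi (d := d) ly))
    (hmap : (Measure.infinitePi fun _ : Vtx d => lam).map (Phi ly) = Measure.infinitePi ρ)
    (hle : ∀ t, FF p t ≤ MeasurableSpace.pi)
    (b : ℕ → ℕ) (hb : Monotone b) (hbi : ∀ i, i ≤ b i) (E : ℕ → Set (IX d → Bool)) (hE0 : E 0 = univ)
    (hEm : ∀ i, MeasurableSet[FF p (b i)] (E i)) (hne : ∀ i, ∀ ω ∈ E i, (SA p (b i) ω).Nonempty) (ε : ENNReal)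
    (hε : ∑' i, 2 ^ (p.B0 * b (i + 1)) * Measure.infinitePi ρ (E i \ E (i + 1)) ≤ ε) :
    ∃ Bad : Set (Vtx d → Lab), (Measure.infinitePi fun _ : Vtx d => lam) Bad ≤ ε ∧
      ∀ η ∉ Bad, ∀ ξ, ∃ v, seesWord (fun x => val (η x)) ξ v := by
  have hEm' : ∀ i, MeasurableSet (E i) := fun i => hle _ _ (hEm i)
  refine words_main op swap (V0 p) lam hsw val hv1 hv2 (fun i => Phi ly ⁻¹' E i) (fun i => p.B0 * b i)
    (by simp [hE0]) (fun i => hPm (hEm' i)) ?_ (fun i j hij => Nat.mul_le_mul_left _ (hb hij)) ?_ ε ?_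
  · intro i η η' h hη
    obtain ⟨s, hs⟩ := (FF_iff p).1 (hEm i)
    change Phi ly η' ∈ E i
    have hη' : Phi ly η ∈ E i := hη
    rw [hs] at hη' ⊢
    change hist p (b i) (Phi ly η') ∈ s
    have e : hist p (b i) (Phi ly η') = hist p (b i) (Phi ly η) := by
      funext k
      exact CC_agree p op ly hly (b i) η η' h k (by omega)
    rw [e]; exact hη'
  · intro n
    refine ⟨n + 1, fun η hη => ?_⟩
    obtain ⟨κ, s, hs, -, hsub⟩ := hne _ _ hη
    have hm := p.hm
    have hr := p.hr
    have hss : s ∈ box p.m s := fun j => by constructor <;> linarith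
    refine ⟨s, CC_AL p op ly hly _ η (hsub hss), fun hc => ?_⟩
    have h1 := AL_height p op n η s hc
    rw [hs] at h1
    have h2 : ((n + 1 : ℕ) : ℤ) ≤ b (n + 1) := by exact_mod_cast hbi (n + 1)
    unfold hh at h1
    push_cast at h2
    nlinarith
  · refine le_trans (le_of_eq (tsum_congr fun i => ?_)) hε
    rw [← hmap, Measure.map_apply hPm ((hEm' i).diff (hEm' (i + 1)))]
    rfl
end glue

section bern

noncomputable def bM (q : ℝ) : Measure Bool := ENNReal.ofReal q • Measure.dirac true + ENNReal.ofReal (1 - q) • Measure.dirac false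

lemma bM_apply (q : ℝ) (b : Bool) : bM q {b} = ENNReal.ofReal (if b then q else 1 - q) := by
  cases b <;> simp [bM]

lemma bM_prob {q : ℝ} (h0 : 0 ≤ q) (h1 : q ≤ 1) : IsProbabilityMeasure (bM q) := by
  constructor
  simp only [bM, Measure.add_apply, Measure.smul_apply, measure_univ, smul_eq_mul, mul_one]
  rw [← ENNReal.ofReal_add h0 (by linarith)]; simp

lemma eq_inf {ι E : Type*} [MeasurableSpace E] [Finite E] [MeasurableSingletonClass E] (ρ : ι → Measure E)
    [∀ i, IsProbabilityMeasure (ρ i)] (μ : Measure (ι → E)) [IsProbabilityMeasure μ]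
    (h : ∀ (s : Finset ι) (f : ι → E), μ {ω | ∀ v ∈ s, ω v = f v} = ∏ v ∈ s, ρ v {f v}) : μ = Measure.infinitePi ρ := by
  classical
  obtain ⟨e0⟩ : Nonempty (ι → E) := by
    by_contra hc
    have : IsEmpty (ι → E) := not_nonempty_iff.1 hc
    have h1 : μ univ = 1 := measure_univ
    rw [univ_eq_empty_iff.2 this] at h1
    simp at h1
  refine ((Measure.isProjectiveLimit_infinitePi ρ).unique ?_).symm
  intro s
  refine Measure.ext_of_singleton fun f => ?_
  rw [Measure.map_apply (Finset.measurable_restrict s) (measurableSet_singleton f), Measure.pi_singleton]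
  have := h s (fun i => if hi : i ∈ s then f ⟨i, hi⟩ else e0 i)
  rw [← Finset.prod_attach] at this
  convert this using 1
  · congr 1
    ext ω
    simp only [mem_preimage, mem_singleton_iff, mem_setOf_eq, funext_iff, Finset.restrict, Subtype.forall]
    refine forall_congr' fun v => forall_congr' fun hv => ?_
    rw [dif_pos hv]
  · refine Finset.prod_congr (by simp) fun v _ => ?_
    rw [dif_pos v.2]

lemma fam_eq {ι : Type} {q : ℝ} (h0 : 0 ≤ q) (h1 : q ≤ 1) {μ : Measure (ι → Bool)} (h : IsBernoulliFam q μ) :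
    μ = Measure.infinitePi (fun _ => bM q) := by
  haveI := bM_prob h0 h1
  haveI := h.1
  refine eq_inf _ μ fun s f => ?_
  rw [h.2]
  exact Finset.prod_congr rfl fun v _ => (bM_apply _ _).symm

abbrev Vec := Option JJ → Bool

inductive LabT : Type
  | sm (b : Bool) (v : Vec) : LabT
  | nn : LabT
instance : MeasurableSpace LabT := ⊤
instance : DiscreteMeasurableSpace LabT := ⟨fun _ => trivial⟩
instance : Finite LabT := Finite.of_surjective
  (fun x : Option (Bool × Vec) => match x with | some (b, v) => LabT.sm b v | none => LabT.nn)
  (fun y => by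
    cases y with
    | sm b v => exact ⟨some (b, v), rfl⟩
    | nn => exact ⟨none, rfl⟩)

def lyT : LabT → Vec
  | LabT.sm true v => v
  | _ => fun _ => false

def opT (a : LabT) : Prop := ∃ v, a = LabT.sm true v

def swT : LabT → LabT
  | .sm b v => .sm (!b) v
  | .nn => .nn

def vaT (c : Bool) : LabT → Bool
  | .sm b _ => b
  | .nn => c

noncomputable def lamT (π : Measure Vec) (w : ENNReal) : Measure LabT :=
  (π.restrict {fun _ => false}ᶜ).map (fun v => LabT.sm true v) +
  (π.restrict {fun _ => false}ᶜ).map (fun v => LabT.sm false v) + w • Measure.dirac LabT.nn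

lemma hly_T (a : LabT) (j) (h : lyT a j = true) : opT a := by
  unfold lyT at h
  split at h
  · exact ⟨_, rfl⟩
  · simp at h

lemma hv1_T (c) (a : LabT) (h : opT a) : vaT c a = true := by
  obtain ⟨v, rfl⟩ := h; rfl

lemma hv2_T (c) (a : LabT) (h : opT (swT a)) : vaT c a = false := by
  obtain ⟨v, h⟩ := h
  unfold swT at h
  split at h
  · rename_i b v'
    have : (!b) = true := (LabT.sm.inj h).1
    change b = false
    simpa using this
  · cases h

lemma sw_T (π : Measure Vec) (w : ENNReal) : (lamT π w).map swT = lamT π w := by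
  have hm : Measurable swT := Measurable.of_discrete
  have h1 : ∀ b, Measurable (fun v : Vec => LabT.sm b v) := fun b => Measurable.of_discrete
  unfold lamT
  rw [Measure.map_add _ _ hm, Measure.map_add _ _ hm, Measure.map_smul, Measure.map_map hm (h1 _), Measure.map_map hm (h1 _), Measure.map_dirac' hm]
  rw [add_comm (Measure.map _ _) (Measure.map _ _)]
  rfl

lemma ly_T (π : Measure Vec) [IsProbabilityMeasure π] (w : ENNReal) (hw : π {fun _ => false}ᶜ + w = π {fun _ => false}) : (lamT π w).map lyT = π := by
  have hm : Measurable lyT := Measurable.of_discrete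
  have h1 : ∀ b, Measurable (fun v : Vec => LabT.sm b v) := fun b => Measurable.of_discrete
  unfold lamT
  rw [Measure.map_add _ _ hm, Measure.map_add _ _ hm, Measure.map_smul, Measure.map_map hm (h1 _), Measure.map_map hm (h1 _), Measure.map_dirac' hm]
  have e1 : (lyT ∘ fun v : Vec => LabT.sm true v) = id := rfl
  have e2 : (lyT ∘ fun v : Vec => LabT.sm false v) = fun _ => fun _ => false := rfl
  have e3 : lyT .nn = fun _ => false := rfl
  rw [e1, e2, e3, Measure.map_id, Measure.map_const, Measure.restrict_apply_univ, add_assoc, ← add_smul, hw,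
    ← Measure.restrict_singleton, add_comm, Measure.restrict_add_restrict_compl (measurableSet_singleton _)]

lemma va_T (π : Measure Vec) (w : ENNReal) (c : Bool) : (lamT π w).map (vaT c) =
    π {fun _ => false}ᶜ • Measure.dirac true + π {fun _ => false}ᶜ • Measure.dirac false + w • Measure.dirac c := by
  have hm : Measurable (vaT c) := Measurable.of_discrete
  have h1 : ∀ b, Measurable (fun v : Vec => LabT.sm b v) := fun b => Measurable.of_discrete
  unfold lamT
  rw [Measure.map_add _ _ hm, Measure.map_add _ _ hm, Measure.map_smul, Measure.map_map hm (h1 _), Measure.map_map hm (h1 _), Measure.map_dirac' hm]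
  have e1 : ∀ b, (vaT c ∘ fun v : Vec => LabT.sm b v) = fun _ => b := fun b => rfl
  have e3 : vaT c .nn = c := rfl
  rw [e1, e1, e3, Measure.map_const, Measure.map_const, Measure.restrict_apply_univ]

lemma prob_T (π : Measure Vec) [IsProbabilityMeasure π] (w : ENNReal) (hw : π {fun _ => false}ᶜ + w = π {fun _ => false}) :
    IsProbabilityMeasure (lamT π w) := by
  constructor
  have hm : Measurable lyT := Measurable.of_discrete
  rw [← preimage_univ (f := lyT), ← Measure.map_apply hm MeasurableSet.univ, ly_T π w hw, measure_univ]

lemma Phi_map {d : ℕ} {Lab : Type} [MeasurableSpace Lab] [DiscreteMeasurableSpace Lab] (lam : Measure Lab) [IsProbabilityMeasure lam]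
    (ly : Lab → Vec) (cM : Option JJ → Measure Bool) [∀ j, IsProbabilityMeasure (cM j)]
    (h : lam.map ly = Measure.infinitePi cM) :
    Measurable (Phi (d := d) ly) ∧
    (Measure.infinitePi fun _ : Vtx d => lam).map (Phi ly) = Measure.infinitePi (fun i : IX d => cM i.2) := by
  have hm : Measurable ly := Measurable.of_discrete
  have e : Phi (d := d) ly = (MeasurableEquiv.curry (Vtx d) (Option JJ) Bool).symm ∘ (fun η x => ly (η x)) := rfl
  have h1 : Measurable (fun (η : Vtx d → Lab) x => ly (η x)) := by fun_prop
  refine ⟨by rw [e]; exact (MeasurableEquiv.measurable _).comp h1, ?_⟩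
  rw [e, ← Measure.map_map (MeasurableEquiv.measurable _) h1, Measure.infinitePi_map_pi (fun _ => lam) (fun _ => hm)]
  simp only [h]
  exact Measure.infinitePi_map_curry_symm (fun (_ : Vtx d) => cM)

end bern

section fin

lemma good_transfer {d : ℕ} (cM : Option JJ → Measure Bool) [∀ j, IsProbabilityMeasure (cM j)] (m r : ℤ) (hm : 0 ≤ m) (hr : 0 ≤ r) (β : ENNReal)
    (h : ∀ k : ℤ, r ≤ k → ∀ (i : Fin d) sg s, IsSg sg → (Measure.infinitePi fun _ : Vtx d => cM none) (Good i sg s m k)ᶜ ≤ β)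
    (Z B) (G : Finset (Vtx d)) (hg : good m r Z B G) :
    Measure.infinitePi (fun i : IX d => cM i.2) {ω | ¬ Gd Z B G (opn (lay none ω))} ≤ β := by
  obtain ⟨i, sg, s, k, hs, hk, rfl, rfl, hG⟩ := hg
  refine le_trans ?_ (h k hk i sg s hs)
  have hinj : Function.Injective (fun x : Vtx d => ((x, none) : IX d)) := fun x y h => (Prod.mk.inj h).1
  have e := Measure.map_infinitePi_infinitePi_of_inj (P := fun i : IX d => cM i.2) hinj
  have hmeas : MeasurableSet (Good i sg s m k)ᶜ := (Good_meas i hs s hm (by omega)).compl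
  rw [← e, Measure.map_apply (by fun_prop) hmeas]
  refine measure_mono fun ω hω hg => hω ?_
  obtain ⟨z, h1, h2, h3⟩ := hg
  refine ⟨box m z, ⟨z, h1, rfl⟩, h2, ?_⟩
  rw [hG]
  exact h3

lemma exists_delta {q1 q : ℝ} (h : q1 < q) (hq : q < 1) : ∃ δ : ℝ, 0 < δ ∧ δ < 1 ∧ 1 - q = (1 - q1) * (1 - δ) ^ 9 := by
  have h1 : 0 < 1 - q1 := by linarith
  set y := (1 - q) / (1 - q1)
  have hy0 : 0 < y := div_pos (by linarith) h1
  have hy1 : y < 1 := (div_lt_one h1).2 (by linarith)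
  refine ⟨1 - y ^ ((9 : ℝ)⁻¹), ?_, ?_, ?_⟩
  · have := Real.rpow_lt_one hy0.le hy1 (by norm_num : (0 : ℝ) < 9⁻¹); linarith
  · have := Real.rpow_pos_of_pos hy0 ((9 : ℝ)⁻¹); linarith
  · rw [sub_sub_cancel]
    have := Real.rpow_inv_natCast_pow hy0.le (n := 9) (by norm_num)
    push_cast at this
    rw [this]
    field_simp [y]
    rw [mul_div_cancel₀ _ h1.ne']

lemma val_law {p q : ℝ} (hq : q = min p (1 - p)) (h0 : 0 ≤ q) (π : Measure Vec) (hπ : π {fun _ => false}ᶜ = ENNReal.ofReal q) :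
    ∃ c, (lamT π (ENNReal.ofReal (1 - 2 * q))).map (vaT c) = bM p := by
  rcases le_total p (1 - p) with h | h
  · rw [min_eq_left h] at hq
    refine ⟨false, ?_⟩
    rw [va_T, hπ, add_assoc, ← add_smul, ← ENNReal.ofReal_add h0 (by linarith), bM]
    rw [show q + (1 - 2 * q) = 1 - p by linarith, hq]
  · rw [min_eq_right h] at hq
    refine ⟨true, ?_⟩
    rw [va_T, hπ, add_right_comm, ← add_smul, ← ENNReal.ofReal_add h0 (by linarith), bM]
    rw [show q + (1 - 2 * q) = p by linarith, hq]

theorem core (d : ℕ) (hd : 3 ≤ d) (p q q1 : ℝ) (hq : q = min p (1 - p)) (hq1 : 0 < q1) (hlt : q1 < q)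
    (hp : 0 < (Measure.infinitePi fun _ : Vtx d => bM q1) {ω | PercolatesAt ω (fun _ => 0)}) (s : ℕ) :
    1 ≤ (Measure.infinitePi fun _ : Vtx d => bM p) {ω | ∀ ξ : ℕ → Bool, ∃ v : Vtx d, seesWord ω ξ v} + 2⁻¹ ^ s := by
  have hqp : q ≤ p := hq ▸ min_le_left _ _
  have hqp' : q ≤ 1 - p := hq ▸ min_le_right _ _
  obtain ⟨δ, hδ0, hδ1, hδ⟩ := exists_delta hlt (by linarith)
  haveI P1 : IsProbabilityMeasure (bM q1) := bM_prob hq1.le (by linarith)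
  haveI P2 : IsProbabilityMeasure (bM δ) := bM_prob hδ0.le hδ1.le
  haveI P3 : IsProbabilityMeasure (bM p) := bM_prob (by linarith) (by linarith)
  set cM : Option JJ → Measure Bool := fun j => match j with | none => bM q1 | some _ => bM δ with hcM
  haveI P4 : ∀ j, IsProbabilityMeasure (cM j) := by
    intro j; cases j
    · exact P1
    · exact P2
  -- labels
  set π := Measure.infinitePi cM with hπ
  have hπ0 : π {fun _ => false} = ENNReal.ofReal (1 - q) := by
    rw [hπ, Measure.infinitePi_singleton_of_fintype, Fintype.prod_option]
    change bM q1 {false} * ∏ _ : JJ, bM δ {false} = _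
    rw [bM_apply, bM_apply, Finset.prod_const, hδ, ENNReal.ofReal_mul (by linarith), ENNReal.ofReal_pow (by linarith)]
    simp [JJ]
  have hπ1 : π {fun _ => false}ᶜ = ENNReal.ofReal q := by
    rw [prob_compl_eq_one_sub (measurableSet_singleton _), hπ0, ← ENNReal.ofReal_one, ← ENNReal.ofReal_sub _ (by linarith)]
    congr 1; ring
  have hw : π {fun _ => false}ᶜ + ENNReal.ofReal (1 - 2 * q) = π {fun _ => false} := by
    rw [hπ0, hπ1, ← ENNReal.ofReal_add (by linarith) (by linarith)]
    congr 1; ring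
  set lam := lamT π (ENNReal.ofReal (1 - 2 * q)) with hlam
  haveI P5 : IsProbabilityMeasure lam := prob_T π _ hw
  obtain ⟨c, hc⟩ := val_law hq (by linarith) π hπ1
  obtain ⟨hPm, hPmap⟩ := Phi_map (d := d) lam lyT cM (ly_T π _ hw)
  -- parameters
  set ε : ENNReal := 2⁻¹ ^ 70 with hε
  have hε0 : ε ≠ 0 := pow_ne_zero _ (by simp)
  have hε1 : ε ≤ 1 := pow_le_one' (by simp) _
  set ε1 : ENNReal := ε ^ 441 / 3
  have hε10 : ε1 ≠ 0 := ENNReal.div_ne_zero.2 ⟨pow_ne_zero _ hε0, by simp⟩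
  have hε13 : 3 * ε1 ≤ ε ^ 441 := ENNReal.mul_div_le
  have hε12 : ε1 / 2 ≠ 0 := ENNReal.div_ne_zero.2 ⟨hε10, by simp⟩
  obtain ⟨t0, ht0⟩ : ∃ t0 : ℕ, bM δ {false} ^ t0 ≤ ε1 / 2 := by
    have h1 : bM δ {false} < 1 := by
      rw [bM_apply]; simp [hδ0]
    have := ENNReal.tendsto_pow_atTop_nhds_zero_of_lt_one h1
    exact (((tendsto_order.1 this).2 _ (pos_iff_ne_zero.2 hε12)).exists).imp fun _ h => h.le
  have hf : bM q1 {false} ≠ 0 := by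
    rw [bM_apply]; simp; linarith
  have ht : bM q1 {true} ≠ 0 := by
    rw [bM_apply]; simp [hq1]
  set β := ε1 / 2 * bM q1 {false} ^ t0 with hβ
  have hβ0 : β ≠ 0 := mul_ne_zero hε12 (pow_ne_zero _ hf)
  obtain ⟨m, r', hm, hmr, hG⟩ := hits (bM q1) (⟨0, by omega⟩ : Fin d) hp hf ht β hβ0
  set r := max r' (10 * m + 10) with hr
  set pr0 : Par d := ⟨m, r, 0, 0, ⟨0, by omega⟩, ⟨1, by omega⟩, ⟨2, by omega⟩, hm, le_max_right _ _, by simp, by simp, by simp⟩ with hpr0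
  obtain ⟨R, b, hb, hbi, hlev⟩ := levels 70 (3 * tcard pr0) s le_rfl
  set pr : Par d := ⟨m, r, 2 * r * R + m, 3 * tcard pr0, ⟨0, by omega⟩, ⟨1, by omega⟩, ⟨2, by omega⟩, hm, le_max_right _ _, by simp, by simp, by simp⟩ with hpr
  have hK : Ker (Measure.infinitePi (fun i : IX d => cM i.2)) (FF pr) (SA pr) ε := by
    refine ker pr (fun i : IX d => cM i.2) (bM q1) (bM δ) (fun _ => rfl) (fun _ _ => rfl) t0 ε1 β ε hf prob_le_one le_rfl ht0 ?_ le_rfl hε1 hε13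
    exact good_transfer cM m r hm (by omega) β (fun k hk => hG k (by omega))
  obtain ⟨E, hE0, hEm, hEn, hEs⟩ := hlev hK (full pr R le_rfl)
  obtain ⟨Bad, hB1, hB2⟩ := glue pr opT lyT swT lam hly_T (sw_T π _) (vaT c) (hv1_T c) (hv2_T c)
    (fun i : IX d => cM i.2) hPm hPmap hK.le b hb hbi E hE0 hEm hEn (2⁻¹ ^ s) hEs
  have hvm : Measurable (vaT c) := Measurable.of_discrete
  have hvmap : (Measure.infinitePi fun _ : Vtx d => lam).map (fun η x => vaT c (η x)) = Measure.infinitePi fun _ : Vtx d => bM p := by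
    rw [Measure.infinitePi_map_pi (fun _ => lam) (fun _ => hvm)]
    simp only [hlam, hc]
  have hvmm : Measurable (fun (η : Vtx d → LabT) x => vaT c (η x)) := by fun_prop
  calc (1 : ENNReal) = (Measure.infinitePi fun _ : Vtx d => lam) univ := measure_univ.symm
    _ ≤ (Measure.infinitePi fun _ : Vtx d => lam) Badᶜ + (Measure.infinitePi fun _ : Vtx d => lam) Bad := by
        refine (measure_mono ?_).trans (measure_union_le _ _)
        rw [compl_union_self]
    _ ≤ _ := by
        refine add_le_add ?_ hB1
        rw [← hvmap]
        refine le_trans (measure_mono ?_) (Measure.le_map_apply hvmm.aemeasurable _)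
        intro η hη
        exact hB2 η hη

lemma perc_all {d : ℕ} (hd : 3 ≤ d) (ω : Config d) (h : ∀ v, ω v = true) : PercolatesAt ω (fun _ => 0) := by
  classical
  set i0 : Fin d := ⟨0, by omega⟩
  refine ⟨Set.range fun a : ℤ => (Pi.single i0 a : Vtx d), ⟨0, by ext j; simp⟩,
    Set.infinite_range_of_injective (Pi.single_injective (M := fun _ : Fin d => ℤ) i0), fun u _ => h u, ?_⟩
  rintro _ ⟨a, rfl⟩ _ ⟨b, rfl⟩
  have key : ∀ (σ : ℤ) (k : ℕ), σ ^ 2 = 1 → adj (Pi.single i0 (a + σ * k) : Vtx d) (Pi.single i0 (a + σ * (k + 1 : ℕ))) := by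
    intro σ k hσ
    unfold adj
    rw [Finset.sum_eq_single i0]
    · simp only [Pi.single_eq_same]; push_cast; linear_combination hσ
    · intro j _ hj; simp [hj]
    · simp
  rcases le_total a b with hab | hab
  · refine ⟨(b - a).natAbs, fun i => Pi.single i0 (a + 1 * i), by simp, ?_, fun i _ => key 1 i (by norm_num), fun i _ => ⟨_, rfl⟩⟩
    change (Pi.single i0 (a + 1 * ((b - a).natAbs : ℤ)) : Vtx d) = _
    congr 1; omega
  · refine ⟨(b - a).natAbs, fun i => Pi.single i0 (a + (-1) * i), by simp, ?_, fun i _ => key (-1) i (by norm_num), fun i _ => ⟨_, rfl⟩⟩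
    change (Pi.single i0 (a + (-1) * ((b - a).natAbs : ℤ)) : Vtx d) = _
    congr 1; omega

theorem main_thm
    (d : ℕ) (hd : 3 ≤ d)
    (ℙ : ℝ → Measure (Config d))
    (hP : ∀ q : ℝ, 0 ≤ q → q ≤ 1 → IsBernoulliFam q (ℙ q))
    (p : ℝ) (hp : pcSite d ℙ < p) (hp' : p < 1 - pcSite d ℙ) :
    ℙ p {ω | ∀ ξ : ℕ → Bool, ∃ v : Vtx d, seesWord ω ξ v} = 1 := by
  have hpc : 0 ≤ pcSite d ℙ := Real.sInf_nonneg fun x hx => hx.1.1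
  have hne : {p : ℝ | p ∈ Set.Icc (0 : ℝ) 1 ∧ 0 < ℙ p {ω | PercolatesAt ω (fun _ => 0)}}.Nonempty := by
    refine ⟨1, by simp, ?_⟩
    obtain ⟨h1, h2⟩ := hP 1 (by norm_num) le_rfl
    have h3 : ∀ᵐ ω ∂(ℙ 1), ∀ v, ω v = true := by
      rw [ae_all_iff]
      intro v
      have := h2 {v} (fun _ => false)
      simp only [Finset.mem_singleton, forall_eq, Finset.prod_singleton] at this
      rw [ae_iff]
      simpa using this
    have h4 : ∀ᵐ ω ∂(ℙ 1), PercolatesAt ω (fun _ => 0) := h3.mono fun ω h => perc_all hd ω h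
    rw [pos_iff_ne_zero]
    intro h0
    have h5 : ∀ᵐ ω ∂(ℙ 1), False := by
      have h6 : ∀ᵐ ω ∂(ℙ 1), ¬ PercolatesAt ω (fun _ => 0) := by
        rw [ae_iff]; simpa using h0
      filter_upwards [h4, h6] with ω a b using b a
    simp [ae_iff] at h5
  set q := min p (1 - p) with hq
  have hqpc : pcSite d ℙ < q := lt_min hp (by linarith)
  obtain ⟨q1, ⟨⟨hq0, hq1⟩, hpos⟩, hlt⟩ := exists_lt_of_csInf_lt hne hqpc
  have hq1pos : 0 < q1 := by
    rcases hq0.lt_or_eq with h | h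
    · exact h
    · exfalso
      subst h
      obtain ⟨h1, h2⟩ := hP 0 le_rfl (by norm_num)
      have := h2 {fun _ => 0} (fun _ => true)
      simp only [Finset.mem_singleton, forall_eq, Finset.prod_singleton] at this
      refine hpos.ne' (measure_mono_null ?_ (this.trans (by simp)))
      rintro ω ⟨C, h0, -, h, -⟩
      exact h _ h0
  have e1 := fam_eq hq0 hq1 (hP q1 hq0 hq1)
  have e2 := fam_eq (by linarith) (by linarith) (hP p (by linarith) (by linarith))
  haveI := (hP p (by linarith) (by linarith)).1
  rw [e1] at hpos
  have hc := core d hd p q q1 hq hq1pos hlt hpos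
  rw [← e2] at hc
  refine le_antisymm prob_le_one ?_
  have ht : Filter.Tendsto (fun s : ℕ => ℙ p {ω | ∀ ξ : ℕ → Bool, ∃ v : Vtx d, seesWord ω ξ v} + (2⁻¹ : ENNReal) ^ s) Filter.atTop
      (nhds (ℙ p {ω | ∀ ξ : ℕ → Bool, ∃ v : Vtx d, seesWord ω ξ v} + 0)) :=
    tendsto_const_nhds.add (ENNReal.tendsto_pow_atTop_nhds_zero_of_lt_one (by simp))
  rw [add_zero] at ht
  exact ge_of_tendsto' ht hc
end fin

/-- **No exceptional words** : for `d ≥ 3` and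
`p ∈ (p_c^site(ℤ^d), 1 − p_c^site(ℤ^d))`, almost surely every infinite binary word is
seen from some vertex of `ℤ^d`. -/
theorem no_exceptional_words
    (d : ℕ) (hd : 3 ≤ d)
    (ℙ : ℝ → Measure (Config d))
    (hP : ∀ q : ℝ, 0 ≤ q → q ≤ 1 → IsBernoulliFam q (ℙ q))
    (p : ℝ) (hp : pcSite d ℙ < p) (hp' : p < 1 - pcSite d ℙ) :
    ℙ p {ω | ∀ ξ : ℕ → Bool, ∃ v : Vtx d, seesWord ω ξ v} = 1 := by
  exact main_thm d hd ℙ hP p hp hp'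

end PercWords
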